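/- arXiv:2506.01684 — 4 statements merged into one kernel-verified Lean document; each statement's English description precedes it below -/
import Mathlib

section
/- Let q be a positive integer and let ϰ ∈ (0, 1/2) be irrational. Define φ on the circle ℝ/ℤ (using representatives in [0,1)) by φ(x) = 0 for x ∈ [0, 1−2ϰ), φ(x) = 1 for x ∈ [1−2ϰ, 1−ϰ), and φ(x) = −1 for x ∈ [1−ϰ, 1). Define h : (ℝ/ℤ) × ZMod(q+1) → (ℝ/ℤ) × ZMod(q+1) by h(x, k) = (x + 2ϰ, k + φ(x)). Then h preserves the product of the Haar probability measure on ℝ/ℤ and the uniform probability measure on ZMod(q+1), and h is ergodic with respect to this measure. -/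
open MeasureTheory
open scoped ENNReal

noncomputable instance (n : ℕ) : MeasurableSpace (ZMod n) := ⊤

open Filter Set Topology
open scoped symmDiff

theorem Irrational.exists_pos_le_abs_natCast_mul_sub {ξ : ℝ} (hξ : Irrational ξ) (K : ℕ) :
    ∃ ε > 0, ∀ j : ℕ, 0 < j → j ≤ K → ∀ p : ℤ, ε < |j * ξ - p| := by
  have key : ∀ᶠ ε in 𝓝[>] (0 : ℝ), ∀ j ∈ Finset.Icc 1 K, ε < |j * ξ - round (j * ξ)| := by
    refine (Filter.eventually_all_finset _).2 fun j hj => ?_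
    refine nhdsWithin_le_nhds (gt_mem_nhds (abs_pos.2 ?_))
    have hj' : j ≠ 0 := by have := (Finset.mem_Icc.1 hj).1; omega
    exact ((hξ.natCast_mul hj').sub_intCast _).ne_zero
  obtain ⟨ε, hε, hpos⟩ := (key.and self_mem_nhdsWithin).exists
  exact ⟨ε, hpos, fun j h0 hjK p =>
    (hε j (Finset.mem_Icc.2 ⟨h0, hjK⟩)).trans_le (round_le _ p)⟩

theorem Irrational.exists_forall_lt_abs_natCast_mul_sub {ξ : ℝ} (hξ : Irrational ξ) (K : ℕ) :
    ∃ M > K, ∀ j : ℕ, 0 < j → j < M → ∀ p : ℤ, 1 / (2 * (M : ℝ)) < |j * ξ - p| := by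
  obtain ⟨ε, hε, hK⟩ := hξ.exists_pos_le_abs_natCast_mul_sub K
  have hex : ∃ m : ℕ, 0 < m ∧ ∃ p : ℤ, |m * ξ - p| < ε := by
    obtain ⟨n, hn⟩ := exists_nat_one_div_lt hε
    obtain ⟨k, hk, -, hkn⟩ := Real.exists_nat_abs_mul_sub_round_le ξ n.succ_pos
    refine ⟨k, hk, _, (hkn.trans ?_).trans_lt hn⟩
    gcongr
    simp
  classical
  obtain ⟨hM, p', hp'⟩ := Nat.find_spec hex
  have hmin := fun j => Nat.find_min hex (m := j)
  set M := Nat.find hex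
  refine ⟨M, ?_, fun j h0 hj p => ?_⟩
  · by_contra! h
    exact (hK M hM h p').not_gt hp'
  · have hle : ε ≤ |j * ξ - p| := by
      by_contra! h
      exact hmin j hj ⟨h0, p, h⟩
    have hjR : (0 : ℝ) < j := by exact_mod_cast h0
    have hjM : (j : ℝ) < M := by exact_mod_cast hj
    have hint : ((j * p' - M * p : ℤ) : ℝ) = M * (j * ξ - p) - j * (M * ξ - p') := by
      push_cast; ring
    have hlt : |j * (M * ξ - p')| < |M * (j * ξ - p)| := by
      rw [abs_mul, abs_mul, abs_of_pos hjR, abs_of_pos (hjR.trans hjM)]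
      exact mul_lt_mul'' hjM (hp'.trans_le hle) hjR.le (abs_nonneg _)
    have hne : (j * p' - M * p : ℤ) ≠ 0 := by
      intro h
      rw [h, Int.cast_zero, eq_comm, sub_eq_zero] at hint
      rw [hint] at hlt
      exact lt_irrefl _ hlt
    have hone : (1 : ℝ) ≤ |M * (j * ξ - p) - j * (M * ξ - p')| := by
      rw [← hint]
      exact_mod_cast Int.one_le_abs hne
    have := hone.trans (abs_sub _ _)
    rw [abs_mul (M : ℝ), abs_of_pos (hjR.trans hjM)] at hlt this
    rw [div_lt_iff₀ (by linarith)]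
    linarith

theorem floor_add_add_eq {t s z : ℝ} (hz : ∀ p : ℤ, t < |z - p|) (hs : -t < s) (hs' : s < 0) :
    ⌊z + s + t⌋ = ⌊z + s⌋ := by
  have h1 := Int.floor_le (z + s)
  have h2 := Int.lt_floor_add_one (z + s)
  refine Int.floor_eq_iff.2 ⟨by linarith, ?_⟩
  by_contra! h
  have := hz (⌊z + s⌋ + 1)
  push_cast at this
  rcases lt_abs.1 this with h | h <;> linarith

/-- The Birkhoff sum of the cocycle: a sum of second differences of the floor function. -/
noncomputable def birkhoffFloor (κ : ℝ) (N : ℕ) (y : ℝ) : ℤ :=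
  ∑ j ∈ Finset.range N,
    (⌊y + 2 * j * κ + 2 * κ⌋ + ⌊y + 2 * j * κ⌋ - 2 * ⌊y + 2 * j * κ + κ⌋)

theorem birkhoffFloor_add {κ t y : ℝ} {N m : ℕ} (hm : m < N) (ht : t < 1)
    (hκ : ∀ j : ℕ, 0 < j → j ≤ 2 * N → ∀ p : ℤ, t < |j * κ - p|) (p : ℤ)
    (hy : -t < y + (2 * m + 1) * κ - p) (hy' : y + (2 * m + 1) * κ - p < 0) :
    birkhoffFloor κ N (y + t) = birkhoffFloor κ N y - 2 := by
  have hκ' : ∀ i : ℤ, i ≠ 0 → -(2 * N) ≤ i → i ≤ 2 * N → ∀ p : ℤ, t < |i * κ - p| := by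
    intro i hi hiN hiN' p
    obtain ⟨n, rfl | rfl⟩ := i.eq_nat_or_neg
    · exact_mod_cast hκ n (by omega) (by omega) p
    · have := hκ n (by omega) (by omega) (-p)
      rw [← abs_neg]
      convert this using 2
      push_cast; ring
  have hfl : ∀ i : ℤ, i ≠ 2 * m + 1 → 0 ≤ i → i ≤ 2 * N → ⌊y + t + i * κ⌋ = ⌊y + i * κ⌋ := by
    intro i hi h0 hN
    have := floor_add_add_eq (t := t) (s := y + (2 * m + 1) * κ - p)
      (z := (i - (2 * m + 1) : ℤ) * κ - (- p : ℤ))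
      (fun k => by
        have := hκ' (i - (2 * m + 1)) (by omega) (by omega) (by omega) (-p + k)
        convert this using 2
        push_cast; ring) hy hy'
    convert this using 2 <;> push_cast <;> ring
  have hfm : ⌊y + t + (2 * m + 1) * κ⌋ = ⌊y + (2 * m + 1) * κ⌋ + 1 := by
    have h1 : ⌊y + t + (2 * m + 1) * κ⌋ = p := Int.floor_eq_iff.2 ⟨by linarith, by linarith⟩
    have h2 : ⌊y + (2 * m + 1) * κ⌋ = p - 1 :=
      Int.floor_eq_iff.2 ⟨by push_cast; linarith, by push_cast; linarith⟩
    omega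
  have hterm : ∀ j ∈ Finset.range N,
      (⌊y + t + 2 * j * κ + 2 * κ⌋ + ⌊y + t + 2 * j * κ⌋ - 2 * ⌊y + t + 2 * j * κ + κ⌋) =
      (⌊y + 2 * j * κ + 2 * κ⌋ + ⌊y + 2 * j * κ⌋ - 2 * ⌊y + 2 * j * κ + κ⌋) -
        if m = j then 2 else 0 := by
    intro j hj
    rw [Finset.mem_range] at hj
    have e0 := hfl (2 * j) (by omega) (by omega) (by omega)
    have e2 := hfl (2 * j + 2) (by omega) (by omega) (by omega)
    push_cast at e0 e2
    simp only [add_mul, ← add_assoc, one_mul] at e0 e2 hfm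
    rw [e0, e2]
    split_ifs with hmj
    · subst hmj
      rw [hfm]; ring
    · have e1 := hfl (2 * j + 1) (by omega) (by omega) (by omega)
      push_cast at e1
      simp only [add_mul, ← add_assoc, one_mul] at e1
      rw [e1]; ring
  rw [birkhoffFloor, birkhoffFloor, Finset.sum_congr rfl hterm, Finset.sum_sub_distrib,
    Finset.sum_ite_eq, if_pos (Finset.mem_range.2 hm)]

theorem step_eq_floor {κ : ℝ} (h0 : 0 < κ) (h1 : κ < 1 / 2) (y : ℝ) :
    (if Int.fract y < 1 - 2 * κ then 0 else if Int.fract y < 1 - κ then 1 else -1 : ℤ) =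
      ⌊y + 2 * κ⌋ + ⌊y⌋ - 2 * ⌊y + κ⌋ := by
  have e := Int.floor_add_fract y
  have f0 := Int.fract_nonneg y
  have f1 := Int.fract_lt_one y
  split_ifs with ha hb
  · have : ⌊y + 2 * κ⌋ = ⌊y⌋ := Int.floor_eq_iff.2 ⟨by linarith, by linarith⟩
    have : ⌊y + κ⌋ = ⌊y⌋ := Int.floor_eq_iff.2 ⟨by linarith, by linarith⟩
    omega
  · have : ⌊y + 2 * κ⌋ = ⌊y⌋ + 1 :=
      Int.floor_eq_iff.2 ⟨by push_cast; linarith, by push_cast; linarith⟩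
    have : ⌊y + κ⌋ = ⌊y⌋ := Int.floor_eq_iff.2 ⟨by linarith, by linarith⟩
    omega
  · have : ⌊y + 2 * κ⌋ = ⌊y⌋ + 1 :=
      Int.floor_eq_iff.2 ⟨by push_cast; linarith, by push_cast; linarith⟩
    have : ⌊y + κ⌋ = ⌊y⌋ + 1 :=
      Int.floor_eq_iff.2 ⟨by push_cast; linarith, by push_cast; linarith⟩
    omega

theorem AddCircle.ergodic_add_right_of_irrational {a : ℝ} (ha : Irrational a) :
    Ergodic (· + (a : AddCircle (1 : ℝ))) := by
  rw [AddCircle.ergodic_add_right, addOrderOf_eq_zero_iff']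
  intro n hn h
  rw [← AddCircle.coe_nsmul, AddCircle.coe_eq_zero_iff] at h
  obtain ⟨k, hk⟩ := h
  refine (ha.natCast_mul hn.ne').ne_int k ?_
  simpa using hk.symm

theorem AddCircle.exists_forall_volume_symmDiff_lt {ι : Type*} [Finite ι]
    {E : ι → Set (AddCircle (1 : ℝ))} (hE : ∀ i, MeasurableSet (E i)) {ε : ℝ≥0∞} (hε : 0 < ε) :
    ∃ δ > 0, ∀ t : ℝ, |t| < δ → ∀ i,
      volume (((· + (t : AddCircle (1 : ℝ))) ⁻¹' E i) ∆ E i) < ε := by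
  let f : C(ℝ × AddCircle (1 : ℝ), AddCircle (1 : ℝ)) :=
    ⟨fun p => p.2 + (p.1 : AddCircle (1 : ℝ)),
      continuous_snd.add ((AddCircle.continuous_mk' 1).comp continuous_fst)⟩
  have h : ∀ᶠ t : ℝ in 𝓝 0, ∀ i,
      volume (((· + (t : AddCircle (1 : ℝ))) ⁻¹' E i) ∆ E i) < ε := by
    refine eventually_all.2 fun i => ?_
    have := tendsto_measure_symmDiff_preimage_nhds_zero (f.curry.continuous.tendsto 0)
      (.of_forall fun t => measurePreserving_add_right volume (t : AddCircle (1 : ℝ)))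
      (measurePreserving_add_right volume ((0 : ℝ) : AddCircle (1 : ℝ)))
      (hE i).nullMeasurableSet (measure_ne_top volume _)
    have := this.eventually (gt_mem_nhds hε)
    filter_upwards [this] with t ht
    have h0 : f.curry 0 ⁻¹' E i = E i := by ext x; simp [f]
    rw [h0] at ht
    exact ht
  obtain ⟨δ, hδ, h⟩ := Metric.eventually_nhds_iff.1 h
  exact ⟨δ, hδ, fun t ht => h (by simpa using ht)⟩

section Cocycle

variable {n : ℕ} {κ : ℝ} {φ : AddCircle (1 : ℝ) → ℤ} {E : ZMod n → Set (AddCircle (1 : ℝ))}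

theorem mem_add_birkhoffFloor_iff
    (hφ : ∀ y : ℝ, φ (y : AddCircle (1 : ℝ)) = ⌊y + 2 * κ⌋ + ⌊y⌋ - 2 * ⌊y + κ⌋)
    (hinv : ∀ x k, x + ((2 * κ : ℝ) : AddCircle (1 : ℝ)) ∈ E (k + φ x) ↔ x ∈ E k)
    (N : ℕ) (y : ℝ) (k : ZMod n) :
    ((y + 2 * N * κ : ℝ) : AddCircle (1 : ℝ)) ∈ E (k + birkhoffFloor κ N y) ↔
      (y : AddCircle (1 : ℝ)) ∈ E k := by
  induction N with
  | zero => simp [birkhoffFloor]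
  | succ N ih =>
    have h := hinv ((y + 2 * N * κ : ℝ) : AddCircle (1 : ℝ)) (k + birkhoffFloor κ N y)
    rw [hφ, ← AddCircle.coe_add, add_assoc k, ← Int.cast_add] at h
    rw [← ih, ← h, birkhoffFloor, Finset.sum_range_succ, ← birkhoffFloor]
    have e : y + 2 * ((N + 1 : ℕ) : ℝ) * κ = y + 2 * N * κ + 2 * κ := by push_cast; ring
    rw [e]

/-- Translation by a small `t` barely changes the sets `E k`, whereas it changes the Birkhoff sums
of the cocycle by `-2` on a set of measure bounded below. -/
theorem volume_setOf_forall_mem_add_two_iff_ne_zero [NeZero n] (hirr : Irrational κ)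
    (hφ : ∀ y : ℝ, φ (y : AddCircle (1 : ℝ)) = ⌊y + 2 * κ⌋ + ⌊y⌋ - 2 * ⌊y + κ⌋)
    (hinv : ∀ x k, x + ((2 * κ : ℝ) : AddCircle (1 : ℝ)) ∈ E (k + φ x) ↔ x ∈ E k)
    (hE : ∀ k, MeasurableSet (E k)) :
    volume {x | ∀ k, x ∈ E (k + 2) ↔ x ∈ E k} ≠ 0 := by
  intro hG
  have hn : (0 : ℝ) < n := by exact_mod_cast NeZero.pos n
  obtain ⟨δ, hδ, hsmall⟩ := AddCircle.exists_forall_volume_symmDiff_lt hE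
    (ε := ENNReal.ofReal (1 / (64 * n))) (by positivity)
  obtain ⟨K, hK⟩ := exists_nat_one_div_lt hδ
  obtain ⟨M, hMK, hM⟩ := hirr.exists_forall_lt_abs_natCast_mul_sub (K + 4)
  have hM0 : (0 : ℝ) < M := by exact_mod_cast (show 0 < M by omega)
  set t : ℝ := 1 / (2 * M) with ht
  have ht0 : 0 < t := by positivity
  have ht1 : t < 1 := by
    rw [ht, div_lt_one (by positivity)]
    have : (1 : ℝ) ≤ M := by exact_mod_cast (show 1 ≤ M by omega)
    linarith
  have htδ : |t| < δ := by
    rw [abs_of_pos ht0]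
    refine lt_of_le_of_lt ?_ hK
    rw [ht]
    apply one_div_le_one_div_of_le (by positivity)
    have : (K : ℝ) + 1 ≤ M := by exact_mod_cast (show K + 1 ≤ M by omega)
    linarith
  obtain ⟨N, hN, hN'⟩ : ∃ N : ℕ, 2 * N < M ∧ M ≤ 4 * N := ⟨(M - 1) / 2, by omega, by omega⟩
  have hgap : ∀ j : ℕ, 0 < j → j ≤ 2 * N → ∀ p : ℤ, t < |j * κ - p| :=
    fun j h0 hj => hM j h0 (by omega)
  let B : Set (AddCircle (1 : ℝ)) :=
    ⋃ k, ((· + (t : AddCircle (1 : ℝ))) ⁻¹' E k) ∆ E k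
  have hB : volume B ≤ ENNReal.ofReal (1 / 64) := by
    calc volume B ≤ ∑ k : ZMod n, volume (((· + (t : AddCircle (1 : ℝ))) ⁻¹' E k) ∆ E k) :=
          measure_iUnion_fintype_le _ _
      _ ≤ ∑ _k : ZMod n, ENNReal.ofReal (1 / (64 * n)) :=
          Finset.sum_le_sum fun k _ => (hsmall t htδ k).le
      _ = ENNReal.ofReal (1 / 64) := by
          rw [Finset.sum_const, Finset.card_univ, ZMod.card, ← ENNReal.ofReal_nsmul]
          congr 1
          simp only [nsmul_eq_mul]
          field_simp
  have hBiff : ∀ x ∉ B, ∀ k, x + (t : AddCircle (1 : ℝ)) ∈ E k ↔ x ∈ E k := by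
    intro x hx k
    simp only [B, mem_iUnion, not_exists, mem_symmDiff, mem_preimage] at hx
    have := hx k
    tauto
  let c : ℕ → AddCircle (1 : ℝ) := fun m => ((-(t / 2) - (2 * m + 1) * κ : ℝ) : AddCircle (1 : ℝ))
  let A : ℕ → Set (AddCircle (1 : ℝ)) := fun m => Metric.closedBall (c m) (t / 4)
  have hA : ∀ m, ∀ x ∈ A m, ∃ y : ℝ, (y : AddCircle (1 : ℝ)) = x ∧ ∃ p : ℤ,
      -t < y + (2 * m + 1) * κ - p ∧ y + (2 * m + 1) * κ - p < 0 := by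
    intro m x hx
    obtain ⟨y, rfl⟩ := QuotientAddGroup.mk_surjective x
    refine ⟨y, rfl, round (y - (-(t / 2) - (2 * m + 1) * κ)), ?_⟩
    have hx : ‖((y - (-(t / 2) - (2 * m + 1) * κ) : ℝ) : AddCircle (1 : ℝ))‖ ≤ t / 4 := by
      rw [AddCircle.coe_sub, ← dist_eq_norm]; exact hx
    rw [UnitAddCircle.norm_eq, abs_le] at hx
    constructor <;> linarith [hx.1, hx.2]
  have hdisj : (Finset.range N : Set ℕ).PairwiseDisjoint A := by
    have aux : ∀ m m', m < m' → m' < N → Disjoint (A m) (A m') := by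
      intro m m' hmm hm'
      refine Metric.closedBall_disjoint_closedBall ?_
      rw [dist_eq_norm, ← AddCircle.coe_sub, UnitAddCircle.norm_eq]
      have := hgap (2 * (m' - m)) (by omega) (by omega)
        (round (-(t / 2) - (2 * m + 1) * κ - (-(t / 2) - (2 * m' + 1) * κ)))
      push_cast [Nat.cast_sub hmm.le] at this
      calc t / 4 + t / 4 < t := by linarith
        _ < _ := this
        _ = _ := by congr 2; ring
    intro m hm m' hm' hne
    simp only [Finset.coe_range, mem_Iio] at hm hm'
    rcases hne.lt_or_gt with h | h
    · exact aux m m' h hm'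
    · exact (aux m' m h hm).symm
  have hAvol : ENNReal.ofReal (1 / 16) ≤ volume (⋃ m ∈ Finset.range N, A m) := by
    rw [measure_biUnion_finset hdisj fun m _ => Metric.isClosed_closedBall.measurableSet]
    simp only [A, AddCircle.volume_closedBall]
    rw [Finset.sum_const, Finset.card_range, ← ENNReal.ofReal_nsmul,
      min_eq_right (by linarith), nsmul_eq_mul]
    apply ENNReal.ofReal_le_ofReal
    have : (M : ℝ) ≤ 4 * N := by exact_mod_cast hN'
    rw [ht]
    field_simp
    linarith
  have hsub : (⋃ m ∈ Finset.range N, A m) ⊆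
      {x | ∀ k, x ∈ E (k + 2) ↔ x ∈ E k} ∪ (B ∪
        (· + ((2 * N * κ : ℝ) : AddCircle (1 : ℝ))) ⁻¹' B) := by
    intro x hx
    simp only [mem_iUnion, Finset.mem_range] at hx
    obtain ⟨m, hm, hx⟩ := hx
    obtain ⟨y, rfl, p, hy, hy'⟩ := hA m x hx
    by_contra! hcon
    simp only [mem_union, not_or, mem_preimage] at hcon
    obtain ⟨hxG, hxB, hxB'⟩ := hcon
    refine hxG fun k => ?_
    rw [← mem_add_birkhoffFloor_iff hφ hinv N y k, AddCircle.coe_add, ← hBiff _ hxB',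
      ← hBiff _ hxB, ← AddCircle.coe_add, ← mem_add_birkhoffFloor_iff hφ hinv N (y + t) (k + 2),
      birkhoffFloor_add hm ht1 hgap p hy hy', ← AddCircle.coe_add, ← AddCircle.coe_add]
    have e : k + 2 + ((birkhoffFloor κ N y - 2 : ℤ) : ZMod n) = k + birkhoffFloor κ N y := by
      push_cast; ring
    rw [e, add_right_comm y t]
  have hle := hAvol.trans (measure_mono hsub)
  have hpre : volume ((· + ((2 * N * κ : ℝ) : AddCircle (1 : ℝ))) ⁻¹' B) = volume B :=
    measure_preimage_add_right volume _ B
  have hlt : ENNReal.ofReal (1 / 16) ≤ ENNReal.ofReal (1 / 64 + 1 / 64) := by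
    refine hle.trans ((measure_union_le _ _).trans ?_)
    rw [hG, zero_add, ENNReal.ofReal_add (by norm_num) (by norm_num)]
    refine (measure_union_le _ _).trans ?_
    rw [hpre]
    gcongr
  rw [ENNReal.ofReal_le_ofReal_iff (by norm_num)] at hlt
  norm_num at hlt

theorem ae_forall_mem_add_two_iff [NeZero n] (hirr : Irrational κ)
    (hφ : ∀ y : ℝ, φ (y : AddCircle (1 : ℝ)) = ⌊y + 2 * κ⌋ + ⌊y⌋ - 2 * ⌊y + κ⌋)
    (hinv : ∀ x k, x + ((2 * κ : ℝ) : AddCircle (1 : ℝ)) ∈ E (k + φ x) ↔ x ∈ E k)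
    (hE : ∀ k, MeasurableSet (E k)) :
    ∀ᵐ x, ∀ k, x ∈ E (k + 2) ↔ x ∈ E k := by
  have hirr' : Irrational (2 * κ) := by exact_mod_cast hirr.natCast_mul two_ne_zero
  have hmeas : MeasurableSet {x | ∀ k, x ∈ E (k + 2) ↔ x ∈ E k} := by
    rw [ofPred_forall]
    exact .iInter fun k => (hE _).iff (hE _)
  have hpre : (· + ((2 * κ : ℝ) : AddCircle (1 : ℝ))) ⁻¹' {x | ∀ k, x ∈ E (k + 2) ↔ x ∈ E k} =
      {x | ∀ k, x ∈ E (k + 2) ↔ x ∈ E k} := by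
    ext x
    simp only [mem_preimage, mem_ofPred_eq]
    rw [← (Equiv.addRight (φ x : ZMod n)).forall_congr_right]
    simp only [Equiv.coe_addRight, add_right_comm _ (φ x : ZMod n) 2, hinv]
  exact ((AddCircle.ergodic_add_right_of_irrational hirr').measure_self_or_compl_eq_zero
    hmeas hpre).resolve_left (volume_setOf_forall_mem_add_two_iff_ne_zero hirr hφ hinv hE)

theorem mem_add_intCast_iff_of_even {x : AddCircle (1 : ℝ)}
    (hx : ∀ k, x ∈ E (k + 2) ↔ x ∈ E k) {a b : ℤ} (hab : Even (a - b)) (k : ZMod n) :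
    x ∈ E (k + a) ↔ x ∈ E (k + b) := by
  have key : ∀ c : ℤ, ∀ k, x ∈ E (k + 2 * c) ↔ x ∈ E k := by
    intro c
    induction c with
    | zero => simp
    | succ i ih =>
      intro k
      rw [← ih k, ← hx (k + 2 * (i : ℤ))]
      push_cast
      ring_nf
    | pred i ih =>
      intro k
      rw [← ih k, ← hx (k + 2 * ((-i - 1 : ℤ)))]
      push_cast
      ring_nf
  obtain ⟨c, hc⟩ := hab
  rw [← key c (k + b)]
  have : a = b + 2 * c := by omega
  rw [this]
  push_cast
  rw [add_assoc]

theorem AddCircle.measurable_equivIco_zero :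
    Measurable fun x : AddCircle (1 : ℝ) => (AddCircle.equivIco 1 0 x : ℝ) :=
  measurable_subtype_coe.comp (AddCircle.measurableEquivIco 1 0).measurable

theorem AddCircle.equivIco_zero_coe (y : ℝ) :
    (AddCircle.equivIco 1 0 (y : AddCircle (1 : ℝ)) : ℝ) = Int.fract y := by
  simp [AddCircle.coe_equivIco_mk_apply]

theorem AddCircle.two_nsmul_coe (y : ℝ) :
    2 • (y : AddCircle (1 : ℝ)) = ((2 * y : ℝ) : AddCircle (1 : ℝ)) := by
  rw [two_nsmul, ← AddCircle.coe_add, two_mul]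

/-- Once the sets `E k` depend only on the parity of `k`, the cocycle becomes a coboundary on the
double cover of the circle, where rotation by `κ` is ergodic. -/
theorem ae_forall_mem_or_ae_forall_notMem [NeZero n] (hirr : Irrational κ)
    (hφ : ∀ y : ℝ, φ (y : AddCircle (1 : ℝ)) = ⌊y + 2 * κ⌋ + ⌊y⌋ - 2 * ⌊y + κ⌋)
    (hinv : ∀ x k, x + ((2 * κ : ℝ) : AddCircle (1 : ℝ)) ∈ E (k + φ x) ↔ x ∈ E k)
    (hE : ∀ k, MeasurableSet (E k)) :
    (∀ᵐ x, ∀ k, x ∈ E k) ∨ ∀ᵐ x, ∀ k, x ∉ E k := by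
  have hdbl : MeasurePreserving (fun x : AddCircle (1 : ℝ) => 2 • x) :=
    (AddCircle.ergodic_nsmul one_lt_two).toMeasurePreserving
  have hpar : ∀ᵐ x : AddCircle (1 : ℝ), ∀ k, 2 • x ∈ E (k + 2) ↔ 2 • x ∈ E k :=
    hdbl.quasiMeasurePreserving.ae (p := fun x => ∀ k, x ∈ E (k + 2) ↔ x ∈ E k)
      (ae_forall_mem_add_two_iff hirr hφ hinv hE)
  let s : AddCircle (1 : ℝ) → ℤ := fun x => ⌊2 * (AddCircle.equivIco 1 0 x : ℝ)⌋
  have hs : Measurable s := (AddCircle.measurable_equivIco_zero.const_mul 2).floor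
  have hs_coe : ∀ y : ℝ, Even (s y - ⌊2 * y⌋) := by
    intro y
    have : s y = ⌊2 * y⌋ - 2 * ⌊y⌋ := by
      simp only [s, AddCircle.equivIco_zero_coe, Int.fract]
      rw [← Int.floor_sub_intCast]
      push_cast
      ring_nf
    rw [this]
    exact ⟨-⌊y⌋, by ring⟩
  let D : ZMod n → Set (AddCircle (1 : ℝ)) := fun k => {x | 2 • x ∈ E (k + s x)}
  have hD : ∀ k, MeasurableSet (D k) := by
    intro k
    have : D k = ⋃ a : ℤ, s ⁻¹' {a} ∩ (fun x => 2 • x) ⁻¹' E (k + a) := by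
      ext x; simp [D]
    rw [this]
    exact .iUnion fun a => (hs (measurableSet_singleton a)).inter (hdbl.measurable (hE _))
  have hDrot : ∀ k, (· + (κ : AddCircle (1 : ℝ))) ⁻¹' D k =ᵐ[volume] D k := by
    intro k
    rw [Filter.eventuallyEq_set]
    filter_upwards [hpar, (measurePreserving_add_right volume
      (κ : AddCircle (1 : ℝ))).quasiMeasurePreserving.tendsto_ae.eventually hpar] with x hx hx'
    obtain ⟨y, rfl⟩ := QuotientAddGroup.mk_surjective x
    change 2 • ((y + κ : ℝ) : AddCircle (1 : ℝ)) ∈ E (k + s ((y + κ : ℝ) : AddCircle (1 : ℝ))) ↔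
      2 • (y : AddCircle (1 : ℝ)) ∈ E (k + s (y : AddCircle (1 : ℝ)))
    replace hx : ∀ k, 2 • (y : AddCircle (1 : ℝ)) ∈ E (k + 2) ↔ _ := hx
    replace hx' : ∀ k, 2 • ((y + κ : ℝ) : AddCircle (1 : ℝ)) ∈ E (k + 2) ↔ _ := hx'
    have hstep := hinv ((2 * y : ℝ) : AddCircle (1 : ℝ))
      (k + (2 * ⌊2 * y + κ⌋ - ⌊2 * y⌋ : ℤ))
    rw [hφ, ← AddCircle.coe_add, add_assoc k, ← Int.cast_add, ← mul_add, ← AddCircle.two_nsmul_coe,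
      ← AddCircle.two_nsmul_coe] at hstep
    have hy := hs_coe y
    have hyκ := hs_coe (y + κ)
    rw [mem_add_intCast_iff_of_even hx' hyκ, mul_add]
    rw [mul_add] at hstep
    have e : 2 * ⌊2 * y + κ⌋ - ⌊2 * y⌋ + (⌊2 * y + 2 * κ⌋ + ⌊2 * y⌋ - 2 * ⌊2 * y + κ⌋) =
      ⌊2 * y + 2 * κ⌋ := by ring
    rw [e] at hstep
    rw [hstep]
    refine mem_add_intCast_iff_of_even hx ?_ k
    rw [Int.even_iff] at hy ⊢
    omega
  have hDhalf : ∀ k, ∀ᵐ x, x + ((1 / 2 : ℝ) : AddCircle (1 : ℝ)) ∈ D k ↔ x ∈ D (k + 1) := by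
    intro k
    filter_upwards [hpar] with x hx
    obtain ⟨y, rfl⟩ := QuotientAddGroup.mk_surjective x
    change 2 • ((y + 1 / 2 : ℝ) : AddCircle (1 : ℝ)) ∈
        E (k + s ((y + 1 / 2 : ℝ) : AddCircle (1 : ℝ))) ↔
      2 • (y : AddCircle (1 : ℝ)) ∈ E (k + 1 + s (y : AddCircle (1 : ℝ)))
    replace hx : ∀ k, 2 • (y : AddCircle (1 : ℝ)) ∈ E (k + 2) ↔ _ := hx
    have hy := hs_coe y
    have hy' := hs_coe (y + 1 / 2)
    have e : 2 • ((y + 1 / 2 : ℝ) : AddCircle (1 : ℝ)) = 2 • (y : AddCircle (1 : ℝ)) := by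
      rw [AddCircle.two_nsmul_coe, AddCircle.two_nsmul_coe, mul_add, mul_one_div_cancel two_ne_zero,
        AddCircle.coe_add_period]
    rw [mul_add, mul_one_div_cancel two_ne_zero, Int.floor_add_one] at hy'
    have e' : k + 1 + (s (y : AddCircle (1 : ℝ)) : ZMod n) =
        k + ((1 + s (y : AddCircle (1 : ℝ)) : ℤ) : ZMod n) := by
      push_cast; ring
    rw [e, e']
    refine mem_add_intCast_iff_of_even hx ?_ k
    rw [Int.even_iff] at hy hy' ⊢
    omega
  have key : ∀ P : Prop → Prop, (∀ᵐ x, P (x ∈ D 0)) → ∀ᵐ x, ∀ k, P (x ∈ E k) := by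
    intro P h0
    have hnat : ∀ m : ℕ, ∀ᵐ x, P (x ∈ D m) := by
      intro m
      induction m with
      | zero => simpa using h0
      | succ m ih =>
        filter_upwards [hDhalf m, (measurePreserving_add_right volume ((1 / 2 : ℝ) :
          AddCircle (1 : ℝ))).quasiMeasurePreserving.tendsto_ae.eventually ih] with x hx hx'
        rw [Nat.cast_succ, ← hx]
        exact hx'
    have hall : ∀ᵐ x, ∀ k, P (x ∈ D k) :=
      ae_all_iff.2 fun k => by simpa using hnat k.val
    rw [← hdbl.map_eq, ae_map_iff hdbl.aemeasurable]
    · filter_upwards [hall] with x hx k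
      simpa [D] using hx (k - s x)
    · rw [ofPred_forall]
      exact .iInter fun k => (measurable_mem.2 (hE k)) (.of_discrete (s := {p | P p}))
  exact ((AddCircle.ergodic_add_right_of_irrational hirr).quasiErgodic.ae_mem_or_ae_notMem₀
    (hD 0).nullMeasurableSet (hDrot 0)).imp (key id) (key Not)

end Cocycle

/-- Ergodicity of the skew product `h(x,k) = (x + 2ϰ, k + φ(x))` over the
irrational rotation by `2ϰ` on `ℝ/ℤ`, with the three-valued piecewise constant
cocycle `φ`, with respect to the product of the Haar probability measure on
`ℝ/ℤ` and the uniform probability measure on `ZMod (q+1)`. -/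
theorem skew_product_ergodic
    (q : ℕ) (hq : 0 < q)
    (ϰ : ℝ) (hϰ₀ : 0 < ϰ) (hϰ₁ : ϰ < 1/2) (hirr : Irrational ϰ)
    (φ : AddCircle (1:ℝ) → ℤ)
    (hφ : ∀ y : ℝ, φ (↑y : AddCircle (1:ℝ)) =
      if Int.fract y < 1 - 2*ϰ then 0
      else if Int.fract y < 1 - ϰ then 1
      else -1)
    (h : AddCircle (1:ℝ) × ZMod (q+1) → AddCircle (1:ℝ) × ZMod (q+1))
    (hh : ∀ p, h p = (p.1 + (↑(2*ϰ) : AddCircle (1:ℝ)), p.2 + (φ p.1 : ZMod (q+1))))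
    (μ : Measure (AddCircle (1:ℝ) × ZMod (q+1)))
    (hμ : μ = (volume : Measure (AddCircle (1:ℝ))).prod
      ((((q : ℝ≥0∞) + 1)⁻¹) • Measure.count)) :
    MeasurePreserving h μ μ ∧ Ergodic h μ := by
  have hdisc : DiscreteMeasurableSpace (ZMod (q + 1)) := ⟨fun _ => trivial⟩
  have hφ' : ∀ y : ℝ, φ (y : AddCircle (1 : ℝ)) = ⌊y + 2 * ϰ⌋ + ⌊y⌋ - 2 * ⌊y + ϰ⌋ :=
    fun y => (hφ y).trans (step_eq_floor hϰ₀ hϰ₁ y)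
  have hφm : Measurable φ := by
    have : φ = fun x => ⌊(AddCircle.equivIco 1 0 x : ℝ) + 2 * ϰ⌋ +
        ⌊(AddCircle.equivIco 1 0 x : ℝ)⌋ - 2 * ⌊(AddCircle.equivIco 1 0 x : ℝ) + ϰ⌋ := by
      ext x
      rw [← hφ', AddCircle.coe_equivIco]
    rw [this]
    have := AddCircle.measurable_equivIco_zero
    fun_prop
  have hmp : MeasurePreserving h μ μ := by
    obtain rfl : h = fun p => (p.1 + ((2 * ϰ : ℝ) : AddCircle (1 : ℝ)),
      p.2 + (φ p.1 : ZMod (q + 1))) := funext hh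
    subst hμ
    refine (measurePreserving_add_right volume ((2 * ϰ : ℝ) : AddCircle (1 : ℝ))).skew_product
      (g := fun x k => k + (φ x : ZMod (q + 1))) ?_ (.of_forall fun x => ?_)
    · have : Measurable fun p : ZMod (q + 1) × ℤ => p.1 + (p.2 : ZMod (q + 1)) :=
        measurable_of_countable _
      exact this.comp (measurable_snd.prodMk (hφm.comp measurable_fst))
    · rw [Measure.map_smul, map_add_right_eq_self]
  refine ⟨hmp, hmp, ⟨fun s hs hinv => ?_⟩⟩
  have hcases := ae_forall_mem_or_ae_forall_notMem (E := fun k => (fun x => (x, k)) ⁻¹' s) hirr hφ'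
    (fun x k => by
      conv_rhs => rw [← hinv]
      simp [hh]) fun k => measurable_prodMk_right hs
  rw [Filter.eventuallyConst_set]
  refine hcases.imp (fun hc => ?_) fun hc => ?_
  · rw [hμ]
    refine (Measure.ae_prod_iff_ae_ae hs).2 ?_
    filter_upwards [hc] with x hx
    exact .of_forall hx
  · rw [hμ]
    refine (Measure.ae_prod_iff_ae_ae hs.compl).2 ?_
    filter_upwards [hc] with x hx
    exact .of_forall hx
end

section
/- Let q be a positive integer, let ϰ ∈ (0,1) be irrational, and let c ∈ ZMod(q+1). Define Ĥ : (ℝ/ℤ) × ZMod(q+1) → (ℝ/ℤ) × ZMod(q+1) by Ĥ(x, k) = (x + ϰ, c − k) if the representative of x in [0,1) lies in [0, 1−ϰ), and Ĥ(x, k) = (x + ϰ, c + 1 − k) if the representative lies in [1−ϰ, 1). Then Ĥ preserves the product of the Haar probability measure on ℝ/ℤ and the uniform probability measure on ZMod(q+1), and Ĥ is ergodic with respect to this measure. -/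
open MeasureTheory
open scoped ENNReal

section SkewProduct

open Filter Topology Set

/-- The fibre coordinate of the `i`-th iterate of the skew product. -/
noncomputable def fiberOrbit {N : ℕ} (ϰ : ℝ) (c : ZMod N) (y : ℝ) (k : ZMod N) : ℕ → ZMod N
  | 0 => k
  | i + 1 => c + ((⌊y + (i + 1 : ℕ) * ϰ⌋ - ⌊y + i * ϰ⌋ : ℤ) : ZMod N) - fiberOrbit ϰ c y k i

/-- A set of `(ℝ/ℤ) × ZMod N` which is strictly invariant under the skew product. -/
def SkewInvariant {N : ℕ} (ϰ : ℝ) (c : ZMod N) (A : Set (AddCircle (1 : ℝ) × ZMod N)) : Prop :=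
  ∀ (y : ℝ) (k : ZMod N),
    (((y + ϰ : ℝ) : AddCircle (1 : ℝ)), c + ((⌊y + ϰ⌋ - ⌊y⌋ : ℤ) : ZMod N) - k) ∈ A ↔
      ((y : AddCircle (1 : ℝ)), k) ∈ A

/-- Base points over which the fibre of `A` is invariant under translation by `d`. -/
def shiftFixed {N : ℕ} (A : Set (AddCircle (1 : ℝ) × ZMod N)) (d : ZMod N) :
    Set (AddCircle (1 : ℝ)) :=
  {x | ∀ k, (x, k) ∈ A ↔ (x, k + d) ∈ A}

/-- Base points at which the fibres of `A` over `x` and `x + t` differ. -/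
def fiberChange {N : ℕ} (A : Set (AddCircle (1 : ℝ) × ZMod N)) (t : AddCircle (1 : ℝ)) :
    Set (AddCircle (1 : ℝ)) :=
  {x | ∃ k, ¬ ((x, k) ∈ A ↔ (x + t, k) ∈ A)}

section Combinatorics

variable {N : ℕ} {ϰ : ℝ} {c : ZMod N} {A : Set (AddCircle (1 : ℝ) × ZMod N)}

lemma SkewInvariant.iterate (hA : SkewInvariant ϰ c A) (y : ℝ) (k : ZMod N) (i : ℕ) :
    (((y + i * ϰ : ℝ) : AddCircle (1 : ℝ)), fiberOrbit ϰ c y k i) ∈ A ↔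
      ((y : AddCircle (1 : ℝ)), k) ∈ A := by
  induction i with
  | zero => simp [fiberOrbit]
  | succ i ih =>
    rw [← ih, ← hA (y + i * ϰ), fiberOrbit,
      show y + (i + 1 : ℕ) * ϰ = y + i * ϰ + ϰ by push_cast; ring]

/-- If the orbits of `y` and `y + δ` are separated by an integer only at the time `j` before `m`,
then the fibre maps differ by a translation by `±2`. -/
lemma fiberOrbit_translate (y δ : ℝ) (k : ZMod N) {m j : ℕ} (hjm : j < m)
    (hj : ⌊y + δ + j * ϰ⌋ = ⌊y + j * ϰ⌋ + 1)
    (hne : ∀ i ≤ m, i ≠ j → ⌊y + δ + i * ϰ⌋ = ⌊y + i * ϰ⌋) (hj₀ : 0 < j) :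
    fiberOrbit ϰ c (y + δ) (k - (-1) ^ j * 2) m = fiberOrbit ϰ c y k m := by
  have key : ∀ i ≤ m, fiberOrbit ϰ c (y + δ) (k - (-1) ^ j * 2) i =
      fiberOrbit ϰ c y k i + ((⌊y + δ + i * ϰ⌋ - ⌊y + i * ϰ⌋ : ℤ) : ZMod N) -
        (if i ≤ j then (-1) ^ i * ((-1) ^ j * 2) else 0) := by
    intro i
    induction i with
    | zero =>
      intro _
      have h0 := hne 0 (by omega) (by omega)
      have h0' : ⌊y + δ⌋ = ⌊y⌋ := by simpa using h0
      simp [fiberOrbit, h0']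
    | succ i ih =>
      intro hi
      rw [fiberOrbit, fiberOrbit, ih (by omega)]
      rcases lt_trichotomy i j with h | h | h
      · rw [hne i (by omega) (by omega), if_pos (by omega), if_pos (by omega)]
        push_cast
        ring
      · subst h
        rw [hj, if_pos le_rfl, if_neg (by omega)]
        have : ((-1 : ZMod N) ^ i * ((-1) ^ i * 2)) = 2 := by
          rw [← mul_assoc, ← mul_pow]; simp
        rw [this]
        push_cast
        ring
      · rw [hne i (by omega) (by omega), if_neg (by omega), if_neg (by omega)]
        push_cast
        ring
  rw [key m le_rfl, hne m le_rfl (by omega), if_neg (by omega)]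
  simp

lemma fiberOrbit_eq_add_two_mul (y : ℝ) (k : ZMod N) (m : ℕ) :
    ∃ e : ZMod N, fiberOrbit ϰ c y k m =
      k + (m * c + ((⌊y + m * ϰ⌋ - ⌊y⌋ : ℤ) : ZMod N)) + 2 * e := by
  induction m with
  | zero => exact ⟨0, by simp [fiberOrbit]⟩
  | succ m ih =>
    obtain ⟨e, he⟩ := ih
    refine ⟨e - fiberOrbit ϰ c y k m, ?_⟩
    rw [fiberOrbit]
    push_cast at he ⊢
    linear_combination he

lemma add_mem_iff_of_mem_shiftFixed {x : AddCircle (1 : ℝ)} {d : ZMod N} (hx : x ∈ shiftFixed A d)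
    (k : ZMod N) (n : ℕ) : (x, k + n * d) ∈ A ↔ (x, k) ∈ A := by
  induction n with
  | zero => simp
  | succ n ih =>
    rw [← ih, hx (k + n * d), Nat.cast_succ, add_mul, one_mul, add_assoc]

lemma mem_shiftFixed_neg {x : AddCircle (1 : ℝ)} {d : ZMod N} (hx : x ∈ shiftFixed A (-d)) :
    x ∈ shiftFixed A d := fun k ↦ by
  simpa using (hx (k + d)).symm

lemma SkewInvariant.preimage_shiftFixed (hA : SkewInvariant ϰ c A) (d : ZMod N) :
    (· + (ϰ : AddCircle (1 : ℝ))) ⁻¹' shiftFixed A d = shiftFixed A d := by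
  ext x
  induction x using QuotientAddGroup.induction_on with
  | H y =>
    set s : ZMod N := c + ((⌊y + ϰ⌋ - ⌊y⌋ : ℤ) : ZMod N) with hs
    have h : ∀ k, (((y : AddCircle (1 : ℝ)) + (ϰ : AddCircle (1 : ℝ)), k) ∈ A ↔
        ((y : AddCircle (1 : ℝ)), s - k) ∈ A) := fun k ↦ by
      rw [← hA y (s - k), ← hs, sub_sub_cancel, AddCircle.coe_add]
    constructor
    · intro hx k
      have := hx (s - k - d)
      rw [h, h] at this
      convert! this.symm using 3 <;> ring
    · intro hx k
      rw [h, h, hx (s - (k + d))]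
      ring_nf

lemma SkewInvariant.mem_shiftFixed_two (hA : SkewInvariant ϰ c A) (y δ : ℝ) {m j : ℕ}
    (hjm : j < m) (hj₀ : 0 < j) (hj : ⌊y + δ + j * ϰ⌋ = ⌊y + j * ϰ⌋ + 1)
    (hne : ∀ i ≤ m, i ≠ j → ⌊y + δ + i * ϰ⌋ = ⌊y + i * ϰ⌋)
    (h₁ : (y : AddCircle (1 : ℝ)) ∉ fiberChange A (δ : ℝ))
    (h₂ : ((y + m * ϰ : ℝ) : AddCircle (1 : ℝ)) ∉ fiberChange A (δ : ℝ)) :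
    (y : AddCircle (1 : ℝ)) ∈ shiftFixed A 2 := by
  simp only [fiberChange, mem_ofPred_eq, not_exists, not_not] at h₁ h₂
  have h : (y : AddCircle (1 : ℝ)) ∈ shiftFixed A (-((-1) ^ j * 2)) := fun k ↦ by
    rw [← sub_eq_add_neg, ← hA.iterate y k m, h₂, h₁, ← AddCircle.coe_add, ← AddCircle.coe_add,
      ← hA.iterate (y + δ) _ m, fiberOrbit_translate y δ k hjm hj hne hj₀,
      show y + m * ϰ + δ = y + δ + m * ϰ by ring]
  rcases neg_one_pow_eq_or (ZMod N) j with h' | h'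
  · rw [h', one_mul] at h
    exact mem_shiftFixed_neg h
  · simpa [h'] using h

lemma SkewInvariant.mem_shiftFixed_one [NeZero N] (hA : SkewInvariant ϰ c A) (y θ : ℝ) {m : ℕ}
    {l : ℤ} (hm : m * ϰ + m * (c.val : ℝ) = 2 * l + 1 + θ) (hy₀ : 0 ≤ Int.fract y + θ)
    (hy₁ : Int.fract y + θ < 1) (h₁ : (y : AddCircle (1 : ℝ)) ∉ fiberChange A (θ : ℝ))
    (h₂ : (y : AddCircle (1 : ℝ)) ∈ shiftFixed A 2) :
    (y : AddCircle (1 : ℝ)) ∈ shiftFixed A 1 := by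
  simp only [fiberChange, mem_ofPred_eq, not_exists, not_not] at h₁
  intro k
  obtain ⟨e, he⟩ := fiberOrbit_eq_add_two_mul (ϰ := ϰ) (c := c) y k m
  have hfl : ⌊y + m * ϰ⌋ = ⌊y⌋ + 2 * l + 1 - m * c.val := by
    rw [Int.floor_eq_iff]
    have := Int.floor_add_fract y
    push_cast
    constructor <;> linarith
  have hc : ((c.val : ℕ) : ZMod N) = c := ZMod.natCast_zmod_val c
  have hcoe : ((y + m * ϰ : ℝ) : AddCircle (1 : ℝ)) = (y : AddCircle (1 : ℝ)) + (θ : ℝ) := by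
    rw [← AddCircle.coe_add, ← sub_eq_zero, ← AddCircle.coe_sub, AddCircle.coe_eq_zero_iff]
    refine ⟨2 * l + 1 - m * c.val, ?_⟩
    simp only [zsmul_eq_mul]
    push_cast
    linarith
  rw [← hA.iterate y k m, he, hcoe, ← h₁, hfl,
    ← add_mem_iff_of_mem_shiftFixed h₂ (k + 1) ((e + l : ZMod N)).val, ZMod.natCast_zmod_val]
  push_cast
  rw [hc]
  ring_nf

end Combinatorics

section Diophantine

lemma exists_rat_large_den {ξ : ℝ} (hξ : Irrational ξ) (M : ℕ) :
    ∃ r : ℚ, |ξ - r| < 1 / (r.den : ℝ) ^ 2 ∧ M ≤ r.den := by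
  by_contra! h
  refine Real.infinite_rat_abs_sub_lt_one_div_den_sq_of_irrational hξ ?_
  obtain ⟨B, hB⟩ := exists_nat_gt (|ξ| * M + M)
  refine Set.Finite.of_finite_image (f := fun r : ℚ ↦ (r.num, r.den))
    (((Set.finite_Icc (-(B : ℤ)) B).prod (Set.finite_Iio M)).subset ?_) ?_
  · rintro _ ⟨r, hr, rfl⟩
    have hd : r.den < M := h r hr
    refine ⟨?_, hd⟩
    have hr' : |ξ - r| < 1 / (r.den : ℝ) ^ 2 := hr
    have hd1 : (1 : ℝ) ≤ r.den := by exact_mod_cast r.den_pos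
    have h1 : |(r : ℝ)| ≤ |ξ| + 1 := by
      have h2 : 1 / (r.den : ℝ) ^ 2 ≤ 1 := by
        rw [div_le_one (by positivity)]
        nlinarith
      have h3 := abs_sub_abs_le_abs_sub (r : ℝ) ξ
      rw [abs_sub_comm] at h3
      linarith
    have h4 : (r.num : ℝ) = r * r.den := by exact_mod_cast (Rat.mul_den_eq_num r).symm
    have h5 : |(r.num : ℝ)| ≤ B := by
      rw [h4, abs_mul, abs_of_nonneg (by positivity : (0 : ℝ) ≤ (r.den : ℝ))]
      have : (r.den : ℝ) ≤ M := by exact_mod_cast hd.le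
      nlinarith [abs_nonneg ξ, abs_nonneg (r : ℝ)]
    have h6 : |r.num| ≤ (B : ℤ) := by exact_mod_cast h5
    exact abs_le.mp h6
  · intro a _ b _ hab
    simp only [Prod.mk.injEq] at hab
    exact Rat.ext hab.1 hab.2

lemma le_abs_mul_sub_of_rat_approx {ξ : ℝ} {r : ℚ} (hr : |ξ - r| < 1 / (r.den : ℝ) ^ 2) {j : ℕ}
    (hj₀ : 0 < j) (hj : 2 * j ≤ r.den) (l : ℤ) : 1 / (2 * (r.den : ℝ)) ≤ |j * ξ - l| := by
  have hd : (0 : ℝ) < r.den := by exact_mod_cast r.den_pos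
  have hne : j * r.num - l * r.den ≠ 0 := by
    intro h
    have h1 : (r.den : ℤ) ∣ j * r.num := ⟨l, by linarith⟩
    have h2 : IsCoprime (r.den : ℤ) r.num := by
      rw [Int.isCoprime_iff_nat_coprime]
      simpa using r.reduced.symm
    have h3 : r.den ∣ j := by exact_mod_cast h2.dvd_of_dvd_mul_right h1
    have := Nat.le_of_dvd hj₀ h3
    omega
  have h4 : (r.num : ℝ) = r * r.den := by exact_mod_cast (Rat.mul_den_eq_num r).symm
  have h5 : 1 / (r.den : ℝ) ≤ |j * (r : ℝ) - l| := by
    have h6 : (1 : ℝ) ≤ |((j * r.num - l * r.den : ℤ) : ℝ)| := by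
      exact_mod_cast Int.one_le_abs hne
    push_cast at h6
    rw [h4, show (j : ℝ) * (r * r.den) - l * r.den = (j * r - l) * r.den by ring, abs_mul,
      abs_of_pos hd] at h6
    rwa [div_le_iff₀ hd]
  have h7 : |(j : ℝ) * (ξ - r)| ≤ 1 / (2 * (r.den : ℝ)) := by
    rw [abs_mul, Nat.abs_cast]
    have h8 : (j : ℝ) ≤ r.den / 2 := by
      have : ((2 * j : ℕ) : ℝ) ≤ r.den := by exact_mod_cast hj
      push_cast at this
      linarith
    calc (j : ℝ) * |ξ - r| ≤ (r.den / 2) * (1 / (r.den : ℝ) ^ 2) := by gcongr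
      _ = _ := by field_simp
  have h9 : 1 / (r.den : ℝ) = 1 / (2 * (r.den : ℝ)) + 1 / (2 * (r.den : ℝ)) := by
    field_simp
    norm_num
  have h10 := abs_sub_abs_le_abs_sub ((j : ℝ) * r - l) (-(j * (ξ - r)))
  rw [abs_neg, show (j : ℝ) * r - l - -(j * (ξ - r)) = j * ξ - l by ring] at h10
  linarith

lemma exists_nat_mul_near_half {a : ℝ} (ha : Irrational a) {ε : ℝ} (hε : 0 < ε) :
    ∃ (m : ℕ) (l : ℤ), |m * a - l - 1 / 2| < ε := by
  have hd : Dense (AddSubgroup.closure {a, 1} : Set ℝ) :=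
    dense_addSubgroupClosure_pair_iff.mpr (by simpa using ha)
  obtain ⟨z, hz, hz'⟩ := Metric.dense_iff.mp hd (1 / 2) ε hε
  obtain ⟨u, v, rfl⟩ := AddSubgroup.mem_closure_pair.mp hz'
  rw [Metric.mem_ball, Real.dist_eq] at hz
  simp only [zsmul_eq_mul, mul_one] at hz
  obtain ⟨m, rfl | rfl⟩ := u.eq_nat_or_neg
  · refine ⟨m, -v, ?_⟩
    push_cast at hz ⊢
    convert hz using 2
    ring
  · refine ⟨m, v - 1, ?_⟩
    rw [← abs_neg]
    push_cast at hz ⊢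
    convert hz using 2
    ring

end Diophantine

section Measure

open scoped symmDiff

lemma coe_mem_setOf_le_equivIco (y δ : ℝ) :
    (y : AddCircle (1 : ℝ)) ∈ {x | 1 - δ ≤ (AddCircle.equivIco (1 : ℝ) 0 x : ℝ)} ↔
      1 - δ ≤ Int.fract y := by
  simp [AddCircle.coe_equivIco_mk_apply]

lemma measurable_equivIco : Measurable fun x ↦ (AddCircle.equivIco (1 : ℝ) 0 x : ℝ) :=
  measurable_subtype_coe.comp (AddCircle.measurableEquivIco (T := 1) 0).measurable

lemma volume_setOf_equivIco_mem {s : Set ℝ} (hs : MeasurableSet s) (hs' : s ⊆ Ioo 0 1) :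
    volume s ≤ volume {x : AddCircle (1 : ℝ) | (AddCircle.equivIco (1 : ℝ) 0 x : ℝ) ∈ s} := by
  have hm : MeasurableSet {x : AddCircle (1 : ℝ) | (AddCircle.equivIco (1 : ℝ) 0 x : ℝ) ∈ s} :=
    measurable_equivIco hs
  rw [AddCircle.add_projection_respects_measure 1 0 hm]
  refine measure_mono fun y hy ↦ ?_
  have h := hs' hy
  refine ⟨?_, h.1, by linarith [h.2]⟩
  change (AddCircle.equivIco (1 : ℝ) 0 (y : AddCircle (1 : ℝ)) : ℝ) ∈ s
  rw [AddCircle.coe_equivIco_mk_apply]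
  simpa [Int.fract_eq_self.mpr ⟨h.1.le, h.2⟩] using hy

lemma ergodic_add_coe {ϰ : ℝ} (h : Irrational ϰ) :
    Ergodic (· + (ϰ : AddCircle (1 : ℝ))) volume := by
  have : Fact ((0 : ℝ) < 1) := ⟨one_pos⟩
  rw [AddCircle.ergodic_add_right, ← AddCircle.denseRange_zsmul_iff]
  have := AddCircle.denseRange_zsmul_coe_iff (p := 1) (a := ϰ)
  rw [this]
  simpa using h

variable {N : ℕ} {A : Set (AddCircle (1 : ℝ) × ZMod N)}

lemma measurableSet_fiber (hA : MeasurableSet A) (k : ZMod N) : MeasurableSet {x | (x, k) ∈ A} :=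
  measurable_prodMk_right hA

variable [NeZero N]

lemma measurableSet_shiftFixed (hA : MeasurableSet A) (d : ZMod N) :
    MeasurableSet (shiftFixed A d) := by
  simp only [shiftFixed, Set.ofPred_forall]
  exact MeasurableSet.iInter fun k ↦ (measurableSet_fiber hA k).iff (measurableSet_fiber hA _)

lemma tendsto_volume_fiberChange (hA : MeasurableSet A) :
    Tendsto (fun t ↦ volume (fiberChange A t)) (𝓝 0) (𝓝 0) := by
  have h (k : ZMod N) : Tendsto (fun t : AddCircle (1 : ℝ) ↦
      volume (((· + t) ⁻¹' {x | (x, k) ∈ A}) ∆ ((· + 0) ⁻¹' {x | (x, k) ∈ A}))) (𝓝 0) (𝓝 0) := by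
    let f : C(AddCircle (1 : ℝ) × AddCircle (1 : ℝ), AddCircle (1 : ℝ)) :=
      ⟨fun p ↦ p.2 + p.1, by fun_prop⟩
    exact tendsto_measure_symmDiff_preimage_nhds_zero (f := f.curry) (g := f.curry 0)
      (f.curry.continuous.tendsto 0)
      (.of_forall fun t ↦ measurePreserving_add_right volume t)
      (measurePreserving_add_right volume 0) (measurableSet_fiber hA k).nullMeasurableSet
      (measure_ne_top _ _)
  have hsum := tendsto_finsetSum Finset.univ fun k _ ↦ h k
  rw [Finset.sum_const_zero] at hsum
  refine tendsto_of_tendsto_of_tendsto_of_le_of_le tendsto_const_nhds hsum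
    (fun _ ↦ zero_le) fun t ↦ ?_
  refine (measure_mono ?_).trans (measure_iUnion_fintype_le volume _)
  rintro x ⟨k, hk⟩
  refine mem_iUnion.mpr ⟨k, ?_⟩
  simp only [mem_symmDiff, mem_preimage, mem_ofPred_eq, add_zero]
  tauto

lemma SkewInvariant.ae_mem_shiftFixed {ϰ : ℝ} (hϰ : Irrational ϰ) {c d : ZMod N}
    (hA : SkewInvariant ϰ c A) (hm : MeasurableSet A) (h : volume (shiftFixed A d) ≠ 0) :
    ∀ᵐ x, x ∈ shiftFixed A d := by
  refine ((ergodic_add_coe hϰ).ae_mem_or_ae_notMem (measurableSet_shiftFixed hm d)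
    (hA.preimage_shiftFixed d)).resolve_right fun h' ↦ h ?_
  simpa [ae_iff] using h'

end Measure

section Ergodicity

variable {N : ℕ} [NeZero N] {A : Set (AddCircle (1 : ℝ) × ZMod N)} {ϰ : ℝ} {c : ZMod N}

lemma floor_add_eq_of_le_fract {z δ : ℝ} (hδ : δ ≤ 1) (h : 1 - δ ≤ Int.fract z) :
    ⌊z + δ⌋ = ⌊z⌋ + 1 := by
  rw [Int.floor_eq_iff]
  have h₁ := Int.floor_add_fract z
  have h₂ := Int.fract_lt_one z
  push_cast
  constructor <;> linarith

lemma floor_add_eq_of_fract_lt {z δ : ℝ} (hδ : 0 ≤ δ) (h : Int.fract z < 1 - δ) :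
    ⌊z + δ⌋ = ⌊z⌋ := by
  rw [Int.floor_eq_iff]
  have h₁ := Int.floor_add_fract z
  have h₂ := Int.fract_nonneg z
  constructor <;> linarith

/-- Two times in the first half-period of a good rational approximation cannot both be close to the
right end of the unit interval. -/
lemma eq_of_le_fract_of_le_fract {r : ℚ} (hr : |ϰ - r| < 1 / (r.den : ℝ) ^ 2) (y : ℝ) {i j : ℕ}
    (hi : 2 * i ≤ r.den) (hj : 2 * j ≤ r.den)
    (hi' : 1 - 1 / (2 * (r.den : ℝ)) ≤ Int.fract (y + i * ϰ))
    (hj' : 1 - 1 / (2 * (r.den : ℝ)) ≤ Int.fract (y + j * ϰ)) : i = j := by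
  wlog hij : i ≤ j generalizing i j
  · exact (this hj hi hj' hi' (by omega)).symm
  by_contra hne
  have h := le_abs_mul_sub_of_rat_approx hr (j := j - i) (by omega) (by omega)
    (⌊y + j * ϰ⌋ - ⌊y + i * ϰ⌋)
  rw [Nat.cast_sub hij] at h
  push_cast at h
  rw [show ((j : ℝ) - i) * ϰ - (⌊y + j * ϰ⌋ - ⌊y + i * ϰ⌋) =
    Int.fract (y + j * ϰ) - Int.fract (y + i * ϰ) by simp only [Int.fract]; ring] at h
  have h₁ := Int.fract_lt_one (y + j * ϰ)
  have h₂ := Int.fract_lt_one (y + i * ϰ)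
  exact absurd h (not_le.mpr (abs_sub_lt_iff.mpr ⟨by linarith, by linarith⟩))

lemma SkewInvariant.volume_shiftFixed_two_ne_zero (hϰ : Irrational ϰ) (hA : SkewInvariant ϰ c A)
    (hm : MeasurableSet A) : volume (shiftFixed A 2) ≠ 0 := by
  intro h0
  have hδ : Tendsto (fun n : ℕ ↦ ((1 / (2 * (n : ℝ)) : ℝ) : AddCircle (1 : ℝ))) atTop (𝓝 0) := by
    have h1 : Tendsto (fun n : ℕ ↦ 1 / (2 * (n : ℝ))) atTop (𝓝 0) := by
      have := (tendsto_one_div_atTop_nhds_zero_nat (𝕜 := ℝ)).const_mul (1 / 2)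
      simpa [mul_comm] using this
    exact ((AddCircle.continuous_mk' (1 : ℝ)).tendsto 0).comp h1
  have hev := ((tendsto_volume_fiberChange hm).comp hδ).eventually_lt_const
    (show (0 : ℝ≥0∞) < ENNReal.ofReal (1 / 32) by simp)
  obtain ⟨M, hM⟩ := eventually_atTop.mp hev
  obtain ⟨r, hr, hrM⟩ := exists_rat_large_den hϰ (max M 10)
  have hsmall := hM r.den (le_of_max_le_left hrM)
  have hden : 10 ≤ r.den := le_of_max_le_right hrM
  have hden' : (10 : ℝ) ≤ r.den := by exact_mod_cast hden
  simp only [Function.comp_apply] at hsmall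
  set δ : ℝ := 1 / (2 * (r.den : ℝ)) with hδ_def
  have hδ₀ : 0 < δ := by positivity
  have hδ₁ : δ < 1 := by
    rw [hδ_def, div_lt_one (by positivity)]
    linarith
  set m : ℕ := r.den / 2 with hm_def
  have h2m : 2 * m ≤ r.den := by omega
  set J : Set (AddCircle (1 : ℝ)) := {x | 1 - δ ≤ (AddCircle.equivIco (1 : ℝ) 0 x : ℝ)}
  have hJm : MeasurableSet J := measurable_equivIco measurableSet_Ici
  have hJ : ENNReal.ofReal δ ≤ volume J := by
    have h1 := volume_setOf_equivIco_mem (s := Ioo (1 - δ) 1) measurableSet_Ioo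
      (Ioo_subset_Ioo_left (by linarith))
    rw [Real.volume_Ioo, sub_sub_cancel] at h1
    exact h1.trans (measure_mono fun x hx ↦ hx.1.le)
  have hmemJ (y : ℝ) (i : ℕ) : (y : AddCircle (1 : ℝ)) + ((i * ϰ : ℝ) : AddCircle (1 : ℝ)) ∈ J ↔
      1 - δ ≤ Int.fract (y + i * ϰ) := by
    rw [← AddCircle.coe_add]
    exact coe_mem_setOf_le_equivIco _ _
  let E (j : ℕ) : Set (AddCircle (1 : ℝ)) := (· + ((j * ϰ : ℝ) : AddCircle (1 : ℝ))) ⁻¹' J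
  have hvolG : volume (⋃ j ∈ Finset.Ioo 0 m, E j) = ((m - 1 : ℕ) : ℝ≥0∞) * volume J := by
    rw [measure_biUnion_finset]
    · simp [E, measure_preimage_add_right]
    · intro i hi j hj hij
      simp only [Finset.coe_Ioo, mem_Ioo] at hi hj
      refine Set.disjoint_left.mpr fun x hxi hxj ↦ hij ?_
      induction x using QuotientAddGroup.induction_on with
      | H y =>
        exact eq_of_le_fract_of_le_fract hr y (by omega) (by omega) ((hmemJ y i).mp hxi)
          ((hmemJ y j).mp hxj)
    · exact fun j _ ↦ measurable_add_const _ hJm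
  have hG : ENNReal.ofReal (1 / 8) ≤ volume (⋃ j ∈ Finset.Ioo 0 m, E j) := by
    rw [hvolG]
    refine le_trans ?_ (mul_le_mul_right hJ _)
    rw [← ENNReal.ofReal_natCast, ← ENNReal.ofReal_mul (by positivity)]
    refine ENNReal.ofReal_le_ofReal ?_
    have h1 : (r.den : ℝ) ≤ 2 * ((m - 1 : ℕ) : ℝ) + 3 := by
      have : r.den ≤ 2 * (m - 1) + 3 := by omega
      exact_mod_cast this
    rw [hδ_def, mul_one_div, div_le_div_iff₀ (by norm_num) (by positivity)]
    linarith
  have hsub : (⋃ j ∈ Finset.Ioo 0 m, E j) ⊆ shiftFixed A 2 ∪ (fiberChange A (δ : ℝ) ∪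
      (· + ((m * ϰ : ℝ) : AddCircle (1 : ℝ))) ⁻¹' fiberChange A (δ : ℝ)) := by
    intro x hx
    induction x using QuotientAddGroup.induction_on with
    | H y =>
      simp only [mem_iUnion, Finset.mem_Ioo, exists_prop] at hx
      obtain ⟨j, ⟨hj₀, hjm⟩, hj⟩ := hx
      have hj' := (hmemJ y j).mp hj
      by_contra hcon
      simp only [mem_union, not_or] at hcon
      refine hcon.1 (hA.mem_shiftFixed_two y δ hjm hj₀ ?_ (fun i hi hij ↦ ?_) hcon.2.1 ?_)
      · rw [add_right_comm]
        exact floor_add_eq_of_le_fract hδ₁.le hj'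
      · rw [add_right_comm]
        refine floor_add_eq_of_fract_lt hδ₀.le (not_le.mp fun hi' ↦ hij ?_)
        exact eq_of_le_fract_of_le_fract hr y (by omega) (by omega) hi' hj'
      · rw [AddCircle.coe_add]
        exact hcon.2.2
  have hlt : volume (shiftFixed A 2 ∪ (fiberChange A (δ : ℝ) ∪
      (· + ((m * ϰ : ℝ) : AddCircle (1 : ℝ))) ⁻¹' fiberChange A (δ : ℝ))) <
        ENNReal.ofReal (1 / 8) := by
    calc _ ≤ volume (shiftFixed A 2) + (volume (fiberChange A (δ : ℝ)) +
          volume ((· + ((m * ϰ : ℝ) : AddCircle (1 : ℝ))) ⁻¹' fiberChange A (δ : ℝ))) :=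
          (measure_union_le _ _).trans (add_le_add_right (measure_union_le _ _) _)
      _ < ENNReal.ofReal (1 / 32) + ENNReal.ofReal (1 / 32) := by
          rw [h0, zero_add, measure_preimage_add_right]
          exact ENNReal.add_lt_add hsmall hsmall
      _ ≤ ENNReal.ofReal (1 / 8) := by
          rw [← ENNReal.ofReal_add (by norm_num) (by norm_num)]
          exact ENNReal.ofReal_le_ofReal (by norm_num)
  exact absurd ((hG.trans (measure_mono hsub)).trans_lt hlt) (lt_irrefl _)

lemma SkewInvariant.volume_shiftFixed_one_ne_zero (hϰ : Irrational ϰ) (hA : SkewInvariant ϰ c A)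
    (hm : MeasurableSet A) : volume (shiftFixed A 1) ≠ 0 := by
  intro h0
  have h2 := hA.ae_mem_shiftFixed hϰ hm (hA.volume_shiftFixed_two_ne_zero hϰ hm)
  have hθ : Tendsto (fun θ : ℝ ↦ (θ : AddCircle (1 : ℝ))) (𝓝 0) (𝓝 0) :=
    (AddCircle.continuous_mk' (1 : ℝ)).tendsto 0
  have hev := ((tendsto_volume_fiberChange hm).comp hθ).eventually_lt_const
    (show (0 : ℝ≥0∞) < ENNReal.ofReal (1 / 4) by simp)
  obtain ⟨ε, hε, hball⟩ := Metric.eventually_nhds_iff.mp hev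
  have hirr : Irrational ((ϰ + (c.val : ℕ)) / (2 : ℕ)) := (hϰ.add_natCast _).div_natCast two_ne_zero
  obtain ⟨m, l, hml⟩ := exists_nat_mul_near_half hirr (ε := min ε (1 / 8) / 2) (by positivity)
  set θ : ℝ := 2 * (m * ((ϰ + (c.val : ℕ)) / (2 : ℕ)) - l - 1 / 2) with hθ_def
  have hθ' : |θ| < min ε (1 / 8) := by
    rw [hθ_def, abs_mul, abs_two]
    linarith
  have hsmall : volume (fiberChange A (θ : ℝ)) < ENNReal.ofReal (1 / 4) :=
    hball (by simpa using hθ'.trans_le (min_le_left _ _))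
  obtain ⟨hθ₀, hθ₁⟩ := abs_lt.mp (hθ'.trans_le (min_le_right _ _))
  have hS := volume_setOf_equivIco_mem (s := Ioo (1 / 8) (7 / 8)) measurableSet_Ioo
    (Ioo_subset_Ioo (by norm_num) (by norm_num))
  have hsub : {x : AddCircle (1 : ℝ) | (AddCircle.equivIco (1 : ℝ) 0 x : ℝ) ∈
      Ioo (1 / 8 : ℝ) (7 / 8)} ⊆
        shiftFixed A 1 ∪ (fiberChange A (θ : ℝ) ∪ (shiftFixed A 2)ᶜ) := by
    intro x hx
    induction x using QuotientAddGroup.induction_on with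
    | H y =>
      have hy : Int.fract y ∈ Ioo (1 / 8 : ℝ) (7 / 8) := by
        have hy' : (AddCircle.equivIco (1 : ℝ) 0 (y : AddCircle (1 : ℝ)) : ℝ) ∈
          Ioo (1 / 8 : ℝ) (7 / 8) := hx
        rwa [AddCircle.coe_equivIco_mk_apply, div_one, mul_one] at hy'
      by_contra hcon
      simp only [mem_union, mem_compl_iff, not_or, not_not] at hcon
      refine hcon.1 (hA.mem_shiftFixed_one y θ (m := m) (l := l) ?_ ?_ ?_ hcon.2.1 hcon.2.2)
      · rw [hθ_def]
        push_cast
        ring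
      · linarith [hy.1]
      · linarith [hy.2]
  have hlt : volume (shiftFixed A 1 ∪ (fiberChange A (θ : ℝ) ∪ (shiftFixed A 2)ᶜ)) <
      volume (Ioo (1 / 8 : ℝ) (7 / 8)) := by
    calc _ ≤ volume (shiftFixed A 1) + (volume (fiberChange A (θ : ℝ)) +
          volume (shiftFixed A 2)ᶜ) :=
          (measure_union_le _ _).trans (add_le_add_right (measure_union_le _ _) _)
      _ = volume (fiberChange A (θ : ℝ)) := by
          rw [h0, zero_add, show volume (shiftFixed A 2)ᶜ = 0 from h2, add_zero]
      _ < ENNReal.ofReal (1 / 4) := hsmall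
      _ ≤ _ := by
          rw [Real.volume_Ioo]
          exact ENNReal.ofReal_le_ofReal (by norm_num)
  exact absurd (hS.trans (measure_mono hsub)) (not_le.mpr hlt)

/-- Over almost every base point the fibre of an invariant set is empty or full, with the same
alternative everywhere. -/
lemma SkewInvariant.ae_forall_mem_or_ae_forall_notMem (hϰ : Irrational ϰ)
    (hA : SkewInvariant ϰ c A) (hm : MeasurableSet A) :
    (∀ᵐ x, ∀ k, (x, k) ∈ A) ∨ ∀ᵐ x, ∀ k, (x, k) ∉ A := by
  have h1 := hA.ae_mem_shiftFixed hϰ hm (hA.volume_shiftFixed_one_ne_zero hϰ hm)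
  have hVm : MeasurableSet {x : AddCircle (1 : ℝ) | ∀ k, (x, k) ∈ A} := by
    simp only [Set.ofPred_forall]
    exact MeasurableSet.iInter fun k ↦ measurableSet_fiber hm k
  have hV : (· + (ϰ : AddCircle (1 : ℝ))) ⁻¹' {x | ∀ k, (x, k) ∈ A} =
      {x : AddCircle (1 : ℝ) | ∀ k, (x, k) ∈ A} := by
    ext x
    induction x using QuotientAddGroup.induction_on with
    | H y =>
      constructor
      · intro hx k
        exact (hA y k).mp (hx _)
      · intro hx k
        have := (hA y (c + ((⌊y + ϰ⌋ - ⌊y⌋ : ℤ) : ZMod N) - k)).mpr (hx _)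
        rwa [sub_sub_cancel] at this
  refine ((ergodic_add_coe hϰ).ae_mem_or_ae_notMem hVm hV).imp id fun h ↦ ?_
  filter_upwards [h, h1] with x hx hx1 k hk
  refine hx fun k' ↦ ?_
  have := add_mem_iff_of_mem_shiftFixed hx1 k (k' - k).val
  rw [ZMod.natCast_zmod_val, mul_one, add_sub_cancel] at this
  exact this.mpr hk

end Ergodicity

end SkewProduct

/-- Ergodicity of the skew product `Ĥ(x,k) = (x + ϰ, σ_x(k))` over the
irrational rotation by `ϰ` on `ℝ/ℤ`, where `σ_x` is the involution `k ↦ c − k`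
on `[0, 1−ϰ)` and `k ↦ c + 1 − k` on `[1−ϰ, 1)` of `ZMod (q+1)`, with respect to
the product of the Haar probability measure on `ℝ/ℤ` and the uniform
probability measure on `ZMod (q+1)`. -/
theorem base_map_ergodic
    (q : ℕ) (hq : 0 < q)
    (ϰ : ℝ) (hϰ₀ : 0 < ϰ) (hϰ₁ : ϰ < 1) (hirr : Irrational ϰ)
    (c : ZMod (q+1))
    (H : AddCircle (1:ℝ) × ZMod (q+1) → AddCircle (1:ℝ) × ZMod (q+1))
    (hH : ∀ (y : ℝ) (kk : ZMod (q+1)), H ((↑y : AddCircle (1:ℝ)), kk) =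
      ((↑(y + ϰ) : AddCircle (1:ℝ)),
        if Int.fract y < 1 - ϰ then c - kk else c + 1 - kk))
    (μ : Measure (AddCircle (1:ℝ) × ZMod (q+1)))
    (hμ : μ = (volume : Measure (AddCircle (1:ℝ))).prod
      ((((q : ℝ≥0∞) + 1)⁻¹) • Measure.count)) :
    MeasurePreserving H μ μ ∧ Ergodic H μ := by
  have hdisc : DiscreteMeasurableSpace (ZMod (q + 1)) := ⟨fun _ ↦ trivial⟩
  have hfin : IsFiniteMeasure ((((q : ℝ≥0∞) + 1)⁻¹) • (Measure.count : Measure (ZMod (q + 1)))) :=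
    Measure.smul_finite _ (by simp)
  have hpres : MeasurePreserving H μ μ := by
    set s : AddCircle (1 : ℝ) → ZMod (q + 1) := fun x ↦
      if (AddCircle.equivIco (1 : ℝ) 0 x : ℝ) < 1 - ϰ then c else c + 1 with hs_def
    have hs : Measurable s :=
      Measurable.ite (measurable_equivIco measurableSet_Iio) measurable_const measurable_const
    have hHs : H = fun p ↦ (p.1 + (ϰ : AddCircle (1 : ℝ)), s p.1 - p.2) := by
      ext1 ⟨x, k⟩
      induction x using QuotientAddGroup.induction_on with
      | H y =>
        have hr : (AddCircle.equivIco (1 : ℝ) 0 (y : AddCircle (1 : ℝ)) : ℝ) = Int.fract y := by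
          rw [AddCircle.coe_equivIco_mk_apply, div_one, mul_one]
        refine (hH y k).trans ?_
        simp only [hs_def]
        rw [hr, AddCircle.coe_add, ite_sub]
    rw [hHs, hμ]
    refine (measurePreserving_add_right volume _).skew_product
      (g := fun x k ↦ s x - k) ?_ (.of_forall fun x ↦ ?_)
    · exact (Measurable.of_discrete (f := fun p : ZMod (q + 1) × ZMod (q + 1) ↦ p.1 - p.2)).comp
        ((hs.comp measurable_fst).prodMk measurable_snd)
    · rw [Measure.map_smul]
      congr 1
      ext t ht
      rw [Measure.map_apply .of_discrete ht, Measure.count_apply ht,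
        Measure.count_apply (.of_discrete)]
      exact congrArg _ (Set.encard_preimage_of_bijective (Equiv.subLeft (s x)).bijective t)
  refine ⟨hpres, hpres, ⟨fun A hAm hAinv ↦ ?_⟩⟩
  have hA : SkewInvariant ϰ c A := fun y k ↦ by
    have h : H ((y : AddCircle (1 : ℝ)), k) ∈ A ↔ ((y : AddCircle (1 : ℝ)), k) ∈ A := by
      rw [← Set.mem_preimage, hAinv]
    rw [← h, hH]
    split_ifs with hy
    · rw [floor_add_eq_of_fract_lt hϰ₀.le hy]
      simp
    · rw [floor_add_eq_of_le_fract hϰ₁.le (not_lt.mp hy)]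
      simp
  rw [Filter.eventuallyConst_set, hμ]
  refine (hA.ae_forall_mem_or_ae_forall_notMem hirr hAm).imp (fun h ↦ ?_) fun h ↦ ?_
  · filter_upwards [Measure.quasiMeasurePreserving_fst.ae h] with p hp using hp p.2
  · filter_upwards [Measure.quasiMeasurePreserving_fst.ae h] with p hp using hp p.2
end

section
/- Let q be a positive integer, A > 0, B = (q+1)·A, T > 0, k = (B−A)/T, 𝒯 = T/(AB). Define P₁, P₂ : ℝ² → ℝ² by P₁(τ, I) = (fract(τ − I/2), I + 2Ak𝒯·(2·fract(τ − I/2) − 1)) and P₂(τ, I) = (fract(τ − I/2), I − 2Bk𝒯·(2·fract(τ − I/2) − 1)), and P = P₂ ∘ P₁. For (τ, I) ∈ ℝ² and N ∈ ℕ write (τ_N, I_N) = P^N(τ, I). Then the escaping set E = {(τ, I) ∈ ℝ² : |I_N| → ∞ as N → ∞} has two-dimensional Lebesgue measure zero. -/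
open MeasureTheory Filter

/-- The minimum of the first `n + 1` Birkhoff sums of `g` along `f`. -/
noncomputable def birkhoffMin {α : Type*} (f : α → α) (g : α → ℝ) : ℕ → α → ℝ
  | 0, _ => 0
  | n + 1, x => min 0 (g x + birkhoffMin f g n (f x))

section BirkhoffMin

variable {α : Type*} {f : α → α} {g : α → ℝ}

lemma birkhoffMin_le_birkhoffSum {k n : ℕ} (hkn : k ≤ n) (x : α) :
    birkhoffMin f g n x ≤ birkhoffSum f g k x := by
  induction n generalizing k x with
  | zero => obtain rfl : k = 0 := by omega
            simp [birkhoffMin]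
  | succ n ih =>
    rcases k with _ | k
    · simp [birkhoffMin]
    · rw [birkhoffSum_succ']
      exact (min_le_right _ _).trans (by gcongr; exact ih (by omega) _)

lemma exists_birkhoffMin_eq_birkhoffSum (n : ℕ) (x : α) :
    ∃ k ≤ n, birkhoffMin f g n x = birkhoffSum f g k x := by
  induction n generalizing x with
  | zero => exact ⟨0, le_rfl, by simp [birkhoffMin]⟩
  | succ n ih =>
    obtain ⟨k, hk, h⟩ := ih (f x)
    rcases le_total 0 (g x + birkhoffMin f g n (f x)) with h0 | h0
    · exact ⟨0, by omega, by simp [birkhoffMin, h0]⟩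
    · exact ⟨k + 1, by omega, by rw [birkhoffSum_succ', ← h, birkhoffMin, min_eq_right h0]⟩

lemma abs_birkhoffMin_succ_sub_le {b : ℝ} (hb : ∀ x, |g x| ≤ b) (n : ℕ) (x : α) :
    |birkhoffMin f g (n + 1) x - birkhoffMin f g n x| ≤ b := by
  induction n generalizing x with
  | zero =>
    have := hb x
    simp only [birkhoffMin, add_zero, sub_zero]
    rcases min_cases 0 (g x) with h | h <;> rw [h.1]
    · simpa using (abs_nonneg _).trans this
    · exact this
  | succ n ih =>
    refine (abs_min_sub_min_le_max _ _ _ _).trans (max_le ?_ ?_)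
    · simpa using (abs_nonneg _).trans (hb x)
    · rw [add_sub_add_left_eq_sub]
      exact ih (f x)

lemma abs_birkhoffMin_le {b : ℝ} (hb : ∀ x, |g x| ≤ b) (n : ℕ) (x : α) :
    |birkhoffMin f g n x| ≤ n * b := by
  induction n with
  | zero => simp [birkhoffMin]
  | succ n ih =>
    have h := abs_birkhoffMin_succ_sub_le (f := f) hb n x
    have := abs_add_le (birkhoffMin f g (n + 1) x - birkhoffMin f g n x) (birkhoffMin f g n x)
    rw [sub_add_cancel] at this
    push_cast
    linarith

lemma measurable_birkhoffMin [MeasurableSpace α] (hf : Measurable f) (hg : Measurable g) (n : ℕ) :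
    Measurable (birkhoffMin f g n) := by
  induction n with
  | zero => exact measurable_const
  | succ n ih => exact measurable_const.min (hg.add (ih.comp hf))

lemma eventually_birkhoffMin_eq_of_tendsto_atTop {x : α}
    (hx : Tendsto (fun n => birkhoffSum f g n x) atTop atTop) :
    ∃ c, ∀ᶠ n in atTop, birkhoffMin f g n x = c := by
  rw [← Nat.cofinite_eq_atTop] at hx
  obtain ⟨k, hk⟩ := hx.exists_forall_le
  refine ⟨birkhoffSum f g k x, eventually_atTop.2 ⟨k, fun n hn => ?_⟩⟩
  obtain ⟨j, -, hj⟩ := exists_birkhoffMin_eq_birkhoffSum (f := f) (g := g) n x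
  exact le_antisymm (birkhoffMin_le_birkhoffSum hn x) (hj ▸ hk j)

/-- If the Birkhoff sums tend to infinity, then after the last near-minimum all of them are
bounded below by a positive constant. -/
lemma exists_forall_le_birkhoffSum_iterate {x : α}
    (hx : Tendsto (fun n => birkhoffSum f g n x) atTop atTop) :
    ∃ n : ℕ, ∀ k : ℕ, (1 / ((n : ℝ) + 1) - 1 / ((n : ℝ) + 2)) ≤
      birkhoffSum f g (k + 1) (f^[n] x) := by
  have h : Tendsto (fun n : ℕ => birkhoffSum f g n x + 1 / ((n : ℝ) + 1)) cofinite atTop := by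
    rw [Nat.cofinite_eq_atTop]
    exact tendsto_atTop_mono (fun n => le_add_of_nonneg_right (by positivity)) hx
  obtain ⟨n, hn⟩ := h.exists_forall_le
  refine ⟨n, fun k => ?_⟩
  have h1 := hn (n + (k + 1))
  rw [birkhoffSum_add] at h1
  have h2 : 1 / (((n + (k + 1) : ℕ) : ℝ) + 1) ≤ 1 / ((n : ℝ) + 2) := by
    refine one_div_le_one_div_of_le (by positivity) ?_
    push_cast
    linarith [k.cast_nonneg (α := ℝ)]
  linarith

variable [MeasurableSpace α] {μ : Measure α} [IsFiniteMeasure μ]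

lemma measure_tendsto_birkhoffSum_atTop (hf : Ergodic f μ) (hg : Measurable g) {b : ℝ}
    (hb : ∀ x, |g x| ≤ b) (h0 : ∫ x, g x ∂μ = 0) :
    μ {x | Tendsto (fun n => birkhoffSum f g n x) atTop atTop} = 0 := by
  have hfm := hf.measurable
  have hSm : ∀ n, Measurable (birkhoffSum f g n) := fun n =>
    Finset.measurable_sum _ fun i _ => hg.comp (hfm.iterate i)
  set C := {x | Tendsto (fun n => birkhoffSum f g n x) atTop atTop} with hC
  have hCm : MeasurableSet C := measurableSet_tendsto _ hSm
  have hinv : f ⁻¹' C = C := by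
    ext x
    simp only [hC, Set.mem_preimage, Set.mem_ofPred_eq]
    rw [← tendsto_add_atTop_iff_nat (f := fun n => birkhoffSum f g n x) 1]
    simp only [birkhoffSum_succ']
    exact ⟨fun h => tendsto_atTop_add_const_left _ _ h, fun h => by
      simpa using tendsto_atTop_add_const_left _ (-g x) h⟩
  rcases hf.toPreErgodic.aeconst_set hCm hinv |> eventuallyConst_set'.1 with h | h
  · exact ae_eq_empty.1 h
  have hae : ∀ᵐ x ∂μ, x ∈ C := eventuallyEq_univ.1 h
  have hmm := measurable_birkhoffMin hfm hg
  have hmi : ∀ n, Integrable (birkhoffMin f g n) μ := fun n =>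
    .of_bound (hmm n).aestronglyMeasurable (n * b) (.of_forall fun x => abs_birkhoffMin_le hb n x)
  have hgi : Integrable g μ := .of_bound hg.aestronglyMeasurable b (.of_forall hb)
  have hmfi : ∀ n, Integrable (fun x => birkhoffMin f g n (f x)) μ := fun n =>
    hf.toMeasurePreserving.integrable_comp_of_integrable (hmi n)
  have hmf : ∀ n, ∫ x, birkhoffMin f g n (f x) ∂μ = ∫ x, birkhoffMin f g n x ∂μ := fun n => by
    rw [← integral_map hfm.aemeasurable (by rw [hf.map_eq]; exact (hmi n).1), hf.map_eq]
  let P : ℕ → α → ℝ := fun n x => g x + birkhoffMin f g n (f x) - birkhoffMin f g (n + 1) x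
  have hPi : ∀ n, Integrable (P n) μ := fun n => (hgi.add (hmfi n)).sub (hmi _)
  have hP : ∀ n, ∫ x, P n x ∂μ = ∫ x, (birkhoffMin f g n x - birkhoffMin f g (n + 1) x) ∂μ := by
    intro n
    have h1 : ∫ x, P n x ∂μ = ∫ x, (g x + birkhoffMin f g n (f x)) ∂μ -
        ∫ x, birkhoffMin f g (n + 1) x ∂μ := integral_sub (hgi.add (hmfi n)) (hmi _)
    rw [h1, integral_add hgi (hmfi n), h0, hmf, integral_sub (hmi _) (hmi _), zero_add]
  have hP0 : ∀ n x, 0 ≤ P n x := fun n x => sub_nonneg.2 (min_le_right _ _)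
  have hlim : Tendsto (fun n => ∫ x, P n x ∂μ) atTop (nhds 0) := by
    simp only [hP]
    rw [← integral_zero α ℝ (μ := μ)]
    refine tendsto_integral_of_dominated_convergence (fun _ => b)
      (fun n => ((hmm n).sub (hmm _)).aestronglyMeasurable) (integrable_const b)
      (fun n => .of_forall fun x => ?_) (hae.mono fun x hx => ?_)
    · rw [Real.norm_eq_abs, abs_sub_comm]
      exact abs_birkhoffMin_succ_sub_le hb n x
    · obtain ⟨c, hc⟩ := eventually_birkhoffMin_eq_of_tendsto_atTop hx
      refine tendsto_const_nhds.congr' ?_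
      filter_upwards [hc, (tendsto_add_atTop_nat 1).eventually hc] with n h1 h2
      rw [h1, h2, sub_self]
  have hD : ∀ δ > 0, μ {x | ∀ k : ℕ, δ ≤ birkhoffSum f g (k + 1) x} = 0 := by
    intro δ hδ
    set D := {x | ∀ k : ℕ, δ ≤ birkhoffSum f g (k + 1) x}
    have hDP : ∀ n, D ⊆ {x | δ ≤ P n x} := by
      intro n x hx
      obtain ⟨k, -, hk⟩ := exists_birkhoffMin_eq_birkhoffSum (f := f) (g := g) n (f x)
      have := hx k
      rw [birkhoffSum_succ', ← hk] at this
      have h1 : birkhoffMin f g (n + 1) x ≤ 0 := min_le_left _ _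
      simp only [P, Set.mem_ofPred_eq]
      linarith
    have hle : ∀ n, δ * μ.real D ≤ ∫ x, P n x ∂μ := fun n =>
      (mul_le_mul_of_nonneg_left (measureReal_mono (hDP n)) hδ.le).trans
        (mul_meas_ge_le_integral_of_nonneg (.of_forall (hP0 n)) (hPi n) δ)
    have h1 : δ * μ.real D ≤ 0 := ge_of_tendsto' hlim hle
    have h2 : μ.real D = 0 := le_antisymm (nonpos_of_mul_nonpos_right h1 hδ) measureReal_nonneg
    exact (measureReal_eq_zero_iff).1 h2
  refine measure_mono_null (t := ⋃ n : ℕ, f^[n] ⁻¹' {x | ∀ k : ℕ,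
    (1 / ((n : ℝ) + 1) - 1 / ((n : ℝ) + 2)) ≤ birkhoffSum f g (k + 1) x}) (fun x hx => ?_)
    (measure_iUnion_null fun n => ?_)
  · exact Set.mem_iUnion.2 (exists_forall_le_birkhoffSum_iterate hx)
  · refine (hf.toMeasurePreserving.iterate n).quasiMeasurePreserving.preimage_null (hD _ ?_)
    rw [gt_iff_lt, sub_pos]
    gcongr
    norm_num

/-- A sequence with bounded increments whose absolute value tends to infinity tends to `+∞`
or to `-∞`. -/
lemma tendsto_atTop_or_neg_of_tendsto_abs_atTop {u : ℕ → ℝ} {b : ℝ}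
    (hb : ∀ n, |u (n + 1) - u n| ≤ b) (hu : Tendsto (fun n => |u n|) atTop atTop) :
    Tendsto u atTop atTop ∨ Tendsto (fun n => -u n) atTop atTop := by
  obtain ⟨N, hN⟩ := eventually_atTop.1 (hu.eventually_gt_atTop b)
  have hb0 : 0 ≤ b := (abs_nonneg _).trans (hb 0)
  rcases le_total 0 (u N) with h | h
  · left
    have : ∀ n ≥ N, 0 ≤ u n := by
      intro n hn
      induction n, hn using Nat.le_induction with
      | base => exact h
      | succ n hn ih =>
        have h1 := hN n hn
        rw [abs_of_nonneg ih] at h1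
        linarith [(abs_le.1 (hb n)).1]
    exact hu.congr' (eventually_atTop.2 ⟨N, fun n hn => abs_of_nonneg (this n hn)⟩)
  · right
    have : ∀ n ≥ N, u n ≤ 0 := by
      intro n hn
      induction n, hn using Nat.le_induction with
      | base => exact h
      | succ n hn ih =>
        have h1 := hN n hn
        rw [abs_of_nonpos ih] at h1
        linarith [(abs_le.1 (hb n)).2]
    exact hu.congr' (eventually_atTop.2 ⟨N, fun n hn => abs_of_nonpos (this n hn)⟩)

/-- The Birkhoff sums of a bounded function of zero mean over an ergodic transformation
almost surely do not tend to infinity in absolute value. -/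
theorem measure_tendsto_abs_birkhoffSum_atTop (hf : Ergodic f μ) (hg : Measurable g) {b : ℝ}
    (hb : ∀ x, |g x| ≤ b) (h0 : ∫ x, g x ∂μ = 0) :
    μ {x | Tendsto (fun n => |birkhoffSum f g n x|) atTop atTop} = 0 := by
  have h1 := measure_tendsto_birkhoffSum_atTop hf hg hb h0
  have h2 := measure_tendsto_birkhoffSum_atTop (g := -g) hf hg.neg (b := b) (by simpa using hb)
    (by simp [integral_neg, h0])
  refine measure_mono_null (fun x hx => ?_) (measure_union_null h1 h2)
  refine (tendsto_atTop_or_neg_of_tendsto_abs_atTop (b := b) (fun n => ?_) hx).imp id fun h => ?_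
  · rw [birkhoffSum_succ, add_sub_cancel_left]
    exact hb _
  · simpa only [Set.mem_ofPred_eq, birkhoffSum_neg] using h

end BirkhoffMin

/-- The involution of the line reversing the order of the unit intervals `[n, n + 1)` while
preserving the orientation of each of them, followed by the translation by `α`. -/
noncomputable def flipShift (α v : ℝ) : ℝ := 2 * Int.fract v - v - 1 + α

section FlipShift

variable {α : ℝ}

lemma flipShift_eq (v : ℝ) : flipShift α v = v - 2 * ⌊v⌋ - 1 + α := by
  rw [flipShift, Int.fract]; ring

lemma flipShift_add_int (v : ℝ) (m : ℤ) : flipShift α (v + m) = flipShift α v - m := by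
  rw [flipShift, flipShift, Int.fract_add_intCast]; ring

lemma exists_flipShift_iterate_eq (n : ℕ) (v : ℝ) :
    ∃ N : ℤ, (flipShift α)^[n] v = v + n * α + N := by
  induction n with
  | zero => exact ⟨0, by simp⟩
  | succ n ih =>
    obtain ⟨N, hN⟩ := ih
    refine ⟨N - 2 * ⌊v + n * α + N⌋ - 1, ?_⟩
    rw [Function.iterate_succ_apply', hN, flipShift_eq]
    push_cast
    ring

lemma exists_flipShift_iterate_add_int (n : ℕ) :
    ∃ σ : ℤ, (σ = 1 ∨ σ = -1) ∧
      ∀ (v : ℝ) (m : ℤ), (flipShift α)^[n] (v + m) = (flipShift α)^[n] v + σ * m := by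
  induction n with
  | zero => exact ⟨1, by simp⟩
  | succ n ih =>
    obtain ⟨σ, hσ, h⟩ := ih
    refine ⟨-σ, by omega, fun v m => ?_⟩
    rw [Function.iterate_succ_apply', Function.iterate_succ_apply', h]
    have := flipShift_add_int (α := α) ((flipShift α)^[n] v) (σ * m)
    push_cast at this ⊢
    rw [this]
    ring

/-- If exactly one integer is met between the orbits of `v` and of `v + s` under the translation
by `α` up to time `n`, then the orbits under `flipShift` get separated by two units. -/
lemma exists_flipShift_iterate_add {v s : ℝ} {j n : ℕ}
    (h : ∀ i < n, ⌊v + s + i * α⌋ = ⌊v + i * α⌋ + if i = j then 1 else 0) :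
    ∃ κ : ℤ, (flipShift α)^[n] (v + s) = (flipShift α)^[n] v + s + 2 * κ ∧
      (n ≤ j → κ = 0) ∧ (j < n → κ = 1 ∨ κ = -1) := by
  induction n with
  | zero => exact ⟨0, by simp⟩
  | succ n ih =>
    obtain ⟨κ, h1, h2, h3⟩ := ih fun i hi => h i (by omega)
    obtain ⟨N, hN⟩ := exists_flipShift_iterate_eq (α := α) n v
    have hn := h n (by omega)
    refine ⟨-κ - if n = j then 1 else 0, ?_, ?_, ?_⟩
    · rw [Function.iterate_succ_apply', Function.iterate_succ_apply', h1, hN, flipShift_eq,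
        flipShift_eq]
      have e1 : ⌊v + n * α + N + s + 2 * κ⌋ = ⌊v + s + n * α⌋ + N + 2 * κ := by
        rw [show v + n * α + N + s + 2 * κ = v + s + n * α + ((N + 2 * κ : ℤ) : ℝ) by
          push_cast; ring, Int.floor_add_intCast, ← add_assoc]
      rw [e1, hn, Int.floor_add_intCast]
      push_cast
      ring
    · intro hj
      rw [h2 (by omega), if_neg (by omega)]; rfl
    · intro hj
      rcases eq_or_ne n j with rfl | hne
      · rw [h2 le_rfl, if_pos rfl]; simp
      · rw [if_neg hne]
        rcases h3 (by omega) with h | h <;> simp [h]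

end FlipShift

section Separation

variable {α s : ℝ} {n : ℕ}

lemma le_abs_sub_of_separated (hs : ∀ m : ℕ, 0 < m → m < n → ∀ k : ℤ, s ≤ |m * α - k|)
    {i j : ℕ} (hi : i < n) (hj : j < n) (hij : i ≠ j) (k : ℤ) :
    s ≤ |((i : ℝ) - j) * α - k| := by
  rcases hij.lt_or_gt with h | h
  · have := hs (j - i) (by omega) (by omega) (-k)
    rw [Nat.cast_sub h.le] at this
    rw [← abs_neg]
    convert this using 2
    push_cast
    ring
  · have := hs (i - j) (by omega) (by omega) k
    rwa [Nat.cast_sub h.le] at this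

lemma floor_add_eq_of_separated (hs0 : 0 < s) (hs1 : s ≤ 1)
    (hs : ∀ m : ℕ, 0 < m → m < n → ∀ k : ℤ, s ≤ |m * α - k|)
    {j : ℕ} (hj : j < n) {v : ℝ} (hv : |v + j * α + s / 2| ≤ s / 4) {i : ℕ} (hi : i < n) :
    ⌊v + s + i * α⌋ = ⌊v + i * α⌋ + if i = j then 1 else 0 := by
  obtain ⟨hv1, hv2⟩ := abs_le.1 hv
  split_ifs with h
  · subst h
    have h1 : ⌊v + i * α⌋ = -1 := by
      rw [Int.floor_eq_iff]; push_cast; constructor <;> linarith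
    have h2 : ⌊v + s + i * α⌋ = 0 := by
      rw [Int.floor_eq_iff]; push_cast; constructor <;> linarith
    rw [h1, h2]; rfl
  · by_contra hne
    have h1 : ⌊v + i * α⌋ ≤ ⌊v + s + i * α⌋ := Int.floor_le_floor (by linarith)
    have h2 : ⌊v + i * α⌋ < ⌊v + s + i * α⌋ := lt_of_le_of_ne h1 (by omega)
    have h3 := Int.floor_lt.1 h2
    have h4 := Int.floor_le (v + s + i * α)
    have h5 := le_abs_sub_of_separated hs hi hj h ⌊v + s + i * α⌋
    rcases abs_cases (((i : ℝ) - j) * α - ⌊v + s + i * α⌋) with h6 | h6 <;> linarith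

/-- An irrational number has arbitrarily small separation constants that are proportional to the
inverse of the number of separated multiples. -/
lemma exists_separated (hα : Irrational α) {η : ℝ} (hη : 0 < η) :
    ∃ (n : ℕ) (s : ℝ), 0 < s ∧ s ≤ 1 ∧ s < η ∧ 1 / 4 ≤ n * s ∧
      ∀ m : ℕ, 0 < m → m < n → ∀ k : ℤ, s ≤ |m * α - k| := by
  obtain ⟨M, hM⟩ := exists_nat_gt (1 / η)
  have hev := hα.eventually_forall_le_dist_cast_rat_of_den_le (M + 1)
  obtain ⟨ε, hε, hεp⟩ := (Metric.eventually_nhds_iff.1 hev)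
  obtain ⟨L, hL⟩ := exists_nat_gt (2 / ε)
  have hLp : 0 < L := by
    have : (0 : ℝ) < L := lt_trans (by positivity) hL
    exact_mod_cast this
  obtain ⟨r, hr, hrL⟩ := Real.exists_rat_abs_sub_le_and_den_le α hLp
  have hd0 : (0 : ℝ) < r.den := by exact_mod_cast r.den_pos
  have hd1 : (1 : ℝ) ≤ r.den := by exact_mod_cast r.den_pos
  have hMd : M + 1 < r.den := by
    by_contra hle
    have h1 := hεp (y := ε / 2) (by rw [Real.dist_eq, sub_zero, abs_of_pos (by positivity)]; linarith)
      r (by omega)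
    rw [Real.dist_eq] at h1
    have h2 : 1 / (((L : ℝ) + 1) * r.den) < ε / 2 := by
      rw [div_lt_iff₀ (by positivity)]
      rw [div_lt_iff₀ hε] at hL
      nlinarith
    linarith
  have hMd' : (M : ℝ) + 1 < r.den := by exact_mod_cast hMd
  refine ⟨r.den / 2 + 1, 1 / (2 * r.den), by positivity, ?_, ?_, ?_, ?_⟩
  · rw [div_le_one (by positivity)]; linarith
  · rw [div_lt_iff₀ hη] at hM
    rw [div_lt_iff₀ (by positivity)]
    nlinarith
  · have : (r.den : ℝ) ≤ 2 * ((r.den / 2 + 1 : ℕ) : ℝ) := by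
      exact_mod_cast (by omega : r.den ≤ 2 * (r.den / 2 + 1))
    rw [mul_one_div, div_le_div_iff₀ (by positivity) (by positivity)]
    linarith
  · intro m hm0 hm k
    have hmd : 2 * m ≤ r.den := by omega
    have hmd' : 2 * (m : ℝ) ≤ r.den := by exact_mod_cast hmd
    have hint : (m : ℤ) * r.num - k * r.den ≠ 0 := by
      intro h0
      have h1 : (r.den : ℤ) ∣ m * r.num := ⟨k, by linarith⟩
      have h2 : (r.den : ℤ) ∣ m := by
        refine IsCoprime.dvd_of_dvd_mul_right (z := r.num) ?_ h1
        have := r.reduced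
        rw [Int.isCoprime_iff_gcd_eq_one]
        exact this.symm
      have := Nat.le_of_dvd hm0 (Int.natCast_dvd_natCast.1 h2)
      omega
    have h1 : (1 : ℝ) ≤ |(m : ℝ) * r.num - k * r.den| := by
      exact_mod_cast Int.one_le_abs hint
    have h2 : |(m : ℝ) * r - k| = |(m : ℝ) * r.num - k * r.den| / r.den := by
      rw [eq_div_iff hd0.ne', ← abs_of_pos hd0, ← abs_mul, abs_of_pos hd0, sub_mul, mul_assoc,
        Rat.cast_def r, div_mul_cancel₀ _ hd0.ne']
    have h3 : 1 / (r.den : ℝ) ≤ |(m : ℝ) * r - k| := by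
      rw [h2]; gcongr
    have h4 : |(m : ℝ) * (α - r)| ≤ 1 / (2 * r.den) := by
      rw [abs_mul, abs_of_nonneg m.cast_nonneg]
      refine (mul_le_mul_of_nonneg_left hr m.cast_nonneg).trans ?_
      rw [mul_one_div, div_le_div_iff₀ (by positivity) (by positivity)]
      have hrL' : (r.den : ℝ) ≤ L := by exact_mod_cast hrL
      nlinarith
    have h5 : 1 / (r.den : ℝ) = 1 / (2 * r.den) + 1 / (2 * r.den) := by field_simp; norm_num
    have h6 := abs_sub_abs_le_abs_sub ((m : ℝ) * r - k) (-(m * (α - r)))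
    rw [abs_neg] at h6
    have h7 : (m : ℝ) * r - k - -(m * (α - r)) = m * α - k := by ring
    rw [h7] at h6
    linarith

end Separation

section Circle

variable {d : ℕ} [hd : Fact (0 < (d : ℝ))]

/-- The fractional part of a point of a circle of integer length. -/
noncomputable def circleFract (x : AddCircle (d : ℝ)) : ℝ :=
  Int.fract (AddCircle.equivIco (d : ℝ) 0 x : ℝ)

lemma exists_coe_equivIco_eq_add_mul (v : ℝ) :
    ∃ k : ℤ, (AddCircle.equivIco (d : ℝ) 0 (v : AddCircle (d : ℝ)) : ℝ) = v + k * d := by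
  have h : ((AddCircle.equivIco (d : ℝ) 0 (v : AddCircle (d : ℝ)) : ℝ) : AddCircle (d : ℝ)) = v :=
    AddCircle.coe_equivIco
  rw [← sub_eq_zero, ← AddCircle.coe_sub, AddCircle.coe_eq_zero_iff] at h
  obtain ⟨k, hk⟩ := h
  exact ⟨k, by rw [zsmul_eq_mul] at hk; linarith⟩

@[simp]
lemma circleFract_coe (v : ℝ) : circleFract (v : AddCircle (d : ℝ)) = Int.fract v := by
  obtain ⟨k, hk⟩ := exists_coe_equivIco_eq_add_mul (d := d) v
  rw [circleFract, hk]
  have := Int.fract_add_intCast v (k * d)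
  push_cast at this
  exact this

lemma measurable_coe_equivIco :
    Measurable fun x : AddCircle (d : ℝ) => (AddCircle.equivIco (d : ℝ) 0 x : ℝ) :=
  measurable_subtype_coe.comp (AddCircle.measurableEquivIco (d : ℝ) 0).measurable

lemma measurable_circleFract : Measurable (circleFract (d := d)) :=
  measurable_fract.comp measurable_coe_equivIco

/-- The map induced by `flipShift` on a circle of integer length. -/
noncomputable def circleFlipShift (α : ℝ) (x : AddCircle (d : ℝ)) : AddCircle (d : ℝ) :=
  ((2 * circleFract x - 1 + α : ℝ) : AddCircle (d : ℝ)) - x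

lemma circleFlipShift_coe (α v : ℝ) :
    circleFlipShift α (v : AddCircle (d : ℝ)) = (flipShift α v : ℝ) := by
  rw [circleFlipShift, circleFract_coe, ← AddCircle.coe_sub, flipShift]
  congr 1
  ring

lemma circleFlipShift_iterate_coe (α v : ℝ) (n : ℕ) :
    (circleFlipShift α)^[n] (v : AddCircle (d : ℝ)) = ((flipShift α)^[n] v : ℝ) := by
  induction n with
  | zero => rfl
  | succ n ih => rw [Function.iterate_succ_apply', Function.iterate_succ_apply', ih,
      circleFlipShift_coe]

lemma measurable_circleFlipShift (α : ℝ) : Measurable (circleFlipShift (d := d) α) :=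
  (AddCircle.measurable_mk'.comp
    (((measurable_circleFract.const_mul 2).sub_const 1).add_const α)).sub measurable_id

lemma circleFlipShift_eq_add (α : ℝ) (x : AddCircle (d : ℝ)) :
    circleFlipShift α x = circleFlipShift 0 x + (α : ℝ) := by
  rw [circleFlipShift, circleFlipShift, add_zero, AddCircle.coe_add]
  abel

lemma circleFlipShift_add_int (α : ℝ) (x : AddCircle (d : ℝ)) (m : ℤ) :
    circleFlipShift α (x + ((m : ℝ) : AddCircle (d : ℝ))) =
      circleFlipShift α x - ((m : ℝ) : AddCircle (d : ℝ)) := by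
  induction x using QuotientAddGroup.induction_on with
  | H v =>
    change circleFlipShift α ((v : AddCircle (d : ℝ)) + _) =
      circleFlipShift α (v : AddCircle (d : ℝ)) - _
    rw [← AddCircle.coe_add, circleFlipShift_coe, circleFlipShift_coe, flipShift_add_int,
      AddCircle.coe_sub]

lemma exists_circleFlipShift_eq_add_int (α : ℝ) (x : AddCircle (d : ℝ)) :
    ∃ m : ℤ, circleFlipShift α x = x + (α : ℝ) + ((m : ℝ) : AddCircle (d : ℝ)) := by
  induction x using QuotientAddGroup.induction_on with
  | H v =>
    refine ⟨-2 * ⌊v⌋ - 1, ?_⟩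
    change circleFlipShift α (v : AddCircle (d : ℝ)) = (v : AddCircle (d : ℝ)) + _ + _
    rw [circleFlipShift_coe, flipShift_eq, ← AddCircle.coe_add, ← AddCircle.coe_add]
    congr 1
    push_cast
    ring

lemma circleFlipShift_zero_involutive :
    Function.Involutive (circleFlipShift (d := d) 0) := by
  intro x
  obtain ⟨m, hm⟩ := exists_circleFlipShift_eq_add_int 0 x
  rw [AddCircle.coe_zero, add_zero] at hm
  conv_lhs => rw [hm]
  rw [circleFlipShift_add_int, hm, add_sub_cancel_right]

/-- An involution all of whose displacements belong to a countable subgroup preserves the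
measure. -/
lemma measurePreserving_of_involutive {G : Type*} [AddCommGroup G] [MeasurableSpace G]
    [MeasurableSingletonClass G] [MeasurableAdd₂ G] [MeasurableSub₂ G] {μ : Measure G}
    [μ.IsAddRightInvariant] {f : G → G} (hf : Measurable f) (hinv : Function.Involutive f)
    (H : AddSubgroup G) [Countable H] (hH : ∀ x, f x - x ∈ H) : MeasurePreserving f μ μ := by
  refine ⟨hf, Measure.ext fun A hA => ?_⟩
  rw [Measure.map_apply hf hA]
  let h : G → G := fun x => f x - x
  have hm : Measurable h := hf.sub measurable_id
  have key : ∀ B, MeasurableSet B → μ B = ∑' t : H, μ (B ∩ h ⁻¹' {(t : G)}) := by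
    intro B hB
    have h1 := tsum_measure_preimage_singleton (μ := μ.restrict B) (s := (H : Set G)) (f := h)
      (Set.to_countable _) (fun t _ => hm (measurableSet_singleton t))
    rw [Set.eq_univ_of_forall (s := h ⁻¹' (H : Set G)) hH, Measure.restrict_apply_univ] at h1
    rw [← h1]
    refine tsum_congr fun t => ?_
    rw [Measure.restrict_apply (hm (measurableSet_singleton _)), Set.inter_comm]
  rw [key A hA, key _ (hf hA), ← (Equiv.neg H).tsum_eq fun t => μ (A ∩ h ⁻¹' {(t : G)})]
  refine tsum_congr fun t => ?_
  rw [← measure_preimage_add_right μ (t : G) (A ∩ h ⁻¹' _)]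
  congr 1
  ext x
  simp only [h, Set.mem_inter_iff, Set.mem_preimage, Set.mem_singleton_iff, Equiv.neg_apply,
    NegMemClass.coe_neg, sub_eq_iff_eq_add]
  rw [add_comm (t : G) x, add_comm (-(t : G)), add_neg_cancel_right]
  constructor
  · rintro ⟨h1, h2⟩
    rw [← h2]
    exact ⟨h1, hinv x⟩
  · rintro ⟨h1, h2⟩
    have h3 : f x = x + t := by rw [← h2, hinv, h2]
    exact ⟨h3 ▸ h1, h3⟩

lemma measurePreserving_circleFlipShift (α : ℝ) :
    MeasurePreserving (circleFlipShift (d := d) α) := by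
  have h0 : MeasurePreserving (circleFlipShift (d := d) 0) := by
    refine measurePreserving_of_involutive (measurable_circleFlipShift 0)
      circleFlipShift_zero_involutive
      (AddSubgroup.zmultiples ((1 : ℝ) : AddCircle (d : ℝ))) fun x => ?_
    obtain ⟨m, hm⟩ := exists_circleFlipShift_eq_add_int 0 x
    refine AddSubgroup.mem_zmultiples_iff.2 ⟨m, ?_⟩
    rw [hm, AddCircle.coe_zero, add_zero, add_sub_cancel_left, ← AddCircle.coe_zsmul, zsmul_one]
  have h1 := (measurePreserving_add_right volume ((α : ℝ) : AddCircle (d : ℝ))).comp h0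
  have h2 : circleFlipShift (d := d) α = (fun x => x + (α : AddCircle (d : ℝ))) ∘
      circleFlipShift 0 := funext (circleFlipShift_eq_add α)
  rw [h2]
  exact h1

lemma ergodic_add_right_of_irrational {β : ℝ} (hβ : Irrational β) :
    Ergodic (fun x : AddCircle (d : ℝ) => x + (β : ℝ)) := by
  rw [AddCircle.ergodic_add_right, addOrderOf_eq_zero_iff']
  intro n hn h
  rw [← AddCircle.coe_nsmul, AddCircle.coe_eq_zero_iff] at h
  obtain ⟨k, hk⟩ := h
  have h1 := hβ.natCast_mul hn.ne'
  rw [zsmul_eq_mul, nsmul_eq_mul] at hk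
  rw [← hk] at h1
  exact h1 ⟨k * d, by push_cast; rfl⟩

/-- The points some integer translate of which is separated from its translate by `s` by the
set `C`. -/
def translateMismatch (C : Set (AddCircle (d : ℝ))) (s : ℝ) : Set (AddCircle (d : ℝ)) :=
  {x | ∃ t : ℤ, ¬(x + (t : ℝ) ∈ C ↔ x + (t : ℝ) + (s : ℝ) ∈ C)}

omit hd in
lemma add_int_mem_translateMismatch {C : Set (AddCircle (d : ℝ))} {s : ℝ}
    {x : AddCircle (d : ℝ)} (m : ℤ) :
    x + (m : ℝ) ∈ translateMismatch C s ↔ x ∈ translateMismatch C s := by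
  constructor
  · rintro ⟨t, ht⟩
    refine ⟨m + t, ?_⟩
    rwa [Int.cast_add, AddCircle.coe_add, ← add_assoc]
  · rintro ⟨t, ht⟩
    refine ⟨t - m, ?_⟩
    rwa [Int.cast_sub, AddCircle.coe_sub, add_assoc x, add_sub_cancel]

lemma translateMismatch_subset (C : Set (AddCircle (d : ℝ))) (s : ℝ) :
    translateMismatch C s ⊆ ⋃ t ∈ Finset.range d, (fun x => x + (((t : ℕ) : ℝ) : AddCircle (d : ℝ)))
      ⁻¹' (symmDiff ((fun x => x + (s : AddCircle (d : ℝ))) ⁻¹' C) C) := by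
  rintro x ⟨t, ht⟩
  have hd0 : (0 : ℤ) < d := by exact_mod_cast hd.out
  have h1 := Int.emod_nonneg t hd0.ne'
  have h2 := Int.emod_lt_of_pos t hd0
  have h3 : ((((t % d).toNat : ℕ) : ℝ) : AddCircle (d : ℝ)) = ((t : ℝ) : AddCircle (d : ℝ)) := by
    have h4 : (((t % d).toNat : ℕ) : ℝ) = ((t % d : ℤ) : ℝ) := by
      exact_mod_cast congrArg (Int.cast (R := ℝ)) (Int.toNat_of_nonneg h1)
    rw [h4, ← sub_eq_zero, ← AddCircle.coe_sub, AddCircle.coe_eq_zero_iff]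
    refine ⟨-(t / d), ?_⟩
    have h5 : ((t % d + d * (t / d) : ℤ) : ℝ) = t := by rw [Int.emod_add_mul_ediv]
    push_cast at h5
    rw [zsmul_eq_mul]
    push_cast
    linarith
  refine Set.mem_iUnion₂.2 ⟨(t % d).toNat, Finset.mem_range.2 (by omega), ?_⟩
  simp only [Set.mem_preimage, Set.mem_symmDiff, h3]
  tauto

omit hd in
lemma measurableSet_translateMismatch {C : Set (AddCircle (d : ℝ))} (hC : MeasurableSet C)
    (s : ℝ) : MeasurableSet (translateMismatch C s) := by
  have : translateMismatch C s = ⋃ t : ℤ, symmDiff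
      ((fun x => x + ((t : ℝ) : AddCircle (d : ℝ))) ⁻¹' C)
      ((fun x => x + ((t : ℝ) : AddCircle (d : ℝ)) + (s : AddCircle (d : ℝ))) ⁻¹' C) := by
    ext x
    simp only [translateMismatch, Set.mem_iUnion, Set.mem_symmDiff, Set.mem_preimage]
    refine exists_congr fun t => ?_
    tauto
  rw [this]
  refine MeasurableSet.iUnion fun t => MeasurableSet.symmDiff ?_ ?_
  · exact (measurable_id.add_const _) hC
  · exact ((measurable_id.add_const _).add_const _) hC

lemma measure_translateMismatch_le {C : Set (AddCircle (d : ℝ))} (hC : MeasurableSet C) (s : ℝ) :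
    volume (translateMismatch C s) ≤
      d * volume (symmDiff ((fun x => x + (s : AddCircle (d : ℝ))) ⁻¹' C) C) := by
  refine (measure_mono (translateMismatch_subset C s)).trans
    ((measure_biUnion_finset_le _ _).trans ?_)
  simp only [measure_preimage_add_right, Finset.sum_const, Finset.card_range, nsmul_eq_mul, le_refl]

lemma tendsto_measure_symmDiff_add {C : Set (AddCircle (d : ℝ))} (hC : MeasurableSet C) :
    Tendsto (fun s : ℝ => volume (symmDiff ((fun x => x + (s : AddCircle (d : ℝ))) ⁻¹' C) C))
      (nhds 0) (nhds 0) := by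
  let F : C(ℝ, C(AddCircle (d : ℝ), AddCircle (d : ℝ))) := ContinuousMap.curry
    ⟨fun p : ℝ × AddCircle (d : ℝ) => p.2 + (p.1 : AddCircle (d : ℝ)),
      continuous_snd.add ((AddCircle.continuous_mk' _).comp continuous_fst)⟩
  have hF : ∀ s, ⇑(F s) = fun x => x + (s : AddCircle (d : ℝ)) := fun s => rfl
  have h := tendsto_measure_symmDiff_preimage_nhds_zero (μ := volume) (ν := volume)
    (s := C) (F.continuous.tendsto 0)
    (.of_forall fun s => by rw [hF]; exact measurePreserving_add_right _ _)
    (by rw [hF]; exact measurePreserving_add_right _ _) hC.nullMeasurableSet (measure_ne_top _ _)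
  simpa only [hF, AddCircle.coe_zero, add_zero, Set.preimage_id'] using h

section Invariant

variable {α : ℝ} {C : Set (AddCircle (d : ℝ))}

lemma coe_flipShift_iterate_mem (hinv : circleFlipShift α ⁻¹' C = C) (n : ℕ) (v : ℝ) :
    (((flipShift α)^[n] v : ℝ) : AddCircle (d : ℝ)) ∈ C ↔ (v : AddCircle (d : ℝ)) ∈ C := by
  rw [← circleFlipShift_iterate_coe, ← Set.mem_preimage, Set.preimage_iterate_eq,
    Function.iterate_fixed hinv]

lemma circleFlipShift_mem_translateMismatch_two (hinv : circleFlipShift α ⁻¹' C = C)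
    (x : AddCircle (d : ℝ)) :
    circleFlipShift α x ∈ translateMismatch C 2 ↔ x ∈ translateMismatch C 2 := by
  have key : ∀ t : ℤ, x + ((t : ℝ) : AddCircle (d : ℝ)) ∈ C ↔
      circleFlipShift α x + (((-t : ℤ) : ℝ) : AddCircle (d : ℝ)) ∈ C := fun t => by
    nth_rewrite 1 [← hinv]
    rw [Set.mem_preimage, circleFlipShift_add_int, Int.cast_neg, AddCircle.coe_neg, sub_eq_add_neg]
  have two : ∀ (y : AddCircle (d : ℝ)) (t : ℤ), y + ((t : ℝ) : AddCircle (d : ℝ)) +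
      ((2 : ℝ) : AddCircle (d : ℝ)) = y + (((t + 2 : ℤ) : ℝ) : AddCircle (d : ℝ)) := by
    intro y t
    push_cast
    rw [AddCircle.coe_add, add_assoc]
  simp only [translateMismatch, two]
  constructor
  · rintro ⟨t, ht⟩
    refine ⟨-t - 2, fun h => ht ?_⟩
    rw [key, key] at h
    rw [show -(-t - 2) = t + 2 by ring, show -(-t - 2 + 2) = t by ring] at h
    exact h.symm
  · rintro ⟨t, ht⟩
    refine ⟨-t - 2, fun h => ht ?_⟩
    rw [key, key, show -(t + 2) = -t - 2 by ring, show -t = -t - 2 + 2 by ring]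
    simpa using h.symm

lemma add_mem_translateMismatch_two (hinv : circleFlipShift α ⁻¹' C = C)
    (x : AddCircle (d : ℝ)) :
    x + (α : AddCircle (d : ℝ)) ∈ translateMismatch C 2 ↔ x ∈ translateMismatch C 2 := by
  obtain ⟨m, hm⟩ := exists_circleFlipShift_eq_add_int α x
  rw [← circleFlipShift_mem_translateMismatch_two hinv x, hm, add_int_mem_translateMismatch]

lemma mem_translateMismatch_of_floor (hinv : circleFlipShift α ⁻¹' C = C) {v s : ℝ} {j n : ℕ}
    (hj : j < n) (h : ∀ i < n, ⌊v + s + i * α⌋ = ⌊v + i * α⌋ + if i = j then 1 else 0)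
    (h2 : ((v + n * α : ℝ) : AddCircle (d : ℝ)) ∈ translateMismatch C 2) :
    (v : AddCircle (d : ℝ)) ∈ translateMismatch C s ∨
      ((v + n * α : ℝ) : AddCircle (d : ℝ)) ∈ translateMismatch C s := by
  by_contra! hcon
  obtain ⟨hc1, hc2⟩ := hcon
  simp only [translateMismatch, Set.mem_ofPred_eq, not_exists, not_not, ← AddCircle.coe_add]
    at hc1 hc2
  obtain ⟨κ, hκ, -, hκ1⟩ := exists_flipShift_iterate_add h
  obtain ⟨N, hN⟩ := exists_flipShift_iterate_eq (α := α) n v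
  obtain ⟨σ, hσ, hσ1⟩ := exists_flipShift_iterate_add_int (α := α) n
  have hσσ : (σ : ℝ) * σ = 1 := by rcases hσ with rfl | rfl <;> norm_num
  have key : ∀ t : ℤ, ((v + n * α + t : ℝ) : AddCircle (d : ℝ)) ∈ C ↔
      ((v + n * α + (t + 2 * κ) : ℝ) : AddCircle (d : ℝ)) ∈ C := by
    intro t
    have e1 := coe_flipShift_iterate_mem hinv n (v + (σ * (t - N) : ℤ))
    have e2 := coe_flipShift_iterate_mem hinv n (v + s + (σ * (t - N) : ℤ))
    have e3 := hc1 (σ * (t - N))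
    have e4 := hc2 (t + 2 * κ)
    rw [hσ1] at e1 e2
    rw [hκ] at e2
    rw [hN] at e1 e2
    have r1 : v + n * α + N + σ * ((σ * (t - N) : ℤ) : ℝ) = v + n * α + t := by
      push_cast; rw [← mul_assoc, hσσ]; ring
    have r2 : v + n * α + N + s + 2 * κ + σ * ((σ * (t - N) : ℤ) : ℝ) =
        v + n * α + (t + 2 * κ : ℤ) + s := by
      push_cast; rw [← mul_assoc, hσσ]; ring
    have r3 : v + s + ((σ * (t - N) : ℤ) : ℝ) = v + ((σ * (t - N) : ℤ) : ℝ) + s := by ring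
    rw [r1] at e1
    rw [r2, r3] at e2
    rw [e1, e3, ← e2, ← e4]
    push_cast
    rfl
  obtain ⟨t, ht⟩ := h2
  rw [← AddCircle.coe_add, ← AddCircle.coe_add] at ht
  refine ht ?_
  rcases hκ1 hj with rfl | rfl
  · have := key t
    push_cast at this
    rw [this]
    ring_nf
  · have := key (t + 2)
    push_cast at this
    rw [← add_assoc] at this
    rw [this]
    ring_nf

omit hd in
lemma exists_coe_eq_abs_add_le {x : AddCircle (d : ℝ)} {a b ε : ℝ}
    (hx : x + (a : ℝ) ∈ Metric.closedBall ((b : ℝ) : AddCircle (d : ℝ)) ε) :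
    ∃ v : ℝ, (v : AddCircle (d : ℝ)) = x ∧ |v + a - b| ≤ ε := by
  induction x using QuotientAddGroup.induction_on with
  | H v =>
    rw [Metric.mem_closedBall, dist_eq_norm] at hx
    change ‖(v : AddCircle (d : ℝ)) + _ - _‖ ≤ ε at hx
    rw [← AddCircle.coe_add, ← AddCircle.coe_sub, AddCircle.norm_eq] at hx
    set r := round ((d : ℝ)⁻¹ * (v + a - b))
    refine ⟨v - r * d, ?_, ?_⟩
    · rw [← sub_eq_zero, ← AddCircle.coe_sub, AddCircle.coe_eq_zero_iff]
      exact ⟨-r, by rw [zsmul_eq_mul]; push_cast; ring⟩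
    · convert hx using 2
      ring

lemma mul_le_measure_translateMismatch (hC : MeasurableSet C)
    (hinv : circleFlipShift α ⁻¹' C = C)
    (hfull : ∀ᵐ x : AddCircle (d : ℝ), x ∈ translateMismatch C 2) {s : ℝ} {n : ℕ}
    (hs0 : 0 < s) (hs1 : s ≤ 1)
    (hs : ∀ m : ℕ, 0 < m → m < n → ∀ k : ℤ, s ≤ |m * α - k|) :
    ENNReal.ofReal (n * s / 2) ≤ 2 * volume (translateMismatch C s) := by
  have hd1 : (1 : ℝ) ≤ d := by
    have : 0 < d := by exact_mod_cast hd.out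
    exact_mod_cast this
  let W : ℕ → Set (AddCircle (d : ℝ)) := fun j =>
    (fun x => x + ((j * α : ℝ) : AddCircle (d : ℝ))) ⁻¹'
      Metric.closedBall ((-(s / 2) : ℝ) : AddCircle (d : ℝ)) (s / 4)
  have hWm : ∀ j, MeasurableSet (W j) := fun j =>
    (measurable_id.add_const _) Metric.isClosed_closedBall.measurableSet
  have hW : ∀ j, volume (W j) = ENNReal.ofReal (s / 2) := by
    intro j
    rw [measure_preimage_add_right, AddCircle.volume_closedBall, min_eq_right (by linarith)]
    ring_nf
  have hdisj : (Finset.range n : Set ℕ).PairwiseDisjoint W := by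
    intro i hi j hj hij
    rw [Function.onFun, Set.disjoint_left]
    intro x hxi hxj
    obtain ⟨v, hv, hvi⟩ := exists_coe_eq_abs_add_le (a := i * α) (b := -(s / 2)) (ε := s / 4) hxi
    obtain ⟨w, hw, hwj⟩ := exists_coe_eq_abs_add_le (a := j * α) (b := -(s / 2)) (ε := s / 4) hxj
    rw [← hw, ← sub_eq_zero, ← AddCircle.coe_sub, AddCircle.coe_eq_zero_iff] at hv
    obtain ⟨k, hk⟩ := hv
    rw [zsmul_eq_mul] at hk
    have h1 := le_abs_sub_of_separated hs (Finset.mem_range.1 hi) (Finset.mem_range.1 hj) hij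
      (-(k * d))
    push_cast at h1
    rw [hk, show ((i : ℝ) - j) * α - -(v - w) = (v + i * α - -(s / 2)) - (w + j * α - -(s / 2)) by
      ring] at h1
    have h2 := abs_sub (v + i * α - -(s / 2)) (w + j * α - -(s / 2))
    linarith
  have hsub : ∀ᵐ x : AddCircle (d : ℝ), x ∈ (⋃ j ∈ Finset.range n, W j) →
      x ∈ translateMismatch C s ∪
        (fun x => x + ((n * α : ℝ) : AddCircle (d : ℝ))) ⁻¹' translateMismatch C s := by
    have hfull' := (measurePreserving_add_right volume
      ((n * α : ℝ) : AddCircle (d : ℝ))).quasiMeasurePreserving.ae hfull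
    filter_upwards [hfull'] with x hx hxW
    obtain ⟨j, hj, hxj⟩ := Set.mem_iUnion₂.1 hxW
    rw [Finset.mem_range] at hj
    obtain ⟨v, rfl, hv⟩ := exists_coe_eq_abs_add_le (a := j * α) (b := -(s / 2)) (ε := s / 4) hxj
    rw [sub_neg_eq_add] at hv
    rw [Set.mem_union, Set.mem_preimage]
    rw [← AddCircle.coe_add] at hx ⊢
    exact mem_translateMismatch_of_floor hinv hj
      (fun i hi => floor_add_eq_of_separated hs0 hs1 hs hj hv hi) hx
  have h1 : volume (⋃ j ∈ Finset.range n, W j) = ENNReal.ofReal (n * s / 2) := by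
    rw [measure_biUnion_finset hdisj fun j _ => hWm j]
    simp only [hW, Finset.sum_const, Finset.card_range, nsmul_eq_mul]
    rw [mul_div_assoc, ENNReal.ofReal_mul (by positivity), ENNReal.ofReal_natCast]
  rw [← h1]
  refine (measure_mono_ae hsub).trans ((measure_union_le _ _).trans ?_)
  rw [measure_preimage_add_right, two_mul]

lemma ae_notMem_translateMismatch_two (hα : Irrational α) (hC : MeasurableSet C)
    (hinv : circleFlipShift α ⁻¹' C = C) :
    ∀ᵐ x : AddCircle (d : ℝ), x ∉ translateMismatch C 2 := by
  have hrot := (ergodic_add_right_of_irrational (d := d) hα).toPreErgodic.aeconst_set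
    (measurableSet_translateMismatch hC 2) (Set.ext (add_mem_translateMismatch_two hinv))
  rcases eventuallyConst_set'.1 hrot with h | h
  · exact measure_eq_zero_iff_ae_notMem.1 (ae_eq_empty.1 h)
  exfalso
  have hfull := eventuallyEq_univ.1 h
  have hlim : Tendsto (fun s : ℝ => 2 * (d * volume (symmDiff
      ((fun x => x + (s : AddCircle (d : ℝ))) ⁻¹' C) C))) (nhds 0) (nhds 0) := by
    have h1 := ENNReal.Tendsto.const_mul (a := (d : ENNReal)) (tendsto_measure_symmDiff_add hC)
      (Or.inr (ENNReal.natCast_ne_top d))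
    have h2 := ENNReal.Tendsto.const_mul (a := (2 : ENNReal)) h1 (Or.inr (by simp))
    simpa only [mul_zero] using h2
  have hev := hlim.eventually_lt_const (u := ENNReal.ofReal (1 / 8)) (by simp)
  obtain ⟨η, hη, hlt⟩ := Metric.eventually_nhds_iff.1 hev
  obtain ⟨n, s, hs0, hs1, hsη, hns, hs⟩ := exists_separated hα hη
  have h1 := hlt (y := s) (by rwa [Real.dist_eq, sub_zero, abs_of_pos hs0])
  have h2 := mul_le_measure_translateMismatch hC hinv hfull hs0 hs1 hs
  have h3 : ENNReal.ofReal (1 / 8) ≤ ENNReal.ofReal (n * s / 2) :=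
    ENNReal.ofReal_le_ofReal (by linarith)
  have h4 := mul_le_mul_right (measure_translateMismatch_le hC s) 2
  exact absurd h1 (not_lt.2 (h3.trans (h2.trans h4)))

end Invariant

lemma ergodic_circleFlipShift {α : ℝ} (hα : Irrational α) :
    Ergodic (circleFlipShift (d := d) α) := by
  refine ⟨measurePreserving_circleFlipShift α, ⟨fun C hC hinv => ?_⟩⟩
  have hae := ae_notMem_translateMismatch_two hα hC hinv
  have hα1 : Irrational (α - 1) := by simpa using hα.sub_intCast 1
  have hrot := ergodic_add_right_of_irrational (d := d) hα1
  have hae' := hrot.quasiMeasurePreserving.ae hae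
  refine eventuallyConst_set'.2 (hrot.quasiErgodic.ae_empty_or_univ₀ hC.nullMeasurableSet ?_)
  refine eventuallyEq_set.2 (hae'.mono fun x hx => ?_)
  simp only [translateMismatch, Set.mem_ofPred_eq, not_exists, not_not] at hx
  have key : ∀ m : ℤ, x + ((α - 1 : ℝ) : AddCircle (d : ℝ)) + ((2 * m : ℝ) : AddCircle (d : ℝ)) ∈ C
      ↔ x + ((α - 1 : ℝ) : AddCircle (d : ℝ)) ∈ C := by
    intro m
    induction m using Int.induction_on with
    | zero => simp
    | succ m ih =>
      rw [← ih]
      have := hx (2 * m)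
      push_cast at this ⊢
      rw [this, add_assoc _ _ ((2 : ℝ) : AddCircle (d : ℝ)), ← AddCircle.coe_add]
      ring_nf
    | pred m ih =>
      rw [← ih]
      have := hx (2 * (-m - 1))
      push_cast at this ⊢
      rw [this, add_assoc _ _ ((2 : ℝ) : AddCircle (d : ℝ)), ← AddCircle.coe_add]
      ring_nf
  rw [Set.mem_preimage]
  nth_rewrite 2 [← hinv]
  rw [Set.mem_preimage]
  induction x using QuotientAddGroup.induction_on with
  | H v =>
    rw [← key (-⌊v⌋)]
    change _ ↔ circleFlipShift α (v : AddCircle (d : ℝ)) ∈ C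
    change (v : AddCircle (d : ℝ)) + _ + _ ∈ C ↔ _
    rw [circleFlipShift_coe, flipShift_eq, ← AddCircle.coe_add, ← AddCircle.coe_add]
    push_cast
    ring_nf

lemma coe_equivIco_coe (v : ℝ) :
    (AddCircle.equivIco (d : ℝ) 0 (v : AddCircle (d : ℝ)) : ℝ) = Int.fract (v / d) * d :=
  AddCircle.coe_equivIco_mk_apply (d : ℝ) v

lemma integral_circleFract : ∫ x : AddCircle (d : ℝ), circleFract x = d / 2 := by
  have h1 : ∫ v in (0 : ℝ)..1, Int.fract v = 1 / 2 := by
    rw [intervalIntegral.integral_congr_Ioo_of_le (g := fun v => v) zero_le_one fun v hv =>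
      Int.fract_eq_self.2 ⟨hv.1.le, hv.2⟩, integral_id]
    norm_num
  have h2 : Function.Periodic (Int.fract : ℝ → ℝ) 1 := Int.fract_periodic ℝ
  have h3 := h2.intervalIntegral_add_zsmul_eq (d : ℤ) 0
    fun a b => intervalIntegrable_iff.2 (Measure.integrableOn_of_bounded (M := 1) (by simp)
      measurable_fract.aestronglyMeasurable (.of_forall fun x => by
        rw [Real.norm_eq_abs, abs_of_nonneg (Int.fract_nonneg _)]
        exact (Int.fract_lt_one _).le))
  rw [← AddCircle.intervalIntegral_preimage (d : ℝ) 0]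
  simp only [circleFract_coe]
  simpa [h1, div_eq_mul_inv] using h3

lemma integral_coe_equivIco :
    ∫ x : AddCircle (d : ℝ), (AddCircle.equivIco (d : ℝ) 0 x : ℝ) = d ^ 2 / 2 := by
  have hd0 : (0 : ℝ) < d := hd.out
  rw [← AddCircle.intervalIntegral_preimage (d : ℝ) 0,
    intervalIntegral.integral_congr_Ioo_of_le (g := fun v => v) (by linarith) fun v hv => ?_,
    integral_id]
  · ring
  · rw [zero_add] at hv
    change (AddCircle.equivIco (d : ℝ) 0 (v : AddCircle (d : ℝ)) : ℝ) = v
    rw [coe_equivIco_coe, Int.fract_eq_self.2 ⟨div_nonneg hv.1.le hd0.le,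
      (div_lt_one hd0).2 hv.2⟩, div_mul_cancel₀ _ hd0.ne']

/-- Half of the increment of the action variable along one step of the accelerator. -/
noncomputable def actionIncrement (q θ : ℝ) (x : AddCircle (d : ℝ)) : ℝ :=
  q / d * (2 * circleFract x - 1) -
    q * (2 * ((AddCircle.equivIco (d : ℝ) 0 (circleFlipShift θ x) : ℝ) / d) - 1)

lemma actionIncrement_coe (q θ v : ℝ) :
    actionIncrement q θ (v : AddCircle (d : ℝ)) =
      q / d * (2 * Int.fract v - 1) - q * (2 * Int.fract (flipShift θ v / d) - 1) := by
  have hd0 : (0 : ℝ) < d := hd.out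
  rw [actionIncrement, circleFract_coe, circleFlipShift_coe, coe_equivIco_coe,
    mul_div_cancel_right₀ _ hd0.ne']

lemma measurable_actionIncrement (q θ : ℝ) : Measurable (actionIncrement (d := d) q θ) :=
  (((measurable_circleFract.const_mul 2).sub_const 1).const_mul _).sub
    (((((measurable_coe_equivIco.comp (measurable_circleFlipShift θ)).div_const _).const_mul
      2).sub_const 1).const_mul q)

lemma abs_actionIncrement_le (q θ : ℝ) (x : AddCircle (d : ℝ)) :
    |actionIncrement q θ x| ≤ |q / d| + |q| := by
  induction x using QuotientAddGroup.induction_on with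
  | H v =>
    have key : ∀ u : ℝ, |2 * Int.fract u - 1| ≤ 1 := fun u => by
      rw [abs_le]
      constructor <;> linarith [Int.fract_nonneg u, Int.fract_lt_one u]
    rw [actionIncrement_coe]
    refine (abs_sub _ _).trans (add_le_add ?_ ?_)
    · rw [abs_mul]
      exact mul_le_of_le_one_right (abs_nonneg _) (key _)
    · rw [abs_mul]
      exact mul_le_of_le_one_right (abs_nonneg _) (key _)

lemma integral_actionIncrement (q θ : ℝ) :
    ∫ x : AddCircle (d : ℝ), actionIncrement q θ x = 0 := by
  have hd0 : (0 : ℝ) < d := hd.out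
  have h1 : ∫ x : AddCircle (d : ℝ), (AddCircle.equivIco (d : ℝ) 0 (circleFlipShift θ x) : ℝ) =
      d ^ 2 / 2 := by
    rw [← integral_coe_equivIco]
    have h := (measurePreserving_circleFlipShift (d := d) θ)
    conv_rhs => rw [← h.map_eq]
    exact (integral_map h.measurable.aemeasurable
      measurable_coe_equivIco.aestronglyMeasurable).symm
  have i1 : Integrable (circleFract (d := d)) := by
    refine Integrable.of_bound measurable_circleFract.aestronglyMeasurable 1 (.of_forall fun x => ?_)
    rw [Real.norm_eq_abs, circleFract, abs_of_nonneg (Int.fract_nonneg _)]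
    exact (Int.fract_lt_one _).le
  have i2 : Integrable fun x : AddCircle (d : ℝ) =>
      (AddCircle.equivIco (d : ℝ) 0 (circleFlipShift θ x) : ℝ) := by
    refine Integrable.of_bound (measurable_coe_equivIco.comp
      (measurable_circleFlipShift θ)).aestronglyMeasurable d (.of_forall fun x => ?_)
    have := (AddCircle.equivIco (d : ℝ) 0 (circleFlipShift θ x)).2
    rw [Real.norm_eq_abs, abs_of_nonneg this.1]
    linarith [this.2]
  have hvol : volume.real (Set.univ : Set (AddCircle (d : ℝ))) = d := by
    rw [measureReal_def, AddCircle.measure_univ, ENNReal.toReal_ofReal hd0.le]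
  have e : (actionIncrement (d := d) q θ) = fun x => (2 * q / d) * circleFract x -
      (2 * q / d) * (AddCircle.equivIco (d : ℝ) 0 (circleFlipShift θ x) : ℝ) + (q - q / d) := by
    funext x
    rw [actionIncrement]
    ring
  have i3 := (i1.const_mul (2 * q / d)).sub (i2.const_mul (2 * q / d))
  simp only [Pi.sub_def] at i3
  rw [e, integral_add i3 (integrable_const _), integral_sub (i1.const_mul _) (i2.const_mul _),
    integral_const_mul, integral_const_mul, h1, integral_circleFract, integral_const, hvol, smul_eq_mul]
  field_simp
  ring

lemma quasiMeasurePreserving_coe :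
    Measure.QuasiMeasurePreserving (fun v : ℝ => (v : AddCircle (d : ℝ))) := by
  refine ⟨AddCircle.measurable_mk', Measure.AbsolutelyContinuous.mk fun s hs h0 => ?_⟩
  rw [Measure.map_apply AddCircle.measurable_mk' hs]
  have hcover := iUnion_Ioc_add_zsmul hd.out (0 : ℝ)
  rw [← Set.inter_univ ((fun v : ℝ => (v : AddCircle (d : ℝ))) ⁻¹' s), ← hcover, Set.inter_iUnion]
  refine measure_iUnion_null fun k => ?_
  have h := (AddCircle.measurePreserving_mk (d : ℝ) (0 + k • (d : ℝ))).measure_preimage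
    hs.nullMeasurableSet
  rw [h0, Measure.restrict_apply (AddCircle.measurable_mk' hs)] at h
  rw [add_zsmul, one_zsmul, ← add_assoc]
  exact h

end Circle

/-- The complete Poincaré map, in terms of the resonance order. -/
noncomputable def accelerator (q : ℕ) (p : ℝ × ℝ) : ℝ × ℝ :=
  (Int.fract (Int.fract (p.1 - p.2 / 2) -
      (p.2 + 2 * (q / (q + 1)) * (2 * Int.fract (p.1 - p.2 / 2) - 1)) / 2),
    p.2 + 2 * (q / (q + 1)) * (2 * Int.fract (p.1 - p.2 / 2) - 1) -
      2 * q * (2 * Int.fract (Int.fract (p.1 - p.2 / 2) -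
        (p.2 + 2 * (q / (q + 1)) * (2 * Int.fract (p.1 - p.2 / 2) - 1)) / 2) - 1))

lemma measurable_accelerator (q : ℕ) : Measurable (accelerator q) := by
  have h1 : Measurable fun p : ℝ × ℝ => Int.fract (p.1 - p.2 / 2) :=
    measurable_fract.comp (by fun_prop)
  have h2 : Measurable fun p : ℝ × ℝ =>
      p.2 + 2 * (q / (q + 1)) * (2 * Int.fract (p.1 - p.2 / 2) - 1) := by fun_prop
  have h3 : Measurable fun p : ℝ × ℝ => Int.fract (Int.fract (p.1 - p.2 / 2) -
      (p.2 + 2 * (q / (q + 1)) * (2 * Int.fract (p.1 - p.2 / 2) - 1)) / 2) :=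
    measurable_fract.comp (by fun_prop)
  exact h3.prodMk (h2.sub (((h3.const_mul 2).sub_const 1).const_mul _))

/-- The point of the phase plane has slow coordinate `θ` and fast coordinate `v`, modulo integers
that do not matter for the dynamics. -/
def HasCoordinates (q : ℕ) (θ v : ℝ) (p : ℝ × ℝ) : Prop :=
  ∃ m r : ℤ, p.1 - p.2 / 2 = v + m + (q + 1) * r ∧ -q * p.1 - p.2 / 2 = θ + m

section Dynamics

variable {q : ℕ} {θ v : ℝ} {p : ℝ × ℝ}

local instance : Fact ((0 : ℝ) < ((q + 1 : ℕ) : ℝ)) := ⟨by positivity⟩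

lemma HasCoordinates.accelerator (h : HasCoordinates q θ v p) :
    HasCoordinates q θ (flipShift (2 * θ) v) (accelerator q p) ∧
      (accelerator q p).2 = p.2 + 2 * actionIncrement (d := q + 1) q θ v := by
  obtain ⟨m, r, h1, h2⟩ := h
  have hd0 : (q : ℝ) + 1 ≠ 0 := by positivity
  have hx : Int.fract (p.1 - p.2 / 2) = Int.fract v := by
    rw [h1]
    have := Int.fract_add_intCast v (m + (q + 1) * r)
    push_cast at this
    rwa [← add_assoc] at this
  have hI : p.2 / 2 = -(θ + m + q * (v + m + (q + 1) * r)) / (q + 1) := by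
    rw [← h1, ← h2]; field_simp; ring
  have hu : Int.fract (p.1 - p.2 / 2) -
      (p.2 + 2 * (q / (q + 1)) * (2 * Int.fract (p.1 - p.2 / 2) - 1)) / 2 =
      flipShift θ v / (q + 1) + ((⌊v⌋ + m + q * r + 1 : ℤ) : ℝ) := by
    rw [hx, add_div, hI, flipShift, Int.fract]
    push_cast
    field_simp
    ring
  have hy : (_root_.accelerator q p).1 = Int.fract (flipShift θ v / (q + 1)) := by
    rw [_root_.accelerator]
    dsimp only
    rw [hu, Int.fract_add_intCast]
  have hJ : (_root_.accelerator q p).2 = p.2 + 2 * (q / (q + 1)) * (2 * Int.fract v - 1) -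
      2 * q * (2 * Int.fract (flipShift θ v / (q + 1)) - 1) := by
    rw [← hy, _root_.accelerator, hx]
  refine ⟨⟨m + q * (⌊v⌋ + m + (q + 1) * r - (⌊flipShift θ v / (q + 1)⌋ + ⌊v⌋ + m + q * r + 1)),
    ⌊v⌋ + m + (q + 1) * r - r + 1 - (⌊flipShift θ v / (q + 1)⌋ + ⌊v⌋ + m + q * r + 1),
    ?_, ?_⟩, ?_⟩
  · rw [hy, hJ, sub_div, add_div, hI, flipShift_eq, Int.fract, Int.fract]
    generalize ⌊flipShift θ v / ((q : ℝ) + 1)⌋ = n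
    rw [flipShift_eq]
    push_cast
    field_simp
    ring
  · rw [hy, hJ, sub_div, add_div, hI, Int.fract, Int.fract]
    generalize ⌊flipShift θ v / ((q : ℝ) + 1)⌋ = n
    rw [flipShift_eq]
    push_cast
    field_simp
    ring
  · rw [hJ, actionIncrement_coe]
    push_cast
    ring

lemma HasCoordinates.accelerator_iterate (h : HasCoordinates q θ v p) (n : ℕ) :
    HasCoordinates q θ ((flipShift (2 * θ))^[n] v) ((_root_.accelerator q)^[n] p) ∧
      ((_root_.accelerator q)^[n] p).2 = p.2 + 2 * birkhoffSum (circleFlipShift (d := q + 1)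
        (2 * θ)) (actionIncrement q θ) n v := by
  induction n with
  | zero => exact ⟨h, by simp⟩
  | succ n ih =>
    obtain ⟨h1, h2⟩ := ih
    obtain ⟨h3, h4⟩ := h1.accelerator
    rw [Function.iterate_succ_apply', Function.iterate_succ_apply', birkhoffSum_succ,
      circleFlipShift_iterate_coe]
    refine ⟨h3, ?_⟩
    rw [h4, h2]
    ring

/-- The passage from slow and fast coordinates to the phase plane. -/
noncomputable def ofCoordinates (q : ℕ) : ℝ × ℝ →ₗ[ℝ] ℝ × ℝ where
  toFun w := ((w.2 - w.1) / (q + 1), -2 * (w.1 + q * w.2) / (q + 1))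
  map_add' w z := by ext <;> simp <;> ring
  map_smul' c w := by ext <;> simp <;> ring

lemma hasCoordinates_ofCoordinates (w : ℝ × ℝ) :
    HasCoordinates q w.1 w.2 (ofCoordinates q w) := by
  have hd0 : (q : ℝ) + 1 ≠ 0 := by positivity
  refine ⟨0, 0, ?_, ?_⟩ <;>
  · simp only [ofCoordinates, LinearMap.coe_mk, AddHom.coe_mk, Int.cast_zero]
    field_simp
    ring

lemma surjective_ofCoordinates : Function.Surjective (ofCoordinates q) := by
  have hd0 : (q : ℝ) + 1 ≠ 0 := by positivity
  refine fun p => ⟨(-q * p.1 - p.2 / 2, p.1 - p.2 / 2), ?_⟩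
  ext <;>
  · simp only [ofCoordinates, LinearMap.coe_mk, AddHom.coe_mk]
    field_simp
    ring

lemma volume_slice_escaping (hθ : Irrational θ) :
    volume {v : ℝ | Tendsto (fun N : ℕ => |((accelerator q)^[N] (ofCoordinates q (θ, v))).2|)
      atTop atTop} = 0 := by
  have hα : Irrational (2 * θ) := by simpa using hθ.natCast_mul two_ne_zero
  have h0 := measure_tendsto_abs_birkhoffSum_atTop (ergodic_circleFlipShift (d := q + 1) hα)
    (measurable_actionIncrement q θ) (abs_actionIncrement_le q θ) (integral_actionIncrement q θ)
  refine measure_mono_null (fun v hv => ?_) (quasiMeasurePreserving_coe.preimage_null h0)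
  have hN := fun N => ((hasCoordinates_ofCoordinates (q := q) (θ, v)).accelerator_iterate N).2
  simp only [Set.mem_ofPred_eq, hN] at hv
  rw [Set.mem_preimage, Set.mem_ofPred_eq]
  have h1 := tendsto_atTop_add_const_left atTop (-|(ofCoordinates q (θ, v)).2|) hv
  refine Tendsto.atTop_of_const_mul₀ (c := 2) two_pos (tendsto_atTop_mono (fun N => ?_) h1)
  have h2 := abs_add_le (ofCoordinates q (θ, v)).2 (2 * birkhoffSum (circleFlipShift (d := q + 1)
        (2 * θ)) (actionIncrement q θ) N v)
  rw [abs_mul 2, abs_two] at h2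
  linarith

lemma volume_escaping_accelerator (q : ℕ) :
    volume {p : ℝ × ℝ | Tendsto (fun N : ℕ => |((accelerator q)^[N] p).2|) atTop atTop} = 0 := by
  set E := {p : ℝ × ℝ | Tendsto (fun N : ℕ => |((accelerator q)^[N] p).2|) atTop atTop} with hE
  have hEm : MeasurableSet E := by
    have := fun N : ℕ => (measurable_snd.comp ((measurable_accelerator q).iterate N)).abs
    exact measurableSet_tendsto (f := fun (N : ℕ) (p : ℝ × ℝ) => |((accelerator q)^[N] p).2|)
      atTop this
  have hLm : Measurable (ofCoordinates q) :=
    (LinearMap.continuous_of_finiteDimensional _).measurable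
  have h0 : volume (ofCoordinates q ⁻¹' E) = 0 := by
    rw [Measure.volume_eq_prod, Measure.measure_prod_null (hLm hEm)]
    have hirr : ∀ᵐ θ : ℝ, Irrational θ :=
      measure_eq_zero_iff_ae_notMem.1 ((Set.countable_range ((↑) : ℚ → ℝ)).measure_zero volume)
    filter_upwards [hirr] with θ hθ
    exact volume_slice_escaping hθ
  rw [← Set.image_preimage_eq E (surjective_ofCoordinates (q := q)),
    Measure.addHaar_image_linearMap, h0, mul_zero]

end Dynamics

/-- Non-escaping half of the recurrence theorem for the classical piecewise
linear Fermi–Ulam accelerator under `q`-resonance (`B = (q+1)A`): the escaping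
set of the complete Poincaré map `P = P₂ ∘ P₁` has Lebesgue measure zero. -/
theorem escaping_set_null
    (q : ℕ) (hq : 0 < q)
    (A B T : ℝ) (hA : 0 < A) (hB : B = (q + 1) * A) (hT : 0 < T)
    (k 𝒯 : ℝ) (hk : k = (B - A) / T) (h𝒯 : 𝒯 = T / (A * B))
    (P₁ P₂ P : ℝ × ℝ → ℝ × ℝ)
    (hP₁ : ∀ τ I : ℝ, P₁ (τ, I) =
      (Int.fract (τ - I/2), I + 2*A*k*𝒯 * (2 * Int.fract (τ - I/2) - 1)))
    (hP₂ : ∀ τ I : ℝ, P₂ (τ, I) =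
      (Int.fract (τ - I/2), I - 2*B*k*𝒯 * (2 * Int.fract (τ - I/2) - 1)))
    (hP : P = P₂ ∘ P₁) :
    volume {p : ℝ × ℝ |
      Tendsto (fun N : ℕ => |(P^[N] p).2|) atTop atTop} = 0 := by
  have hd0 : (q : ℝ) + 1 ≠ 0 := by positivity
  have h1 : 2 * A * k * 𝒯 = 2 * (q / (q + 1)) := by
    rw [hk, h𝒯, hB]
    field_simp
    ring
  have h2 : 2 * B * k * 𝒯 = 2 * q := by
    rw [hk, h𝒯, hB]
    field_simp
    ring
  have h3 : P = accelerator q := by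
    funext ⟨τ, I⟩
    rw [hP, Function.comp_apply, hP₁, hP₂, h1, h2, accelerator]
  rw [h3]
  exact volume_escaping_accelerator q
end

section
/- Let q be a positive integer, A > 0, B = (q+1)·A, T > 0, k = (B−A)/T, 𝒯 = T/(AB). Define P₁, P₂ : ℝ² → ℝ² by P₁(τ, I) = (fract(τ − I/2), I + 2Ak𝒯·(2·fract(τ − I/2) − 1)) and P₂(τ, I) = (fract(τ − I/2), I − 2Bk𝒯·(2·fract(τ − I/2) − 1)), and P = P₂ ∘ P₁. For (τ, I) ∈ ℝ² and N ∈ ℕ write (τ_N, I_N) = P^N(τ, I). Then for Lebesgue-almost every (τ, I) ∈ ℝ², the set {N ∈ ℕ : |I_N − I| < 2q} is infinite, i.e. the orbit returns to its initial momentum level infinitely often. -/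
open MeasureTheory Filter

open scoped Topology in
/-- For an ergodic map, the Birkhoff averages of a mean-zero square-integrable function tend to zero
in mean square. -/
theorem Ergodic.tendsto_integral_birkhoffAverage_sq {α : Type*} [MeasurableSpace α]
    {μ : Measure α} [IsProbabilityMeasure μ] {T : α → α} (hT : Ergodic T μ) {f : α → ℝ}
    (hf : MemLp f 2 μ) (h0 : ∫ x, f x ∂μ = 0) :
    Tendsto (fun N : ℕ => ∫ x, (birkhoffAverage ℝ T f N x) ^ 2 ∂μ) atTop (𝓝 0) := by
  set U : Lp ℝ 2 μ →L[ℝ] Lp ℝ 2 μ :=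
    (Lp.compMeasurePreservingₗᵢ ℝ T hT.toMeasurePreserving).toContinuousLinearMap with hU
  have hUapp (g : Lp ℝ 2 μ) : U g = Lp.compMeasurePreserving T hT.toMeasurePreserving g := rfl
  have hUn : ‖U‖ ≤ 1 := LinearIsometry.norm_toContinuousLinearMap_le _
  set F : Lp ℝ 2 μ := hf.toLp f with hF
  have hFc : F =ᵐ[μ] f := hf.coeFn_toLp
  have horth : F ∈ (U.eqLocus (1 : Lp ℝ 2 μ →L[ℝ] Lp ℝ 2 μ))ᗮ := by
    rw [Submodule.mem_orthogonal]
    intro g hg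
    have hg' : Lp.compMeasurePreserving T hT.toMeasurePreserving g = g := by
      simpa [← hUapp] using hg
    have hgT : (g : α → ℝ) ∘ T =ᵐ[μ] g := by
      have := Lp.coeFn_compMeasurePreserving g hT.toMeasurePreserving
      rw [hg'] at this
      exact this.symm
    obtain ⟨c, hc⟩ := hT.ae_eq_const_of_ae_eq_comp_ae (Lp.aestronglyMeasurable g) hgT
    rw [L2.inner_def]
    have : ∫ a, inner ℝ (g a) (F a) ∂μ = ∫ a, c * f a ∂μ := by
      refine integral_congr_ae ?_
      filter_upwards [hc, hFc] with a h1 h2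
      simp [h1, h2, mul_comm]
    rw [this, integral_const_mul, h0, mul_zero]
  have hlim := U.tendsto_birkhoffAverage_orthogonalProjection hUn F
  rw [Submodule.orthogonalProjectionOnto_eq_zero_iff.2 horth] at hlim
  have hiter (n : ℕ) : (U^[n] F : Lp ℝ 2 μ) =ᵐ[μ] f ∘ T^[n] := by
    have h1 : U^[n] F = Lp.compMeasurePreserving T^[n] (hT.toMeasurePreserving.iterate n) F := by
      rw [← Lp.compMeasurePreserving_iterate]
      rfl
    rw [h1]
    exact (Lp.coeFn_compMeasurePreserving F _).trans
      ((hT.toMeasurePreserving.iterate n).quasiMeasurePreserving.ae_eq_comp hFc)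
  have havg (N : ℕ) : (birkhoffAverage ℝ U _root_.id N F : Lp ℝ 2 μ) =ᵐ[μ]
      birkhoffAverage ℝ T f N := by
    have h2 : ∀ᵐ x ∂μ, ∀ n : ℕ, (U^[n] F : Lp ℝ 2 μ) x = f (T^[n] x) :=
      ae_all_iff.2 hiter
    have h3 : ((∑ n ∈ Finset.range N, U^[n] F : Lp ℝ 2 μ) : α → ℝ) =ᵐ[μ]
        fun x => ∑ n ∈ Finset.range N, (U^[n] F : Lp ℝ 2 μ) x := by
      refine (Lp.coeFn_finsetSum _ _).trans ?_
      filter_upwards with x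
      simp
    have h4 := Lp.coeFn_smul ((N : ℝ)⁻¹) (∑ n ∈ Finset.range N, U^[n] F : Lp ℝ 2 μ)
    filter_upwards [h2, h3, h4] with x h2 h3 h4
    simp only [birkhoffAverage, birkhoffSum, id]
    rw [h4, Pi.smul_apply, h3]
    simp [h2]
  have hsq (N : ℕ) : ∫ x, (birkhoffAverage ℝ T f N x) ^ 2 ∂μ =
      ‖(birkhoffAverage ℝ U _root_.id N F : Lp ℝ 2 μ)‖ ^ 2 := by
    rw [← real_inner_self_eq_norm_sq, L2.inner_def]
    refine integral_congr_ae ?_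
    filter_upwards [havg N] with x hx
    rw [hx]
    simp [sq]
  simp_rw [hsq]
  have := (hlim.norm).pow 2
  simpa using this

/-- Among the first `N` iterates of `x`, those after which an integer cocycle never returns to its
current value have pairwise distinct Birkhoff sums. -/
theorem card_filter_birkhoffSum_ne_zero_le {α : Type*} (T : α → α) (f : α → ℤ) (N K : ℕ) (x : α)
    (p : α → Prop) [DecidablePred p] (hp : ∀ y, p y → ∀ n, 1 ≤ n → birkhoffSum T f n y ≠ 0) :
    ((Finset.range N).filter fun i => p (T^[i] x)).card ≤
      2 * K + 1 + ((Finset.range N).filter fun i => (K : ℤ) < |birkhoffSum T f i x|).card := by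
  have hsub : ((Finset.range N).filter fun i => p (T^[i] x)) ⊆
      ((Finset.range N).filter fun i => p (T^[i] x) ∧ |birkhoffSum T f i x| ≤ K) ∪
        ((Finset.range N).filter fun i => (K : ℤ) < |birkhoffSum T f i x|) := by
    intro i hi
    simp only [Finset.mem_filter, Finset.mem_union] at hi ⊢
    rcases le_or_gt |birkhoffSum T f i x| (K : ℤ) with h | h
    · exact Or.inl ⟨hi.1, hi.2, h⟩
    · exact Or.inr ⟨hi.1, h⟩
  refine (Finset.card_le_card hsub).trans ((Finset.card_union_le _ _).trans ?_)
  gcongr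
  have hne : ∀ i j, i < j → p (T^[i] x) → birkhoffSum T f i x ≠ birkhoffSum T f j x := by
    intro i j hij hi h
    refine hp _ hi (j - i) (by omega) ?_
    have := birkhoffSum_add T f i (j - i) x
    rw [Nat.add_sub_cancel' hij.le] at this
    omega
  calc _ ≤ (Finset.Icc (-(K : ℤ)) K).card := by
        refine Finset.card_le_card_of_injOn (fun i => birkhoffSum T f i x) ?_ ?_
        · intro i hi
          simp only [Finset.coe_filter, Set.mem_ofPred_eq] at hi
          simpa [abs_le] using hi.2.2
        · intro i hi j hj hij
          simp only [Finset.coe_filter, Set.mem_ofPred_eq] at hi hj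
          rcases lt_trichotomy i j with h | h | h
          · exact absurd hij (hne i j h hi.2.1)
          · exact h
          · exact absurd hij.symm (hne j i h hj.2.1)
    _ = 2 * K + 1 := by simp; omega

theorem measurable_birkhoffSum {α M : Type*} [MeasurableSpace α] [AddCommMonoid M]
    [MeasurableSpace M] [MeasurableAdd₂ M] {T : α → α} (hT : Measurable T) {f : α → M}
    (hf : Measurable f) (n : ℕ) : Measurable (birkhoffSum T f n) := by
  unfold birkhoffSum
  exact Finset.measurable_fun_sum _ fun i _ => hf.comp (hT.iterate i)

/-- **Atkinson's theorem** for bounded integer cocycles: over an ergodic map, the Birkhoff sums of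
a mean-zero bounded integer-valued function almost surely vanish infinitely often. -/
theorem Ergodic.ae_infinite_birkhoffSum_eq_zero {α : Type*} [MeasurableSpace α]
    {μ : Measure α} [IsProbabilityMeasure μ] {T : α → α} (hT : Ergodic T μ) {f : α → ℤ}
    (hfm : Measurable f) {C : ℝ} (hC : ∀ x, |(f x : ℝ)| ≤ C) (h0 : ∫ x, (f x : ℝ) ∂μ = 0) :
    ∀ᵐ x ∂μ, {N : ℕ | birkhoffSum T f N x = 0}.Infinite := by
  classical
  have hTm := hT.measurable
  have hfm' : Measurable fun x => (f x : ℝ) := measurable_from_top.comp hfm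
  have hSm (n : ℕ) : Measurable (birkhoffSum T f n) := measurable_birkhoffSum hTm hfm n
  have hL2 : MemLp (fun x => (f x : ℝ)) 2 μ :=
    MemLp.of_bound hfm'.aestronglyMeasurable C (ae_of_all _ fun x => by simpa using hC x)
  have hlim := hT.tendsto_integral_birkhoffAverage_sq hL2 h0
  set D : Set α := {x | ∀ n, 1 ≤ n → birkhoffSum T f n x ≠ 0} with hD
  have hDm : MeasurableSet D := by
    rw [hD]
    simp only [Set.ofPred_forall]
    exact MeasurableSet.iInter fun n => MeasurableSet.iInter fun _ =>
      (hSm n (measurableSet_singleton 0)).compl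
  have hcast (n : ℕ) (x : α) :
      ((birkhoffSum T f n x : ℤ) : ℝ) = n * birkhoffAverage ℝ T (fun x => (f x : ℝ)) n x := by
    rcases Nat.eq_zero_or_pos n with rfl | hn
    · simp
    · have : (n : ℝ) ≠ 0 := by positivity
      simp [birkhoffAverage, birkhoffSum, this]
  have hgint (n : ℕ) :
      Integrable (fun x => (birkhoffAverage ℝ T (fun x => (f x : ℝ)) n x) ^ 2) μ := by
    have hm : Measurable (birkhoffAverage ℝ T (fun x => (f x : ℝ)) n) :=
      (measurable_birkhoffSum hTm hfm' n).const_smul (n : ℝ)⁻¹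
    refine Integrable.of_bound (hm.pow_const 2).aestronglyMeasurable (C ^ 2)
      (ae_of_all _ fun x => ?_)
    have hC0 : 0 ≤ C := (abs_nonneg _).trans (hC x)
    have hb : |birkhoffAverage ℝ T (fun x => (f x : ℝ)) n x| ≤ C := by
      rcases Nat.eq_zero_or_pos n with rfl | hn
      · simpa using hC0
      · have hn' : (0 : ℝ) < n := by positivity
        rw [birkhoffAverage, smul_eq_mul, abs_mul, abs_of_pos (inv_pos.2 hn'),
          inv_mul_le_iff₀ hn']
        calc |birkhoffSum T (fun x => (f x : ℝ)) n x|
            ≤ ∑ i ∈ Finset.range n, |(f (T^[i] x) : ℝ)| := Finset.abs_sum_le_sum_abs _ _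
          _ ≤ ∑ i ∈ Finset.range n, C := Finset.sum_le_sum fun i _ => hC _
          _ = n * C := by simp
    rw [Real.norm_eq_abs, abs_pow]
    gcongr
  have hcount (N K : ℕ) : N * μ.real D ≤
      2 * K + 1 + ∑ i ∈ Finset.range N, μ.real {x | (K : ℤ) < |birkhoffSum T f i x|} := by
    have hpre (i : ℕ) : μ.real (T^[i] ⁻¹' D) = μ.real D :=
      (hT.toMeasurePreserving.iterate i).measureReal_preimage hDm.nullMeasurableSet
    have hEm (i : ℕ) : MeasurableSet {x | (K : ℤ) < |birkhoffSum T f i x|} :=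
      (measurable_from_top (f := fun n : ℤ => |n|)).comp (hSm i) |> measurableSet_lt measurable_const
    have hPm (i : ℕ) : MeasurableSet (T^[i] ⁻¹' D) := (hTm.iterate i) hDm
    have h1 : ∫ x, ∑ i ∈ Finset.range N, (T^[i] ⁻¹' D).indicator (fun _ => (1 : ℝ)) x ∂μ ≤
        ∫ x, (2 * K + 1 + ∑ i ∈ Finset.range N,
          {x | (K : ℤ) < |birkhoffSum T f i x|}.indicator (fun _ => (1 : ℝ)) x) ∂μ := by
      refine integral_mono ?_ ?_ fun x => ?_
      · exact integrable_finsetSum _ fun i _ => (integrable_const _).indicator (hPm i)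
      · exact (integrable_const _).add
          (integrable_finsetSum _ fun i _ => (integrable_const _).indicator (hEm i))
      · have := card_filter_birkhoffSum_ne_zero_le T f N K x (· ∈ D) (fun y hy => hy)
        simp only [Set.indicator_apply, Set.mem_preimage, Set.mem_ofPred_eq, Finset.sum_boole]
        exact_mod_cast this
    rw [integral_finsetSum _ fun i _ => (integrable_const _).indicator (hPm i),
      integral_add (integrable_const _)
        (integrable_finsetSum _ fun i _ => (integrable_const _).indicator (hEm i)),
      integral_finsetSum _ fun i _ => (integrable_const _).indicator (hEm i)] at h1
    simp only [integral_indicator_const _ (hPm _), integral_indicator_const _ (hEm _), hpre] at h1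
    simpa using h1
  have hDle (ε : ℝ) (hε : 0 < ε) : μ.real D ≤ 2 * ε + ε := by
    obtain ⟨M, hM⟩ := eventually_atTop.1 (hlim.eventually (gt_mem_nhds (show 0 < ε ^ 3 by positivity)))
    have hprob (N i : ℕ) (hi : i < N) (hMi : M ≤ i) :
        μ.real {x | ((⌊ε * N⌋₊ : ℕ) : ℤ) < |birkhoffSum T f i x|} ≤ ε := by
      have hN : (0 : ℝ) < N := by exact_mod_cast (by omega : 0 < N)
      have hsub : {x | ((⌊ε * N⌋₊ : ℕ) : ℤ) < |birkhoffSum T f i x|} ⊆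
          {x | ε ^ 2 ≤ (birkhoffAverage ℝ T (fun x => (f x : ℝ)) i x) ^ 2} := by
        intro x hx
        simp only [Set.mem_ofPred_eq] at hx ⊢
        have h1 : ε * N < |((birkhoffSum T f i x : ℤ) : ℝ)| := by
          refine (Nat.lt_floor_add_one _).trans_le ?_
          exact_mod_cast hx
        rw [hcast, abs_mul, Nat.abs_cast] at h1
        rw [← sq_abs (birkhoffAverage _ _ _ _ _)]
        have h2 : ε * N ≤ N * |birkhoffAverage ℝ T (fun x => (f x : ℝ)) i x| :=
          h1.le.trans (by gcongr)
        have h3 : ε ≤ |birkhoffAverage ℝ T (fun x => (f x : ℝ)) i x| := by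
          rw [mul_comm] at h2
          exact le_of_mul_le_mul_left h2 hN
        gcongr
      have h2 := mul_meas_ge_le_integral_of_nonneg (ae_of_all _ fun x => sq_nonneg _)
        (hgint i) (ε ^ 2)
      have h3 := (measureReal_mono hsub (measure_ne_top μ _))
      have h4 := hM i hMi
      have h5 : ε ^ 2 * μ.real {x | ((⌊ε * N⌋₊ : ℕ) : ℤ) < |birkhoffSum T f i x|} ≤ ε ^ 2 * ε :=
        (mul_le_mul_of_nonneg_left h3 (by positivity)).trans (h2.trans (h4.le.trans (by ring_nf; rfl)))
      exact le_of_mul_le_mul_left h5 (by positivity)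
    have hbd (N : ℕ) (hN : 0 < N) : μ.real D ≤ 2 * ε + ε + (1 + M) / N := by
      have hN' : (0 : ℝ) < N := by exact_mod_cast hN
      have h1 := hcount N ⌊ε * N⌋₊
      have h2 : (⌊ε * N⌋₊ : ℝ) ≤ ε * N := Nat.floor_le (by positivity)
      have h3 : ∑ i ∈ Finset.range N, μ.real {x | ((⌊ε * N⌋₊ : ℕ) : ℤ) < |birkhoffSum T f i x|} ≤
          ∑ i ∈ Finset.range N, (ε + if i < M then 1 else 0) := by
        refine Finset.sum_le_sum fun i hi => ?_
        split_ifs with h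
        · exact measureReal_le_one.trans (by linarith)
        · simpa using hprob N i (Finset.mem_range.1 hi) (not_lt.1 h)
      have h4 : ∑ i ∈ Finset.range N, (ε + if i < M then (1 : ℝ) else 0) ≤ N * ε + M := by
        rw [Finset.sum_add_distrib, Finset.sum_boole]
        have : ((Finset.range N).filter (· < M)).card ≤ M := by
          refine (Finset.card_le_card (t := Finset.range M) fun i hi => ?_).trans (by simp)
          simp_all
        have : (((Finset.range N).filter (· < M)).card : ℝ) ≤ M := by exact_mod_cast this
        simpa using this
      have h5 : N * μ.real D ≤ N * (2 * ε + ε + (1 + M) / N) := by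
        have : N * (2 * ε + ε + (1 + M) / N) = 2 * (ε * N) + N * ε + (1 + M) := by
          field_simp
        linarith
      exact le_of_mul_le_mul_left h5 hN'
    have hl : Tendsto (fun N : ℕ => 2 * ε + ε + (1 + M : ℝ) / N) atTop (nhds (2 * ε + ε + 0)) :=
      tendsto_const_nhds.add (tendsto_const_div_atTop_nhds_zero_nat _)
    rw [add_zero] at hl
    exact ge_of_tendsto hl (eventually_atTop.2 ⟨1, fun N hN => hbd N hN⟩)
  have hD0 : μ D = 0 := by
    have : μ.real D ≤ 0 := by
      refine le_of_forall_pos_le_add fun ε hε => ?_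
      have := hDle (ε / 3) (by positivity)
      linarith
    exact (measureReal_eq_zero_iff).1 (le_antisymm this measureReal_nonneg)
  have hae : ∀ᵐ x ∂μ, ∀ i : ℕ, T^[i] x ∉ D := by
    refine ae_all_iff.2 fun i => ?_
    exact (hT.toMeasurePreserving.iterate i).quasiMeasurePreserving.ae
      (measure_eq_zero_iff_ae_notMem.1 hD0)
  filter_upwards [hae] with x hx hfin
  have hmem0 : (0 : ℕ) ∈ {N : ℕ | birkhoffSum T f N x = 0} := by simp
  obtain ⟨N, hN, hmax⟩ := hfin.exists_maximal ⟨0, hmem0⟩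
  have := hx N
  simp only [hD, Set.mem_ofPred_eq, not_forall, not_not] at this
  obtain ⟨n, hn, hn0⟩ := this
  have h1 : N + n ∈ {N : ℕ | birkhoffSum T f N x = 0} := by
    simp only [Set.mem_ofPred_eq] at hN ⊢
    rw [birkhoffSum_add, hN, hn0, add_zero]
  have := hmax h1 (by omega)
  omega

theorem two_mul_sum_range_neg_one_pow_mul {n : ℕ} (hn : Even n) :
    2 * ∑ i ∈ Finset.range n, (-1 : ℤ) ^ i * i = -n := by
  obtain ⟨m, rfl⟩ := hn
  induction m with
  | zero => simp
  | succ m ih =>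
    rw [show m + 1 + (m + 1) = m + m + 1 + 1 by ring, Finset.sum_range_succ,
      Finset.sum_range_succ, mul_add, mul_add, ih]
    have h : (-1 : ℤ) ^ (m + m) = 1 := Even.neg_one_pow ⟨m, rfl⟩
    rw [pow_succ, h]
    push_cast
    ring

theorem neg_one_pow_eq_of_int_parity {i r : ℕ} {N : ℤ} (h : (N - r - i) % 2 = 0) :
    (-1 : ℤ) ^ i = (-1) ^ N.natAbs * (-1) ^ r := by
  rw [← pow_add]
  rcases Nat.even_or_odd i with hi | hi
  · rw [hi.neg_one_pow, Even.neg_one_pow]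
    rw [Nat.even_iff] at hi ⊢
    omega
  · rw [hi.neg_one_pow, Odd.neg_one_pow]
    rw [Nat.odd_iff] at hi ⊢
    omega

/-- The alternating sum of the integer parts of `s - i P / Q` over a full period of even length. -/
theorem two_mul_sum_neg_one_pow_mul_floor {Q : ℕ} (hQ : 0 < Q) (hQe : Even Q) {P : ℤ}
    (hPQ : IsCoprime P (Q : ℤ)) (s : ℝ) :
    2 * ∑ i ∈ Finset.range Q, (-1 : ℤ) ^ i * ⌊s - i * (P / Q)⌋ =
      P + (-1) ^ (⌊Q * s⌋.natAbs) := by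
  have hQ' : (0 : ℝ) < Q := by exact_mod_cast hQ
  have hQz : (0 : ℤ) < Q := by exact_mod_cast hQ
  set N := ⌊Q * s⌋ with hN
  have hfl (i : ℕ) : ⌊s - i * ((P : ℝ) / Q)⌋ = (N - i * P) / (Q : ℤ) := by
    have h1 : s - i * ((P : ℝ) / Q) = (Q * s - (i * P : ℤ)) / (Q : ℕ) := by
      push_cast
      field_simp
    rw [h1, Int.floor_div_natCast, Int.floor_sub_intCast]
  simp_rw [hfl]
  have hPodd : P % 2 = 1 := by
    obtain ⟨a, b, hab⟩ := hPQ
    obtain ⟨k, rfl⟩ := hQe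
    by_contra h
    obtain ⟨p, rfl⟩ : ∃ p, P = 2 * p := ⟨P / 2, by omega⟩
    have : 2 * (a * p + b * k) = 1 := by
      rw [← hab]
      push_cast
      ring
    omega
  have hmod : ∑ i ∈ Finset.range Q, (-1 : ℤ) ^ i * ((N - i * P) % Q) =
      (-1) ^ N.natAbs * ∑ r ∈ Finset.range Q, (-1 : ℤ) ^ r * r := by
    rw [Finset.mul_sum]
    set g : ℕ → ℕ := fun i => ((N - i * P) % Q).toNat with hg
    have hgz (i : ℕ) : ((g i : ℕ) : ℤ) = (N - i * P) % Q :=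
      Int.toNat_of_nonneg (Int.emod_nonneg _ hQz.ne')
    have hgmem (i : ℕ) : g i < Q := by
      have := Int.emod_lt_of_pos (N - i * P) hQz
      rw [← hgz] at this
      exact_mod_cast this
    have hinj : Set.InjOn g (Finset.range Q) := by
      intro i hi j hj hij
      have h1 : (N - i * P) % Q = (N - j * P) % Q := by rw [← hgz, ← hgz, hij]
      have h2 : (Q : ℤ) ∣ (i - j) * P := by
        rw [Int.emod_eq_emod_iff_emod_sub_eq_zero] at h1
        have h2 := dvd_neg.2 (Int.dvd_of_emod_eq_zero h1)
        rwa [show -(N - i * P - (N - j * P)) = (i - j) * P by ring] at h2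
      have h3 : (Q : ℤ) ∣ (i - j) := hPQ.symm.dvd_of_dvd_mul_right h2
      simp only [Finset.coe_range, Set.mem_Iio] at hi hj
      have h4 := Int.eq_zero_of_abs_lt_dvd h3 (by rw [abs_lt]; omega)
      omega
    have himg : (Finset.range Q).image g = Finset.range Q := by
      refine Finset.eq_of_subset_of_card_le (fun k hk => ?_) ?_
      · obtain ⟨i, _, rfl⟩ := Finset.mem_image.1 hk
        exact Finset.mem_range.2 (hgmem i)
      · rw [Finset.card_image_of_injOn hinj]
    conv_rhs => rw [← himg, Finset.sum_image hinj]
    refine Finset.sum_congr rfl fun i _ => ?_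
    rw [← hgz, neg_one_pow_eq_of_int_parity (i := i) (r := g i) (N := N), mul_assoc]
    obtain ⟨k, hk⟩ := hQe
    obtain ⟨p, hp⟩ : ∃ p, P = 2 * p + 1 := ⟨P / 2, by omega⟩
    have h5 := Int.emod_add_mul_ediv (N - i * P) Q
    rw [← hgz] at h5
    have h6 : N - g i - i = 2 * (i * p + k * ((N - i * P) / Q)) := by
      have : (Q : ℤ) = 2 * k := by rw [hk]; push_cast; ring
      rw [this] at h5 ⊢
      subst hp
      linear_combination -h5
    rw [h6]
    simp
  have hsum : (Q : ℤ) * ∑ i ∈ Finset.range Q, (-1 : ℤ) ^ i * ((N - i * P) / Q) =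
      N * ∑ i ∈ Finset.range Q, (-1 : ℤ) ^ i - P * ∑ i ∈ Finset.range Q, (-1 : ℤ) ^ i * i -
        ∑ i ∈ Finset.range Q, (-1 : ℤ) ^ i * ((N - i * P) % Q) := by
    simp_rw [Finset.mul_sum, ← Finset.sum_sub_distrib]
    refine Finset.sum_congr rfl fun i _ => ?_
    linear_combination (-1 : ℤ) ^ i * Int.emod_add_mul_ediv (N - i * P) Q
  rw [hmod, neg_one_geom_sum, if_pos hQe] at hsum
  have h2 := two_mul_sum_range_neg_one_pow_mul hQe
  refine mul_left_cancel₀ hQz.ne' ?_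
  linear_combination 2 * hsum - (P + (-1) ^ N.natAbs) * h2

/-- If no integer lies within `d` of `a`, then all points within `d` of `a` have the same integer
part. -/
theorem floor_eq_floor_of_lt_norm {a b d : ℝ} (hab : |a - b| ≤ d)
    (hd : d < ‖(a : UnitAddCircle)‖) : ⌊a⌋ = ⌊b⌋ := by
  have h (n : ℤ) : d < |a - n| := by
    refine hd.trans_le ?_
    rw [UnitAddCircle.norm_eq]
    exact round_le a n
  rw [abs_le] at hab
  symm
  rw [Int.floor_eq_iff]
  have h0 := h ⌊a⌋
  have h1 := h (⌊a⌋ + 1)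
  have h2 := Int.floor_le a
  have h3 := Int.lt_floor_add_one a
  push_cast at h1
  rw [abs_of_nonneg (by linarith)] at h0
  rw [abs_of_neg (by linarith)] at h1
  constructor <;> linarith

/-- A map of a group which is injective and moves points by countably many translations
preserves any right-invariant finite measure. -/
theorem measurePreserving_of_injective_add {G : Type*} [AddGroup G] [MeasurableSpace G]
    [MeasurableAdd G] {μ : Measure G} [IsFiniteMeasure μ] [μ.IsAddRightInvariant]
    {ι : Type*} [Countable ι] [MeasurableSpace ι] [MeasurableSingletonClass ι]
    {κ : G → ι} (hκ : Measurable κ) (g : ι → G) {T : G → G} (hT : ∀ y, T y = y + g (κ y))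
    (hTm : Measurable T) (hinj : Function.Injective T) : MeasurePreserving T μ μ := by
  have hle (A : Set G) (hA : MeasurableSet A) : μ (T ⁻¹' A) ≤ μ A := by
    have h1 : T ⁻¹' A = ⋃ k, (κ ⁻¹' {k} ∩ T ⁻¹' A) := by
      ext y
      simp
    set B : ι → Set G := fun k => A ∩ (· + -g k) ⁻¹' (κ ⁻¹' {k}) with hB
    have hBm (k : ι) : MeasurableSet (B k) :=
      hA.inter ((hκ (measurableSet_singleton k)).preimage (measurable_add_const _))
    have h2 (k : ι) : κ ⁻¹' {k} ∩ T ⁻¹' A = (· + g k) ⁻¹' B k := by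
      ext y
      simp only [Set.mem_inter_iff, Set.mem_preimage, Set.mem_singleton_iff, hB,
        add_neg_cancel_right, hT]
      constructor
      · rintro ⟨rfl, h⟩
        exact ⟨h, rfl⟩
      · rintro ⟨h, rfl⟩
        exact ⟨rfl, h⟩
    have hdisj : Pairwise (Function.onFun Disjoint B) := by
      intro i j hij
      refine Set.disjoint_left.2 fun z hzi hzj => hij ?_
      have h3 : κ (z + -g i) = i := hzi.2
      have h4 : κ (z + -g j) = j := hzj.2
      have h5 : T (z + -g i) = T (z + -g j) := by simp [hT, h3, h4]
      rw [← h3, ← h4, hinj h5]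
    calc μ (T ⁻¹' A) ≤ ∑' k, μ (κ ⁻¹' {k} ∩ T ⁻¹' A) := by
          conv_lhs => rw [h1]
          exact measure_iUnion_le _
      _ = ∑' k, μ (B k) := by
          refine tsum_congr fun k => ?_
          rw [h2, measure_preimage_add_right]
      _ = μ (⋃ k, B k) := (measure_iUnion hdisj hBm).symm
      _ ≤ μ A := measure_mono (Set.iUnion_subset fun k => Set.inter_subset_left)
  refine ⟨hTm, ?_⟩
  ext A hA
  rw [Measure.map_apply hTm hA]
  refine le_antisymm (hle A hA) ?_
  have h1 := hle Aᶜ hA.compl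
  rw [Set.preimage_compl, measure_compl (hTm hA) (measure_ne_top _ _),
    measure_compl hA (measure_ne_top _ _)] at h1
  exact (ENNReal.sub_le_sub_iff_left (measure_mono (Set.subset_univ _)) (measure_ne_top _ _)).1 h1

namespace FermiUlam

/-- The representative of a point of the unit circle in `[0, 1)`. -/
noncomputable def rep (y : UnitAddCircle) : ℝ := AddCircle.equivIco 1 0 y

theorem rep_coe (τ : ℝ) : rep (τ : UnitAddCircle) = Int.fract τ := by
  have h := AddCircle.coe_equivIco_mk_apply (1 : ℝ) τ
  rw [div_one, mul_one] at h
  exact h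

theorem coe_rep (y : UnitAddCircle) : (rep y : UnitAddCircle) = y :=
  (AddCircle.equivIco 1 0).symm_apply_apply y

theorem rep_nonneg (y : UnitAddCircle) : 0 ≤ rep y := (AddCircle.equivIco 1 0 y).2.1

theorem rep_lt_one (y : UnitAddCircle) : rep y < 1 :=
  lt_of_lt_of_eq (AddCircle.equivIco 1 0 y).2.2 (zero_add 1)

theorem measurable_rep : Measurable rep :=
  measurable_subtype_coe.comp (AddCircle.measurableEquivIco 1 0).measurable

theorem integrable_rep : Integrable rep volume :=
  Integrable.of_bound measurable_rep.aestronglyMeasurable 1 (ae_of_all _ fun y => by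
    rw [Real.norm_of_nonneg (rep_nonneg y)]
    exact (rep_lt_one y).le)

theorem integral_rep : ∫ y, rep y = 1 / 2 := by
  rw [← UnitAddCircle.intervalIntegral_preimage 0, zero_add]
  have : ∫ a in (0 : ℝ)..1, rep a = ∫ a in (0 : ℝ)..1, a := by
    refine intervalIntegral.integral_congr_ae_restrict ?_
    have h1 : ∀ᵐ a ∂(volume : Measure ℝ), a ≠ 1 := by simp [ae_iff]
    refine (ae_restrict_iff' measurableSet_uIoc).2 (h1.mono fun a ha hmem => ?_)
    rw [Set.uIoc_of_le zero_le_one] at hmem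
    change rep (a : UnitAddCircle) = a
    rw [rep_coe, Int.fract_eq_self]
    exact ⟨hmem.1.le, lt_of_le_of_ne hmem.2 ha⟩
  rw [this, integral_id]
  norm_num

/-- A lift of the map describing the evolution of the phase `τ` under the complete Poincaré map,
on the momentum leaf `I + 2 q τ ≡ ω` modulo `2 q`. -/
noncomputable def phaseLift (q : ℕ) (ω τ : ℝ) : ℝ :=
  τ + (q - ω - 2 * ⌊(q + 1) * τ - ω / 2⌋) / (q + 1)

theorem phaseLift_add_intCast (q : ℕ) (ω τ : ℝ) (n : ℤ) :
    phaseLift q ω (τ + n) = phaseLift q ω τ - n := by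
  have h : ((q : ℝ) + 1) * (τ + n) - ω / 2 = (q + 1) * τ - ω / 2 + ((q + 1) * n : ℤ) := by
    push_cast
    ring
  rw [phaseLift, phaseLift, h, Int.floor_add_intCast]
  have : (q : ℝ) + 1 ≠ 0 := by positivity
  push_cast
  field_simp
  ring

/-- The evolution of the phase on the circle. -/
noncomputable def phaseMap (q : ℕ) (ω : ℝ) (y : UnitAddCircle) : UnitAddCircle :=
  (phaseLift q ω (rep y) : ℝ)

/-- The change of the momentum level in one iteration, in units of `2 q`. -/
noncomputable def levelShift (q : ℕ) (ω : ℝ) (y : UnitAddCircle) : ℤ :=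
  ⌊phaseLift q ω (rep y)⌋

theorem coe_intCast (n : ℤ) : ((n : ℝ) : UnitAddCircle) = 0 := by
  rw [AddCircle.coe_eq_zero_iff]
  exact ⟨n, by simp⟩

theorem phaseMap_coe (q : ℕ) (ω τ : ℝ) :
    phaseMap q ω (τ : UnitAddCircle) = (phaseLift q ω τ : UnitAddCircle) := by
  rw [phaseMap, rep_coe, ← Int.self_sub_floor, sub_eq_add_neg, ← Int.cast_neg,
    phaseLift_add_intCast, AddCircle.coe_sub, coe_intCast, sub_zero]

theorem rep_phaseMap (q : ℕ) (ω : ℝ) (y : UnitAddCircle) :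
    rep (phaseMap q ω y) = Int.fract (phaseLift q ω (rep y)) := rep_coe _

theorem measurable_floor_rep (q : ℕ) (ω : ℝ) :
    Measurable fun y : UnitAddCircle => ⌊(q + 1) * rep y - ω / 2⌋ :=
  ((measurable_rep.const_mul _).sub_const _).floor

theorem measurable_phaseLift_rep (q : ℕ) (ω : ℝ) :
    Measurable fun y : UnitAddCircle => phaseLift q ω (rep y) := by
  have h : Measurable fun y : UnitAddCircle => ((⌊(q + 1) * rep y - ω / 2⌋ : ℤ) : ℝ) :=
    measurable_from_top.comp (measurable_floor_rep q ω)
  unfold phaseLift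
  exact measurable_rep.add (((h.const_mul 2).const_sub _).div_const _)

theorem measurable_phaseMap (q : ℕ) (ω : ℝ) : Measurable (phaseMap q ω) :=
  AddCircle.measurable_mk'.comp (measurable_phaseLift_rep q ω)

theorem measurable_levelShift (q : ℕ) (ω : ℝ) : Measurable (levelShift q ω) :=
  (measurable_phaseLift_rep q ω).floor

theorem phaseMap_eq_add (q : ℕ) (ω : ℝ) (y : UnitAddCircle) :
    phaseMap q ω y = y + (((q - ω - 2 * ⌊(q + 1) * rep y - ω / 2⌋) / (q + 1) : ℝ) :
      UnitAddCircle) := by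
  rw [phaseMap, phaseLift, AddCircle.coe_add, coe_rep]

theorem phaseMap_injective (q : ℕ) (ω : ℝ) : Function.Injective (phaseMap q ω) := by
  intro y z h
  have hq : (q : ℝ) + 1 ≠ 0 := by positivity
  rw [phaseMap, phaseMap, ← sub_eq_zero, ← AddCircle.coe_sub, AddCircle.coe_eq_zero_iff] at h
  obtain ⟨n, hn⟩ := h
  set k := ⌊(q + 1) * rep y - ω / 2⌋ with hk
  set l := ⌊(q + 1) * rep z - ω / 2⌋ with hl
  rw [phaseLift, phaseLift, ← hk, ← hl, zsmul_eq_mul, mul_one] at hn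
  have h1 : ((q : ℝ) + 1) * (rep y - rep z) = n * (q + 1) + 2 * (k - l) := by
    field_simp at hn
    linear_combination -hn
  have h2 : (q + 1) * rep y - ω / 2 =
      (q + 1) * rep z - ω / 2 + ((n * (q + 1) + 2 * (k - l) : ℤ) : ℝ) := by
    push_cast
    linear_combination h1
  have h3 : k = l + (n * (q + 1) + 2 * (k - l)) := by
    conv_lhs => rw [hk, h2, Int.floor_add_intCast]
  have h4 : ((k : ℝ) - l) = -(n * (q + 1)) := by
    have : (k : ℝ) = l + (n * (q + 1) + 2 * (k - l)) := by exact_mod_cast h3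
    linarith
  have h5 : rep y = rep z + ((-n : ℤ) : ℝ) := by
    rw [h4] at h1
    refine mul_left_cancel₀ hq ?_
    push_cast
    linear_combination h1
  rw [← coe_rep y, ← coe_rep z, h5, AddCircle.coe_add, coe_intCast, add_zero]

theorem measurePreserving_phaseMap (q : ℕ) (ω : ℝ) : MeasurePreserving (phaseMap q ω) :=
  measurePreserving_of_injective_add (measurable_floor_rep q ω)
    (fun k : ℤ => (((q - ω - 2 * k) / (q + 1) : ℝ) : UnitAddCircle)) (phaseMap_eq_add q ω)
    (measurable_phaseMap q ω) (phaseMap_injective q ω)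

theorem measurePreserving_succ_nsmul_sub (q : ℕ) (hq : 0 < q) (a : UnitAddCircle) :
    MeasurePreserving fun y : UnitAddCircle => (q + 1) • y - a := by
  simp_rw [sub_eq_add_neg]
  exact (AddCircle.ergodic_nsmul_add (-a) (by omega)).toMeasurePreserving

theorem levelShift_eq (q : ℕ) (ω : ℝ) (y : UnitAddCircle) :
    (levelShift q ω y : ℝ) = -rep y + q / (q + 1) +
      2 / (q + 1) * rep ((q + 1) • y - ((ω / 2 : ℝ) : UnitAddCircle)) - rep (phaseMap q ω y) := by
  have hq : (q : ℝ) + 1 ≠ 0 := by positivity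
  have h1 : (q + 1) • y - ((ω / 2 : ℝ) : UnitAddCircle) =
      (((q + 1) * rep y - ω / 2 : ℝ) : UnitAddCircle) := by
    conv_lhs => rw [← coe_rep y, ← AddCircle.coe_nsmul, ← AddCircle.coe_sub]
    simp
  rw [h1, rep_coe, rep_phaseMap, levelShift, ← Int.self_sub_floor, ← Int.self_sub_floor, phaseLift]
  field_simp
  ring

theorem integral_rep_comp {f : UnitAddCircle → UnitAddCircle} (hf : MeasurePreserving f) :
    ∫ y, rep (f y) = 1 / 2 := by
  rw [← integral_rep]
  conv_rhs => rw [← hf.map_eq]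
  rw [integral_map hf.measurable.aemeasurable measurable_rep.aestronglyMeasurable]

theorem integrable_rep_comp {f : UnitAddCircle → UnitAddCircle} (hf : MeasurePreserving f) :
    Integrable fun y => rep (f y) :=
  hf.integrable_comp_of_integrable integrable_rep

theorem integral_levelShift (q : ℕ) (hq : 0 < q) (ω : ℝ) :
    ∫ y, (levelShift q ω y : ℝ) = 0 := by
  have h1 := measurePreserving_phaseMap q ω
  have h2 := measurePreserving_succ_nsmul_sub q hq ((ω / 2 : ℝ) : UnitAddCircle)
  have i4 := (integrable_rep_comp h2).const_mul (2 / ((q : ℝ) + 1))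
  have i0 : Integrable (fun y => -rep y) := integrable_rep.neg
  have i3 : Integrable (fun y => -rep y + (q : ℝ) / (q + 1)) := i0.add (integrable_const _)
  have i5 : Integrable (fun y => -rep y + (q : ℝ) / (q + 1) +
    2 / (q + 1) * rep ((q + 1) • y - ((ω / 2 : ℝ) : UnitAddCircle))) := i3.add i4
  simp_rw [levelShift_eq]
  rw [integral_sub i5 (integrable_rep_comp h1), integral_add i3 i4,
    integral_add i0 (integrable_const _), integral_const_mul, integral_neg, integral_rep,
    integral_rep_comp h1, integral_rep_comp h2, integral_const, measureReal_def, UnitAddCircle.measure_univ,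
    ENNReal.toReal_one, one_smul]
  have hq : (q : ℝ) + 1 ≠ 0 := by positivity
  field_simp
  ring

theorem abs_levelShift_le (q : ℕ) (ω : ℝ) (y : UnitAddCircle) : |(levelShift q ω y : ℝ)| ≤ 3 := by
  have hq : (0 : ℝ) < q + 1 := by positivity
  rw [levelShift_eq]
  set a := rep y
  set b := rep ((q + 1) • y - ((ω / 2 : ℝ) : UnitAddCircle))
  set c := rep (phaseMap q ω y)
  have h1 : (q : ℝ) / (q + 1) + 2 / (q + 1) * b ≤ 2 := by
    rw [div_mul_eq_mul_div, ← add_div, div_le_iff₀ hq]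
    have : b < 1 := rep_lt_one _
    have : (0 : ℝ) ≤ q := by positivity
    linarith
  have h2 : 0 ≤ (q : ℝ) / (q + 1) + 2 / (q + 1) * b := by
    have : 0 ≤ b := rep_nonneg _
    positivity
  have ha0 : 0 ≤ a := rep_nonneg _
  have ha1 : a < 1 := rep_lt_one _
  have hc0 : 0 ≤ c := rep_nonneg _
  have hc1 : c < 1 := rep_lt_one _
  rw [abs_le]
  constructor <;> linarith

theorem phaseLift_phaseLift (q : ℕ) (ω τ : ℝ) :
    phaseLift q ω (phaseLift q ω τ) = τ + (-2 * ω + 2 * ⌊(q + 1) * τ - ω / 2⌋ -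
      2 * ⌊(q + 1) * τ - ω / 2 - ω⌋) / (q + 1) := by
  have hq : (q : ℝ) + 1 ≠ 0 := by positivity
  set s := (q + 1) * τ - ω / 2 with hs
  have h : (q + 1) * phaseLift q ω τ - ω / 2 = s - ω + ((q - 2 * ⌊s⌋ : ℤ) : ℝ) := by
    rw [phaseLift, ← hs, hs]
    push_cast
    field_simp
    ring
  rw [phaseLift, h, Int.floor_add_intCast, phaseLift, ← hs]
  push_cast
  field_simp
  ring

theorem phaseLift_iterate_two_mul (q : ℕ) (ω τ : ℝ) (n : ℕ) :
    (phaseLift q ω)^[2 * n] τ = τ + (-(2 * n * ω) + ((2 * ∑ i ∈ Finset.range (2 * n),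
      (-1 : ℤ) ^ i * ⌊(q + 1) * τ - ω / 2 - i * ω⌋ : ℤ) : ℝ)) / (q + 1) := by
  have hq : (q : ℝ) + 1 ≠ 0 := by positivity
  induction n with
  | zero => simp
  | succ n ih =>
    rw [show 2 * (n + 1) = 2 * n + 1 + 1 by ring, Function.iterate_succ_apply',
      Function.iterate_succ_apply', ih, phaseLift_phaseLift, Finset.sum_range_succ,
      Finset.sum_range_succ, pow_succ, Even.neg_one_pow (even_two_mul n)]
    set S := ∑ i ∈ Finset.range (2 * n), (-1 : ℤ) ^ i * ⌊(q + 1) * τ - ω / 2 - i * ω⌋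
    have h : (q + 1) * (τ + (-(2 * n * ω) + ((2 * S : ℤ) : ℝ)) / (q + 1)) - ω / 2 =
        (q + 1) * τ - ω / 2 - (2 * n : ℕ) * ω + (2 * S : ℤ) := by
      push_cast
      field_simp
      ring
    rw [h, add_sub_right_comm _ ((2 * S : ℤ) : ℝ) ω, Int.floor_add_intCast, Int.floor_add_intCast,
      show (q + 1) * τ - ω / 2 - (2 * n : ℕ) * ω - ω =
        (q + 1) * τ - ω / 2 - (2 * n + 1 : ℕ) * ω by push_cast; ring]
    push_cast
    field_simp
    ring

theorem phaseMap_iterate_coe (q : ℕ) (ω τ : ℝ) (N : ℕ) :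
    (phaseMap q ω)^[N] (τ : UnitAddCircle) = ((phaseLift q ω)^[N] τ : ℝ) :=
  ((show Function.Semiconj ((↑) : ℝ → UnitAddCircle) (phaseLift q ω) (phaseMap q ω) from
    fun τ => (phaseMap_coe q ω τ).symm).iterate_right N τ).symm

/-- The set of phases for which the itinerary of length `Q` may change when the frequency `ω` is
replaced by the rational number `P / Q`. -/
def exceptional (q : ℕ) (ω : ℝ) (P : ℤ) (Q : ℕ) : Set UnitAddCircle :=
  ⋃ i ∈ Finset.range Q, (fun y => (q + 1) • y - ((ω / 2 + i * (P / Q) : ℝ) : UnitAddCircle)) ⁻¹'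
    Metric.closedBall 0 |Q * ω - P|

theorem volume_exceptional_le {q : ℕ} (hq : 0 < q) (ω : ℝ) (P : ℤ) (Q : ℕ) :
    volume (exceptional q ω P Q) ≤ ENNReal.ofReal (2 * Q * |Q * ω - P|) := by
  refine (measure_biUnion_finset_le _ _).trans ?_
  have h (i : ℕ) : volume ((fun y : UnitAddCircle =>
      (q + 1) • y - ((ω / 2 + i * (P / Q) : ℝ) : UnitAddCircle)) ⁻¹'
        Metric.closedBall 0 |Q * ω - P|) ≤ ENNReal.ofReal (2 * |Q * ω - P|) := by
    rw [(measurePreserving_succ_nsmul_sub q hq _).measure_preimage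
      Metric.isClosed_closedBall.measurableSet.nullMeasurableSet, AddCircle.volume_closedBall]
    exact ENNReal.ofReal_le_ofReal (min_le_right _ _)
  refine (Finset.sum_le_sum fun i _ => h i).trans ?_
  rw [Finset.sum_const, Finset.card_range, nsmul_eq_mul, ← ENNReal.ofReal_natCast,
    ← ENNReal.ofReal_mul (by positivity)]
  exact ENNReal.ofReal_le_ofReal (le_of_eq (by ring))

theorem succ_nsmul_coe_div (q : ℕ) : (q + 1) • (((1 / (q + 1) : ℝ)) : UnitAddCircle) = 0 := by
  have hq : (q : ℝ) + 1 ≠ 0 := by positivity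
  rw [← AddCircle.coe_nsmul, nsmul_eq_mul]
  push_cast
  rw [mul_one_div_cancel hq]
  exact AddCircle.coe_period 1

theorem add_mem_exceptional_iff (q : ℕ) (ω : ℝ) (P : ℤ) (Q : ℕ) (y : UnitAddCircle) :
    y + ((1 / (q + 1) : ℝ) : UnitAddCircle) ∈ exceptional q ω P Q ↔ y ∈ exceptional q ω P Q := by
  simp only [exceptional, Set.mem_iUnion, Set.mem_preimage, smul_add, succ_nsmul_coe_div, add_zero]

/-- Away from the exceptional set, the `Q`-th iterate of the phase map is a translation by nearly
`± 1 / (q + 1)`. -/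
theorem phaseMap_iterate_of_notMem {q : ℕ} {ω : ℝ} {P : ℤ} {Q : ℕ} (hQ : 0 < Q) (hQe : Even Q)
    (hPQ : IsCoprime P (Q : ℤ)) {τ : ℝ} (hτ : (τ : UnitAddCircle) ∉ exceptional q ω P Q) :
    (phaseMap q ω)^[Q] (τ : UnitAddCircle) = ((τ - (Q * ω - P) / (q + 1) +
      ((-1) ^ (⌊Q * ((q + 1) * τ - ω / 2)⌋.natAbs) : ℤ) * (1 / (q + 1)) : ℝ) :
        UnitAddCircle) := by
  have hQ' : (0 : ℝ) < Q := by exact_mod_cast hQ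
  have hfl : ∀ i ∈ Finset.range Q, ⌊(q + 1) * τ - ω / 2 - i * ω⌋ =
      ⌊(q + 1) * τ - ω / 2 - i * (P / Q : ℝ)⌋ := by
    intro i hi
    symm
    refine floor_eq_floor_of_lt_norm (d := |Q * ω - P|) ?_ ?_
    · rw [show (q + 1) * τ - ω / 2 - i * (P / Q : ℝ) - ((q + 1) * τ - ω / 2 - i * ω) =
        i / Q * (Q * ω - P) by field_simp; ring, abs_mul]
      refine mul_le_of_le_one_left (abs_nonneg _) ?_
      rw [abs_of_nonneg (by positivity), div_le_one hQ']
      exact_mod_cast (Finset.mem_range.1 hi).le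
    · by_contra hlt
      refine hτ (Set.mem_iUnion₂.2 ⟨i, hi, ?_⟩)
      rw [Set.mem_preimage, mem_closedBall_zero_iff]
      rw [← AddCircle.coe_nsmul, ← AddCircle.coe_sub, nsmul_eq_mul, ← sub_sub]
      push_cast
      exact not_lt.1 hlt
  have hs := two_mul_sum_neg_one_pow_mul_floor hQ hQe hPQ ((q + 1) * τ - ω / 2)
  obtain ⟨m, rfl⟩ := hQe
  rw [← two_mul] at *
  rw [phaseMap_iterate_coe, phaseLift_iterate_two_mul,
    Finset.sum_congr rfl fun i hi => by rw [hfl i hi], hs]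
  congr 1
  push_cast
  ring

theorem phaseMap_iterate_of_notMem_or {q : ℕ} {ω : ℝ} {P : ℤ} {Q : ℕ} (hQ : 0 < Q)
    (hQe : Even Q) (hPQ : IsCoprime P (Q : ℤ)) {y : UnitAddCircle}
    (hy : y ∉ exceptional q ω P Q) :
    (phaseMap q ω)^[Q] y = y + ((1 / (q + 1) : ℝ) : UnitAddCircle) +
        ((-(Q * ω - P) / (q + 1) : ℝ) : UnitAddCircle) ∨
      (phaseMap q ω)^[Q] (y + ((1 / (q + 1) : ℝ) : UnitAddCircle)) =
        y + ((-(Q * ω - P) / (q + 1) : ℝ) : UnitAddCircle) := by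
  have hq : (q : ℝ) + 1 ≠ 0 := by positivity
  have hy' := (add_mem_exceptional_iff q ω P Q y).not.2 hy
  rw [← coe_rep y] at hy hy' ⊢
  rw [← AddCircle.coe_add] at hy' ⊢
  rw [phaseMap_iterate_of_notMem hQ hQe hPQ hy, phaseMap_iterate_of_notMem hQ hQe hPQ hy',
    ← AddCircle.coe_add, ← AddCircle.coe_add]
  rcases Nat.even_or_odd ⌊Q * ((q + 1) * rep y - ω / 2)⌋.natAbs with h | h
  · left
    rw [h.neg_one_pow]
    congr 1
    push_cast
    ring
  · right
    have h1 : (Q : ℝ) * ((q + 1) * (rep y + 1 / (q + 1)) - ω / 2) =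
        Q * ((q + 1) * rep y - ω / 2) + (Q : ℤ) := by
      push_cast
      field_simp
      ring
    have h2 : Odd (⌊Q * ((q + 1) * rep y - ω / 2)⌋ + (Q : ℤ)).natAbs := by
      rw [Int.natAbs_odd] at h ⊢
      exact h.add_even (by exact_mod_cast hQe)
    rw [h1, Int.floor_add_intCast, h2.neg_one_pow]
    congr 1
    push_cast
    ring

/-- The frequencies which are irrational and are extremely well approximated by rational numbers
with even denominators. -/
def IsGood (ω : ℝ) : Prop :=
  Irrational ω ∧ ∀ ε > 0, ∃ (P : ℤ) (Q : ℕ), 0 < Q ∧ Even Q ∧ IsCoprime P (Q : ℤ) ∧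
    Q * |Q * ω - P| < ε

open scoped symmDiff

theorem mem_iterate_iff_of_preimage_eq {α : Type*} {T : α → α} {S : Set α} (h : T ⁻¹' S = S)
    (n : ℕ) (y : α) : T^[n] y ∈ S ↔ y ∈ S := by
  conv_rhs => rw [← Function.IsFixedPt.preimage_iterate (show Function.IsFixedPt _ S from h) n]
  rfl

/-- A set invariant under the phase map is almost invariant under the translation by
`1 / (q + 1)`. -/
theorem preimage_add_ae_eq {q : ℕ} (hq : 0 < q) {ω : ℝ} (hω : IsGood ω) {S : Set UnitAddCircle}
    (hS : MeasurableSet S) (hTS : phaseMap q ω ⁻¹' S = S) :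
    (· + ((1 / (q + 1) : ℝ) : UnitAddCircle)) ⁻¹' S =ᵐ[volume] S := by
  have hq1 : (1 : ℝ) ≤ q + 1 := by linarith [(Nat.cast_nonneg q : (0 : ℝ) ≤ q)]
  set v := ((1 / (q + 1) : ℝ) : UnitAddCircle) with hv
  choose P Q hQ hQe hPQ hε using fun n : ℕ =>
    hω.2 (1 / ((n : ℝ) + 1)) Nat.one_div_pos_of_nat
  set a : ℕ → UnitAddCircle := fun n => ((-(Q n * ω - P n) / (q + 1) : ℝ) : UnitAddCircle) with ha
  have hlim : Tendsto (fun n : ℕ => 1 / ((n : ℝ) + 1)) atTop (nhds 0) :=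
    tendsto_one_div_add_atTop_nhds_zero_nat
  have haux : Tendsto a atTop (nhds 0) := by
    have h1 : Tendsto (fun n => (-(Q n * ω - P n) / (q + 1) : ℝ)) atTop (nhds 0) := by
      refine squeeze_zero_norm (fun n => ?_) hlim
      have h2 : (1 : ℝ) ≤ Q n := by exact_mod_cast hQ n
      rw [Real.norm_eq_abs, abs_div, abs_neg, abs_of_pos (by linarith : (0 : ℝ) < q + 1)]
      calc |Q n * ω - P n| / (q + 1) ≤ |Q n * ω - P n| := div_le_self (abs_nonneg _) hq1
        _ ≤ Q n * |Q n * ω - P n| := le_mul_of_one_le_left (abs_nonneg _) h2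
        _ ≤ _ := (hε n).le
    have h2 := ((AddCircle.continuous_mk' (1 : ℝ)).tendsto 0).comp h1
    exact h2
  set A : ℕ → C(UnitAddCircle, UnitAddCircle) := fun n => ⟨fun y => y + a n, by fun_prop⟩ with hA
  have hAlim : Tendsto A atTop (nhds (ContinuousMap.id _)) := by
    set F : C(UnitAddCircle, C(UnitAddCircle, UnitAddCircle)) :=
      ContinuousMap.curry ⟨fun p : UnitAddCircle × UnitAddCircle => p.2 + p.1, by fun_prop⟩
    have h1 := (F.continuous.tendsto 0).comp haux
    have h2 : F 0 = ContinuousMap.id _ := by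
      ext y
      exact add_zero y
    rw [h2] at h1
    exact h1
  have hD := tendsto_measure_symmDiff_preimage_nhds_zero (μ := volume) (ν := volume) hAlim
    (Eventually.of_forall fun n => measurePreserving_add_right volume (a n))
    (MeasurePreserving.id _) hS.nullMeasurableSet (measure_ne_top _ S)
  have hE : Tendsto (fun n => volume (exceptional q ω (P n) (Q n))) atTop (nhds 0) := by
    have h1 : Tendsto (fun n : ℕ => ENNReal.ofReal (2 * (1 / ((n : ℝ) + 1)))) atTop (nhds 0) := by
      have h2 := (ENNReal.continuous_ofReal.tendsto _).comp (hlim.const_mul 2)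
      rw [mul_zero, ENNReal.ofReal_zero] at h2
      exact h2
    refine tendsto_of_tendsto_of_tendsto_of_le_of_le tendsto_const_nhds h1 (fun _ => zero_le)
      fun n => ?_
    refine (volume_exceptional_le hq _ _ _).trans (ENNReal.ofReal_le_ofReal ?_)
    have := hε n
    rw [mul_assoc]
    linarith
  rw [← measure_symmDiff_eq_zero_iff]
  refine le_antisymm ?_ zero_le
  have htot := (hE.add hD).add hD
  rw [add_zero, add_zero] at htot
  refine ge_of_tendsto' htot fun n => ?_
  have hsub : ((· + v) ⁻¹' S) ∆ S ⊆ exceptional q ω (P n) (Q n) ∪ (A n ⁻¹' S) ∆ S ∪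
      (· + v) ⁻¹' ((A n ⁻¹' S) ∆ S) := by
    intro y hy
    by_contra hcon
    simp only [Set.mem_union, Set.mem_symmDiff, Set.mem_preimage, not_or] at hcon hy
    obtain ⟨⟨hc1, hc2⟩, hc3⟩ := hcon
    have e2 : y + a n ∈ S ↔ y ∈ S := by
      change ¬ (y + a n ∈ S ∧ _) ∧ ¬ (_ ∧ y + a n ∉ S) at hc2
      tauto
    have e3 : y + v + a n ∈ S ↔ y + v ∈ S := by
      change ¬ (y + v + a n ∈ S ∧ _) ∧ ¬ (_ ∧ y + v + a n ∉ S) at hc3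
      tauto
    rcases phaseMap_iterate_of_notMem_or (hQ n) (hQe n) (hPQ n) hc1 with h | h
    · have := mem_iterate_iff_of_preimage_eq hTS (Q n) y
      rw [h] at this
      change y + v + a n ∈ S ↔ _ at this
      tauto
    · have := mem_iterate_iff_of_preimage_eq hTS (Q n) (y + v)
      rw [h] at this
      change y + a n ∈ S ↔ _ at this
      tauto
  refine (measure_mono hsub).trans ((measure_union_le _ _).trans ?_)
  rw [measure_preimage_add_right]
  exact add_le_add_left (measure_union_le _ _) _

theorem ergodic_phaseMap {q : ℕ} (hq : 0 < q) {ω : ℝ} (hω : IsGood ω) :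
    Ergodic (phaseMap q ω) := by
  have hq0 : (q : ℝ) + 1 ≠ 0 := by positivity
  refine { measurePreserving_phaseMap q ω with aeconst_set := fun S hS hTS => ?_ }
  set v := ((1 / (q + 1) : ℝ) : UnitAddCircle) with hv
  set r := ((-ω / (q + 1) : ℝ) : UnitAddCircle) with hr
  have hV : ∀ᵐ y, y + v ∈ S ↔ y ∈ S :=
    (preimage_add_ae_eq hq hω hS hTS).mono fun y hy => iff_of_eq hy
  have hV1 : ∀ᵐ y, ∀ k : ℤ, y + r + k • v + v ∈ S ↔ y + r + k • v ∈ S := by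
    rw [ae_all_iff]
    intro k
    have h := (measurePreserving_add_right volume (r + k • v)).quasiMeasurePreserving.ae hV
    filter_upwards [h] with y hy
    rwa [← add_assoc] at hy
  have hR : (· + r) ⁻¹' S =ᵐ[volume] S := by
    filter_upwards [hV1] with y hy
    have hk (k : ℤ) : y + r + k • v ∈ S ↔ y + r ∈ S := by
      induction k using Int.induction_on with
      | zero => simp
      | succ k ih => rw [add_zsmul, one_zsmul, ← add_assoc, hy, ih]
      | pred k ih =>
        rw [← ih, ← hy, add_assoc, ← add_one_zsmul, sub_add_cancel]
    have h1 := mem_iterate_iff_of_preimage_eq hTS 1 y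
    rw [Function.iterate_one, phaseMap_eq_add] at h1
    have h2 : (((q - ω - 2 * ⌊(q + 1) * rep y - ω / 2⌋) / (q + 1) : ℝ) : UnitAddCircle) =
        r + (q - 2 * ⌊(q + 1) * rep y - ω / 2⌋ : ℤ) • v := by
      rw [hr, hv, ← AddCircle.coe_zsmul, ← AddCircle.coe_add, zsmul_eq_mul]
      congr 1
      push_cast
      field_simp
      ring
    rw [h2, ← add_assoc, hk] at h1
    exact propext h1
  have herg : Ergodic (· + r) := by
    rw [AddCircle.ergodic_add_right, addOrderOf_eq_zero_iff, hr,
      AddCircle.not_isOfFinAddOrder_iff_forall_rat_ne_div]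
    intro p hp
    refine hω.1 ⟨-p * (q + 1), ?_⟩
    push_cast
    rw [hp]
    field_simp
  exact herg.quasiErgodic.aeconst_set₀ hS.nullMeasurableSet hR

theorem exists_even_approx_of_odd {a : ℤ} {b : ℕ} (hb : Odd b) (hab : IsCoprime a (b : ℤ)) :
    ∃ (P : ℤ) (Q : ℕ), b ≤ Q ∧ Q ≤ 4 * b ∧ Even Q ∧ P * b - a * Q = 1 := by
  have hb0 : (0 : ℤ) < b := by exact_mod_cast hb.pos
  have h2 : IsCoprime (2 : ℤ) b := by
    rw [Int.isCoprime_iff_gcd_eq_one]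
    exact (Nat.coprime_two_left (n := b)).2 hb
  obtain ⟨u, w, huw⟩ := h2.mul_left hab
  have hm0 := Int.emod_nonneg (-u) hb0.ne'
  have hm1 := Int.emod_lt_of_pos (-u) hb0
  have hm2 := Int.emod_add_mul_ediv (-u) b
  have hc : ((((-u) % (b : ℤ)).toNat : ℕ) : ℤ) = (-u) % b := Int.toNat_of_nonneg hm0
  refine ⟨w + 2 * a - 2 * a * (-u / b), 2 * (b + ((-u) % (b : ℤ)).toNat), by omega, by omega,
    even_two_mul _, ?_⟩
  push_cast
  rw [hc]
  linear_combination huw - 2 * a * hm2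

theorem exists_even_approx {ω : ℝ} (hω : Irrational ω) (N : ℕ) :
    ∃ (P : ℤ) (Q : ℕ), N ≤ Q ∧ 0 < Q ∧ Even Q ∧ IsCoprime P (Q : ℤ) ∧
      |ω - P / Q| ≤ 20 / (Q : ℝ) ^ 2 := by
  obtain ⟨p, hpN, hp⟩ : ∃ p : ℚ, N < p.den ∧ |ω - p| ≤ 1 / (p.den : ℝ) ^ 2 := by
    obtain ⟨ε, hε, hε0⟩ := ((hω.eventually_forall_le_dist_cast_rat_of_den_le N).filter_mono
      nhdsWithin_le_nhds |>.and (self_mem_nhdsWithin (s := Set.Ioi (0 : ℝ)))).exists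
    obtain ⟨n, hn⟩ := exists_nat_gt (1 / ε)
    have hn0 : (0 : ℝ) < n := (one_div_pos.2 hε0).trans hn
    obtain ⟨p, hp, hpn⟩ := Real.exists_rat_abs_sub_le_and_den_le ω (Nat.cast_pos.1 hn0)
    have hd : (1 : ℝ) ≤ p.den := by exact_mod_cast p.pos
    have hdn : (p.den : ℝ) ≤ n := by exact_mod_cast hpn
    refine ⟨p, ?_, hp.trans ?_⟩
    · by_contra! hcon
      have h1 := (hε p hcon).trans hp
      have h2 : 1 / ((n + 1) * (p.den : ℝ)) ≤ 1 / (n : ℝ) :=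
        one_div_le_one_div_of_le hn0 (by nlinarith)
      have h3 := (one_div_lt hε0 hn0).1 hn
      linarith
    · exact one_div_le_one_div_of_le (by positivity) (by nlinarith)
  have hb : (0 : ℝ) < p.den := by exact_mod_cast p.pos
  have hcop : IsCoprime p.num (p.den : ℤ) := by
    rw [Int.isCoprime_iff_gcd_eq_one]
    exact p.reduced
  have hpc : (p : ℝ) = p.num / p.den := Rat.cast_def p
  rcases Nat.even_or_odd p.den with he | ho
  · refine ⟨p.num, p.den, hpN.le, p.pos, he, hcop, ?_⟩
    rw [← hpc]
    refine hp.trans ?_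
    gcongr
    norm_num
  · obtain ⟨P, Q, hbQ, hQb, hQe, hPQ⟩ := exists_even_approx_of_odd ho hcop
    have hQ : 0 < Q := p.pos.trans_le hbQ
    have hQ' : (0 : ℝ) < Q := by exact_mod_cast hQ
    refine ⟨P, Q, hpN.le.trans hbQ, hQ, hQe, ⟨p.den, -p.num, by linear_combination hPQ⟩, ?_⟩
    have h1 : (p : ℝ) - P / Q = -1 / (p.den * Q) := by
      have : (P : ℝ) * p.den - p.num * Q = 1 := by exact_mod_cast hPQ
      rw [hpc]
      field_simp
      linear_combination -this
    have h2 : |ω - P / Q| ≤ 1 / (p.den : ℝ) ^ 2 + 1 / (p.den * Q) := by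
      calc |ω - P / Q| ≤ |ω - p| + |(p : ℝ) - P / Q| := abs_sub_le _ _ _
        _ ≤ _ := by
          rw [h1, abs_div, abs_neg, abs_one, abs_of_pos (mul_pos hb hQ')]
          gcongr
    refine h2.trans ?_
    have h3 : (Q : ℝ) ≤ 4 * p.den := by exact_mod_cast hQb
    rw [div_add_div _ _ (by positivity) (by positivity), div_le_div_iff₀ (by positivity)
      (by positivity)]
    have h4 : (0 : ℝ) ≤ (4 * p.den - Q) * (5 * p.den + Q) :=
      mul_nonneg (by linarith) (by positivity)
    have h5 := mul_nonneg h4 (mul_pos hb hQ').le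
    nlinarith [mul_nonneg (mul_nonneg (mul_nonneg hb.le hQ'.le) hb.le) hQ'.le,
      mul_nonneg (mul_nonneg (mul_nonneg hb.le hQ'.le) hb.le) hb.le]

theorem ae_isGood : ∀ᵐ ω : ℝ, IsGood ω := by
  set s : ℕ → Set ℝ := fun Q => {x | Even Q ∧ 0 < Q ∧ ∃ P : ℤ, IsCoprime P (Q : ℤ) ∧ x = P / Q}
    with hs
  set r : ℕ → ℝ := fun Q => 20 / (Q : ℝ) ^ 2 with hr
  have hr0 : Tendsto r atTop (nhds 0) :=
    tendsto_const_nhds.div_atTop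
      ((tendsto_pow_atTop two_ne_zero).comp tendsto_natCast_atTop_atTop)
  have hirr : ∀ᵐ ω : ℝ, Irrational ω :=
    (Set.countable_range ((↑) : ℚ → ℝ)).ae_notMem volume
  have hmem (n : ℕ) : ∀ᵐ ω : ℝ, ∃ᶠ Q in atTop,
      ω ∈ Metric.cthickening (1 / ((n : ℝ) + 1) * r Q) (s Q) := by
    have h := blimsup_cthickening_mul_ae_eq volume (fun _ => True) s
      (M := 1 / ((n : ℝ) + 1)) Nat.one_div_pos_of_nat r hr0
    simp only [blimsup_true] at h
    filter_upwards [h, hirr] with ω hω hi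
    have h1 : ω ∈ limsup (fun Q => Metric.cthickening (r Q) (s Q)) atTop := by
      rw [mem_limsup_iff_frequently_mem, frequently_atTop]
      intro N
      obtain ⟨P, Q, hNQ, hQ, hQe, hPQ, hd⟩ := exists_even_approx hi N
      exact ⟨Q, hNQ, Metric.mem_cthickening_of_dist_le ω (P / Q) _ _ ⟨hQe, hQ, P, hPQ, rfl⟩ hd⟩
    have h2 : ω ∈ limsup (fun Q => Metric.cthickening (1 / ((n : ℝ) + 1) * r Q) (s Q)) atTop :=
      (iff_of_eq hω).2 h1
    rwa [mem_limsup_iff_frequently_mem] at h2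
  filter_upwards [ae_all_iff.2 hmem, hirr] with ω hω hi
  refine ⟨hi, fun ε hε => ?_⟩
  obtain ⟨n, hn⟩ := exists_nat_one_div_lt (show 0 < ε / 20 by positivity)
  obtain ⟨Q, hQ⟩ := (hω n).exists
  rcases (s Q).eq_empty_or_nonempty with he | ⟨x, hQe, hQ0, -⟩
  · rw [he, Metric.cthickening_empty] at hQ
    exact hQ.elim
  have hQ' : (0 : ℝ) < Q := by exact_mod_cast hQ0
  have hlt : 1 / ((n : ℝ) + 1) * r Q < ε / (Q : ℝ) ^ 2 := by
    rw [hr]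
    calc 1 / ((n : ℝ) + 1) * (20 / (Q : ℝ) ^ 2) < ε / 20 * (20 / (Q : ℝ) ^ 2) := by gcongr
      _ = _ := by field_simp
  have hth := Metric.cthickening_subset_thickening' (by positivity) hlt _ hQ
  obtain ⟨_, ⟨-, -, P, hPQ, rfl⟩, hd⟩ := Metric.mem_thickening_iff.1 hth
  refine ⟨P, Q, hQ0, hQe, hPQ, ?_⟩
  rw [Real.dist_eq, lt_div_iff₀ (by positivity)] at hd
  calc Q * |Q * ω - P| = |ω - P / Q| * (Q : ℝ) ^ 2 := by
        rw [show Q * ω - P = Q * (ω - P / Q) by field_simp, abs_mul, abs_of_pos hQ']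
        ring
    _ < ε := hd

/-- The map describing one collision, with kick strength `c`. -/
noncomputable def kickMap (c : ℝ) (p : ℝ × ℝ) : ℝ × ℝ :=
  (Int.fract (p.1 - p.2 / 2), p.2 + c * (2 * Int.fract (p.1 - p.2 / 2) - 1))

theorem measurable_kickMap (c : ℝ) : Measurable (kickMap c) := by
  unfold kickMap
  fun_prop

/-- The complete Poincaré map, in the momentum units for which the kicks are `2 q / (q + 1)`
and `-2 q`. -/
noncomputable def poincareMap (q : ℕ) : ℝ × ℝ → ℝ × ℝ :=
  kickMap (-(2 * q)) ∘ kickMap (2 * q / (q + 1))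

theorem measurable_poincareMap (q : ℕ) : Measurable (poincareMap q) :=
  (measurable_kickMap _).comp (measurable_kickMap _)

theorem poincareMap_eq {q : ℕ} {ω : ℝ} {y : UnitAddCircle} {p : ℝ × ℝ} {K : ℤ}
    (h1 : Int.fract p.1 = rep y) (h2 : p.2 = ω + 2 * q * K - 2 * q * rep y) :
    poincareMap q p = (rep (phaseMap q ω y),
      ω + 2 * q * (K + levelShift q ω y : ℤ) - 2 * q * rep (phaseMap q ω y)) := by
  have hq : (q : ℝ) + 1 ≠ 0 := by positivity
  set m := ⌊(q + 1) * rep y - ω / 2⌋ with hm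
  have hx : Int.fract (p.1 - p.2 / 2) = (q + 1) * rep y - ω / 2 - m := by
    rw [hm, Int.self_sub_floor, h2, ← h1, Int.fract_eq_fract]
    refine ⟨⌊p.1⌋ - q * K, ?_⟩
    push_cast
    rw [← Int.self_sub_fract]
    ring
  have hJ : (kickMap (2 * q / (q + 1)) p) = ((q + 1) * rep y - ω / 2 - m,
      ω + 2 * q * K - 2 * q * rep y +
        2 * q / (q + 1) * (2 * ((q + 1) * rep y - ω / 2 - m) - 1)) := by
    rw [kickMap, hx, h2]
  have hL : phaseLift q ω (rep y) = rep y + (q - ω - 2 * m) / (q + 1) := by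
    rw [phaseLift, hm]
  have hy : Int.fract ((q + 1) * rep y - ω / 2 - m - (ω + 2 * q * K - 2 * q * rep y +
      2 * q / (q + 1) * (2 * ((q + 1) * rep y - ω / 2 - m) - 1)) / 2) = rep (phaseMap q ω y) := by
    rw [rep_phaseMap, Int.fract_eq_fract]
    refine ⟨m - q * K, ?_⟩
    rw [hL]
    push_cast
    field_simp
    ring
  rw [poincareMap, Function.comp_apply, hJ, kickMap]
  simp only [hy, Prod.mk.injEq, true_and]
  have hf : (levelShift q ω y : ℝ) = phaseLift q ω (rep y) - rep (phaseMap q ω y) := by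
    rw [rep_phaseMap, levelShift, Int.self_sub_fract]
  push_cast
  rw [hf, hL]
  field_simp
  ring

theorem poincareMap_iterate (q : ℕ) (ω τ : ℝ) (N : ℕ) :
    Int.fract ((poincareMap q)^[N] (τ, ω - 2 * q * τ)).1 =
        rep ((phaseMap q ω)^[N] (τ : UnitAddCircle)) ∧
      ((poincareMap q)^[N] (τ, ω - 2 * q * τ)).2 = ω + 2 * q *
        (-⌊τ⌋ + birkhoffSum (phaseMap q ω) (levelShift q ω) N (τ : UnitAddCircle) : ℤ) -
          2 * q * rep ((phaseMap q ω)^[N] (τ : UnitAddCircle)) := by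
  induction N with
  | zero =>
    simp only [Function.iterate_zero, id_eq, rep_coe, birkhoffSum_zero, add_zero, true_and]
    push_cast
    rw [← Int.self_sub_floor]
    ring
  | succ N ih =>
    rw [Function.iterate_succ_apply', Function.iterate_succ_apply', poincareMap_eq ih.1 ih.2,
      birkhoffSum_succ, add_assoc]
    exact ⟨Int.fract_eq_self.2 ⟨rep_nonneg (phaseMap q ω _), rep_lt_one (phaseMap q ω _)⟩, rfl⟩

theorem abs_poincareMap_iterate_sub_lt {q : ℕ} (hq : 0 < q) {ω τ : ℝ} {N : ℕ}
    (h : birkhoffSum (phaseMap q ω) (levelShift q ω) N (τ : UnitAddCircle) = 0) :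
    |((poincareMap q)^[N] (τ, ω - 2 * q * τ)).2 - (ω - 2 * q * τ)| < 2 * q := by
  have hq' : (0 : ℝ) < q := by exact_mod_cast hq
  rw [(poincareMap_iterate q ω τ N).2, h, add_zero]
  set z := (phaseMap q ω)^[N] (τ : UnitAddCircle)
  have h0 := rep_nonneg z
  have h1 := rep_lt_one z
  have h2 := Int.fract_nonneg τ
  have h3 := Int.fract_lt_one τ
  have h4 : ω + 2 * q * (-⌊τ⌋ : ℤ) - 2 * q * rep z - (ω - 2 * q * τ) =
      2 * q * (Int.fract τ - rep z) := by
    rw [← Int.self_sub_floor]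
    push_cast
    ring
  rw [h4, abs_mul, abs_of_pos (by positivity)]
  refine mul_lt_of_lt_one_right (by positivity) ?_
  rw [abs_lt]
  constructor <;> linarith

theorem ae_coe_of_ae {p : UnitAddCircle → Prop} (h : ∀ᵐ y : UnitAddCircle, p y) :
    ∀ᵐ τ : ℝ, p (τ : UnitAddCircle) := by
  have h1 : ∀ᵐ τ : ℝ ∂(volume.restrict (⋃ n : ℤ, Set.Ioc (n : ℝ) (n + 1))),
      p (τ : UnitAddCircle) := by
    rw [ae_restrict_iUnion_iff]
    exact fun n => (UnitAddCircle.measurePreserving_mk (n : ℝ)).quasiMeasurePreserving.ae h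
  rwa [iUnion_Ioc_intCast, Measure.restrict_univ] at h1

theorem ae_infinite_abs_poincareMap_iterate_sub_lt {q : ℕ} (hq : 0 < q) {ω : ℝ} (hω : IsGood ω) :
    ∀ᵐ τ : ℝ, {N : ℕ | |((poincareMap q)^[N] (τ, ω - 2 * q * τ)).2 - (ω - 2 * q * τ)| <
      2 * q}.Infinite := by
  have : IsProbabilityMeasure (volume : Measure UnitAddCircle) := ⟨UnitAddCircle.measure_univ⟩
  have h := ae_coe_of_ae ((ergodic_phaseMap hq hω).ae_infinite_birkhoffSum_eq_zero
    (measurable_levelShift q ω) (abs_levelShift_le q ω) (integral_levelShift q hq ω))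
  filter_upwards [h] with τ hτ
  exact hτ.mono fun N hN => abs_poincareMap_iterate_sub_lt hq hN

theorem measurableSet_infinite_abs_poincareMap_iterate_sub_lt (q : ℕ) :
    MeasurableSet {p : ℝ × ℝ | {N : ℕ | |((poincareMap q)^[N] p).2 - p.2| < 2 * q}.Infinite} := by
  have h : {p : ℝ × ℝ | {N : ℕ | |((poincareMap q)^[N] p).2 - p.2| < 2 * q}.Infinite} =
      limsup (fun N => {p : ℝ × ℝ | |((poincareMap q)^[N] p).2 - p.2| < 2 * q}) atTop := by
    ext p
    rw [mem_limsup_iff_frequently_mem, Nat.frequently_atTop_iff_infinite]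
    rfl
  rw [h]
  refine MeasurableSet.measurableSet_limsup fun N => ?_
  have hm := (((measurable_poincareMap q).iterate N).snd.sub measurable_snd).abs
  exact measurableSet_lt hm measurable_const

theorem ae_infinite_poincareMap {q : ℕ} (hq : 0 < q) :
    ∀ᵐ p : ℝ × ℝ, {N : ℕ | |((poincareMap q)^[N] p).2 - p.2| < 2 * q}.Infinite := by
  set G := {p : ℝ × ℝ | {N : ℕ | |((poincareMap q)^[N] p).2 - p.2| < 2 * q}.Infinite} with hG
  have hGm : MeasurableSet G := measurableSet_infinite_abs_poincareMap_iterate_sub_lt q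
  have hΨ : Measurable fun z : ℝ × ℝ => (z.2, z.1 - 2 * q * z.2) := by fun_prop
  have h1 : ∀ᵐ z : ℝ × ℝ, (z.2, z.1 - 2 * q * z.2) ∈ G :=
    (Measure.ae_prod_iff_ae_ae (hΨ hGm)).2
      (ae_isGood.mono fun ω hω => ae_infinite_abs_poincareMap_iterate_sub_lt hq hω)
  have h2 : MeasurePreserving fun p : ℝ × ℝ => (p.1, p.2 + 2 * q * p.1) :=
    MeasurePreserving.skew_product (g := fun x y : ℝ => y + 2 * q * x)
      (MeasurePreserving.id volume) (by fun_prop)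
      (Eventually.of_forall fun x => map_add_right_eq_self volume (2 * q * x))
  have h3 : MeasurePreserving (Prod.swap : ℝ × ℝ → ℝ × ℝ) := Measure.measurePreserving_swap
  filter_upwards [(h3.comp h2).quasiMeasurePreserving.ae h1] with p hp
  simpa [hG] using hp

end FermiUlam

/-- Recurrence half of the recurrence theorem for the classical piecewise
linear Fermi–Ulam accelerator under `q`-resonance (`B = (q+1)A`): almost every
orbit of the complete Poincaré map `P = P₂ ∘ P₁` returns infinitely often to
within distance `2q` of its initial momentum. -/
theorem almost_every_orbit_recurrent
    (q : ℕ) (hq : 0 < q)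
    (A B T : ℝ) (hA : 0 < A) (hB : B = (q + 1) * A) (hT : 0 < T)
    (k 𝒯 : ℝ) (hk : k = (B - A) / T) (h𝒯 : 𝒯 = T / (A * B))
    (P₁ P₂ P : ℝ × ℝ → ℝ × ℝ)
    (hP₁ : ∀ τ I : ℝ, P₁ (τ, I) =
      (Int.fract (τ - I/2), I + 2*A*k*𝒯 * (2 * Int.fract (τ - I/2) - 1)))
    (hP₂ : ∀ τ I : ℝ, P₂ (τ, I) =
      (Int.fract (τ - I/2), I - 2*B*k*𝒯 * (2 * Int.fract (τ - I/2) - 1)))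
    (hP : P = P₂ ∘ P₁) :
    ∀ᵐ p : ℝ × ℝ, {N : ℕ | |(P^[N] p).2 - p.2| < 2 * q}.Infinite := by
  have hq' : (q : ℝ) + 1 ≠ 0 := by positivity
  have e1 : 2 * A * k * 𝒯 = 2 * q / (q + 1) := by
    rw [hk, h𝒯, hB]
    field_simp
    ring
  have e2 : 2 * B * k * 𝒯 = 2 * q := by
    rw [hk, h𝒯, hB]
    field_simp
    ring
  have hP₁' : P₁ = FermiUlam.kickMap (2 * q / (q + 1)) := by
    funext ⟨τ, I⟩
    rw [hP₁, e1, FermiUlam.kickMap]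
  have hP₂' : P₂ = FermiUlam.kickMap (-(2 * q)) := by
    funext ⟨τ, I⟩
    rw [hP₂, e2, FermiUlam.kickMap, neg_mul, ← sub_eq_add_neg]
  rw [hP, hP₁', hP₂']
  exact FermiUlam.ae_infinite_poincareMap hq
end
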